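/- Assume a ≥ 2 and b ≥ 2, and set d = ab. Every homogeneous polynomial in R of degree at least d−1 belongs to the ideal power I_{a,b}^{b−1}, and there exists a homogeneous polynomial in R of degree d−2 that does not belong to I_{a,b}^{b−1}. (Equivalently, the Castelnuovo–Mumford regularity of I_{a,b}^{b−1} equals d−1; consequence of Theorem 4.2.) -/

import Mathlib

open MvPolynomial

/-- The generic binary form `G = ∑_{i=0}^{b} u_i x^i y^{b-i}` of degree `b`,
viewed as a polynomial in two variables `x = X 0`, `y = X 1` with coefficients in
`R = MvPolynomial (Fin (b+1)) ℂ`. -/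
noncomputable def genForm (b : ℕ) : MvPolynomial (Fin 2) (MvPolynomial (Fin (b + 1)) ℂ) :=
  ∑ i : Fin (b + 1),
    MvPolynomial.C (MvPolynomial.X i) *
      MvPolynomial.X (0 : Fin 2) ^ (i : ℕ) * MvPolynomial.X (1 : Fin 2) ^ (b - (i : ℕ))

/-- The coefficient `c_j ∈ R` of `x^j y^{ab-j}` in `G^a`. -/
noncomputable def coeffC (a b j : ℕ) : MvPolynomial (Fin (b + 1)) ℂ :=
  MvPolynomial.coeff
    (Finsupp.single (0 : Fin 2) j + Finsupp.single (1 : Fin 2) (a * b - j))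
    (genForm b ^ a)

/-- The ideal `I_{a,b} ⊆ R` generated by the coefficients `c_0, …, c_d` of `G^a`,
where `d = ab`. -/
noncomputable def Iab (a b : ℕ) : Ideal (MvPolynomial (Fin (b + 1)) ℂ) :=
  Ideal.span (Set.range fun j : Fin (a * b + 1) => coeffC a b (j : ℕ))

set_option linter.unusedSectionVars false

namespace PowCoeff

/-- The ideal generated by the variables `X i` with `i < j`. -/
noncomputable def lowIdeal (b j : ℕ) : Ideal (MvPolynomial (Fin (b + 1)) ℂ) :=
  Ideal.span (X '' {i : Fin (b + 1) | (i : ℕ) < j})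

theorem mem_lowIdeal {b j : ℕ} {p : MvPolynomial (Fin (b + 1)) ℂ} :
    p ∈ lowIdeal b j ↔ ∀ m ∈ p.support, ∃ i : Fin (b + 1), (i : ℕ) < j ∧ m i ≠ 0 := by
  simp [lowIdeal, mem_ideal_span_X_image]

theorem X_mem_lowIdeal {b j : ℕ} {i : Fin (b + 1)} (h : (i : ℕ) < j) :
    (X i : MvPolynomial (Fin (b + 1)) ℂ) ∈ lowIdeal b j :=
  Ideal.subset_span ⟨i, h, rfl⟩

theorem lowIdeal_mono {b j k : ℕ} (h : j ≤ k) : lowIdeal b j ≤ lowIdeal b k :=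
  Ideal.span_mono (Set.image_mono fun _ hi => lt_of_lt_of_le hi h)

theorem mem_lowIdeal_of_X_mul {b : ℕ} {j : Fin (b + 1)} {p : MvPolynomial (Fin (b + 1)) ℂ}
    (h : X j * p ∈ lowIdeal b j) : p ∈ lowIdeal b j := by
  rw [mem_lowIdeal] at h ⊢
  intro m hm
  obtain ⟨i, hi, h2⟩ := h (Finsupp.single j 1 + m) (by
    rw [mem_support_iff, coeff_X_mul]; exact mem_support_iff.1 hm)
  refine ⟨i, hi, ?_⟩
  have : j ≠ i := by rintro rfl; exact lt_irrefl _ hi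
  simpa [this] using h2

theorem mem_lowIdeal_of_X_pow_mul {b : ℕ} {j : Fin (b + 1)} {p : MvPolynomial (Fin (b + 1)) ℂ}
    (M : ℕ) (h : X j ^ M * p ∈ lowIdeal b j) : p ∈ lowIdeal b j := by
  induction M with
  | zero => simpa using h
  | succ M ih =>
    refine ih (mem_lowIdeal_of_X_mul (j := j) ?_)
    rw [← mul_assoc, ← pow_succ']; exact h

theorem exists_sub_X_mul_mem_lowIdeal {b : ℕ} {j : Fin (b + 1)}
    {p : MvPolynomial (Fin (b + 1)) ℂ} (h : p ∈ lowIdeal b (j + 1)) :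
    ∃ q : MvPolynomial (Fin (b + 1)) ℂ, p - X j * q ∈ lowIdeal b j ∧
      ∀ m ∈ q.support, Finsupp.single j 1 + m ∈ p.support := by
  refine ⟨p.divMonomial (Finsupp.single j 1), ?_, fun m hm => ?_⟩
  · have h1 : p - X j * (p.divMonomial (Finsupp.single j 1)) = p.modMonomial (Finsupp.single j 1) := by
      conv_lhs => enter [1]; rw [← divMonomial_add_modMonomial_single p j]
      ring
    rw [h1, mem_lowIdeal]
    intro m hm
    rw [mem_support_iff] at hm
    by_cases hj : Finsupp.single j 1 ≤ m
    · exact absurd (coeff_modMonomial_of_le _ hj) hm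
    · rw [coeff_modMonomial_of_not_le _ hj] at hm
      obtain ⟨i, hi, h2⟩ := mem_lowIdeal.1 h m (mem_support_iff.2 hm)
      refine ⟨i, ?_, h2⟩
      have : i ≠ j := by
        rintro rfl
        exact hj (by simpa [Finsupp.single_le_iff] using Nat.one_le_iff_ne_zero.2 h2)
      have : (i : ℕ) ≠ j := fun h => this (Fin.ext h)
      omega
  · rw [mem_support_iff, coeff_divMonomial] at hm
    exact mem_support_iff.2 hm

/-- Coordinatewise membership in `lowIdeal`. -/
def LowVec {b : ℕ} {ι : Type*} (j : ℕ) (v : ι → MvPolynomial (Fin (b + 1)) ℂ) : Prop :=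
  ∀ β, v β ∈ lowIdeal b j

section LowVec
variable {b : ℕ} {ι κ : Type*} {j : ℕ} {v w : ι → MvPolynomial (Fin (b + 1)) ℂ}

theorem LowVec.add (hv : LowVec j v) (hw : LowVec j w) : LowVec j (v + w) :=
  fun β => add_mem (hv β) (hw β)

theorem LowVec.sub (hv : LowVec j v) (hw : LowVec j w) : LowVec j (v - w) :=
  fun β => sub_mem (hv β) (hw β)

theorem LowVec.smul (r : MvPolynomial (Fin (b + 1)) ℂ) (hv : LowVec j v) : LowVec j (r • v) :=
  fun β => Ideal.mul_mem_left _ _ (hv β)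

theorem LowVec.zero : LowVec j (0 : ι → MvPolynomial (Fin (b + 1)) ℂ) :=
  fun _ => zero_mem _

theorem LowVec.mono {k : ℕ} (h : j ≤ k) (hv : LowVec j v) : LowVec k v :=
  fun β => lowIdeal_mono h (hv β)

theorem LowVec.of_X_pow_smul {j : Fin (b + 1)} (M : ℕ) (h : LowVec j ((X j ^ M : MvPolynomial (Fin (b + 1)) ℂ) • v)) :
    LowVec j v := fun β => mem_lowIdeal_of_X_pow_mul M (h β)

theorem LowVec.map (L : (ι → MvPolynomial (Fin (b + 1)) ℂ) →ₗ[MvPolynomial (Fin (b + 1)) ℂ]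
    (κ → MvPolynomial (Fin (b + 1)) ℂ)) (hv : LowVec j v) : LowVec j (L v) := by
  have h1 : ∀ β, ∃ c : Fin (b + 1) → MvPolynomial (Fin (b + 1)) ℂ,
      v β = ∑ i : Fin (b + 1), if (i : ℕ) < j then X i * c i else 0 := by
    intro β
    suffices ∀ p ∈ lowIdeal b j, ∃ c : Fin (b + 1) → MvPolynomial (Fin (b + 1)) ℂ,
        p = ∑ i : Fin (b + 1), if (i : ℕ) < j then X i * c i else 0 from this _ (hv β)
    intro p hp
    rw [lowIdeal] at hp
    induction hp using Submodule.span_induction with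
    | mem x hx =>
      obtain ⟨i, hi, rfl⟩ := hx
      refine ⟨Pi.single i 1, ?_⟩
      rw [Finset.sum_eq_single i]
      · simp [show (i : ℕ) < j from hi]
      · intro k _ hk; simp [Pi.single_eq_of_ne hk]
      · simp
    | zero => exact ⟨0, by simp⟩
    | add x y _ _ hx hy =>
      obtain ⟨c, hc⟩ := hx
      obtain ⟨e, he⟩ := hy
      refine ⟨c + e, ?_⟩
      rw [hc, he, ← Finset.sum_add_distrib]
      refine Finset.sum_congr rfl fun i _ => ?_
      split_ifs <;> simp [mul_add]
    | smul a x _ hx =>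
      obtain ⟨c, hc⟩ := hx
      refine ⟨a • c, ?_⟩
      rw [hc, smul_eq_mul, Finset.mul_sum]
      refine Finset.sum_congr rfl fun i _ => ?_
      split_ifs <;> simp; ring
  choose c hc using h1
  have h2 : v = ∑ i : Fin (b + 1), if (i : ℕ) < j then
      (X i : MvPolynomial (Fin (b + 1)) ℂ) • (fun β => c β i) else 0 := by
    funext β
    rw [hc β, Finset.sum_apply]
    refine Finset.sum_congr rfl fun i _ => ?_
    split_ifs <;> simp
  rw [h2, map_sum]
  intro β
  rw [Finset.sum_apply]
  refine sum_mem fun i _ => ?_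
  split_ifs with hi
  · rw [map_smul]
    exact Ideal.mul_mem_right _ _ (X_mem_lowIdeal hi)
  · simp

end LowVec

/-- A complex of free `ℂ[u₀, …, u_b]`-modules on a set `ι` of generators; `lvl i β` says that the
generator `β` sits in homological position `i`, and `sh β` is its internal degree. -/
structure GradedComplex (b : ℕ) (ι : Type*) where
  /-- the homological positions -/
  lvl : ℕ → ι → Prop
  /-- the internal degrees of the generators -/
  sh : ι → ℕ
  /-- the differential -/
  D : (ι → MvPolynomial (Fin (b + 1)) ℂ) →ₗ[MvPolynomial (Fin (b + 1)) ℂ]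
    (ι → MvPolynomial (Fin (b + 1)) ℂ)
  D_D : ∀ v, D (D v) = 0

namespace GradedComplex
variable {b : ℕ} {ι : Type*} (K : GradedComplex b ι)

/-- `v` is concentrated in position `i` and is homogeneous of total degree `n`. -/
def Hom (i n : ℕ) (v : ι → MvPolynomial (Fin (b + 1)) ℂ) : Prop :=
  ∀ β, ∀ m ∈ (v β).support, K.lvl i β ∧ m.degree + K.sh β = n

/-- Exactness at position `i` in degree `n` modulo the first `j` variables. -/
def Exact (i j n : ℕ) : Prop :=
  ∀ v, K.Hom i n v → LowVec j (K.D v) → ∃ y, K.Hom (i + 1) n y ∧ LowVec j (v - K.D y)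

/-- The homology at position `i` modulo the variables before `j` is `X j`-power torsion. -/
def Torsion (i : ℕ) (j : Fin (b + 1)) : Prop :=
  ∀ n v, K.Hom i n v → LowVec j (K.D v) →
    ∃ M y, K.Hom (i + 1) (n + M) y ∧
      LowVec j ((X j ^ M : MvPolynomial (Fin (b + 1)) ℂ) • v - K.D y)

/-- The differential preserves the internal degree and lowers the position by one. -/
def DHom : Prop := ∀ i n v, K.Hom (i + 1) n v → K.Hom i n (K.D v)

variable {K}

theorem Hom.sub {i n : ℕ} {v w} (hv : K.Hom i n v) (hw : K.Hom i n w) : K.Hom i n (v - w) := by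
  classical
  intro β m hm
  rcases Finset.mem_union.1 (support_sub _ _ _ hm) with h | h
  · exact hv β m h
  · exact hw β m h

theorem Hom.add {i n : ℕ} {v w} (hv : K.Hom i n v) (hw : K.Hom i n w) : K.Hom i n (v + w) := by
  classical
  intro β m hm
  rcases Finset.mem_union.1 (support_add hm) with h | h
  · exact hv β m h
  · exact hw β m h

theorem Hom.zero {i n : ℕ} : K.Hom i n 0 := by
  intro β m hm; simp at hm

theorem Hom.smul {i n e : ℕ} {v} {r : MvPolynomial (Fin (b + 1)) ℂ} (hr : r.IsHomogeneous e)
    (hv : K.Hom i n v) : K.Hom i (n + e) (r • v) := by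
  classical
  intro β m hm
  obtain ⟨m₁, h1, m₂, h2, rfl⟩ := Finset.mem_add.1 (support_mul _ _ hm)
  obtain ⟨h3, h4⟩ := hv β m₂ h2
  refine ⟨h3, ?_⟩
  have h5 : m₁.degree = e := by
    have := hr (mem_support_iff.1 h1)
    rw [← this, Finsupp.degree_eq_weight_one]; rfl
  rw [map_add, h5]; omega

theorem exists_X_smul {i n j : ℕ} (hj : j < b + 1) {v} (hv : K.Hom i (n + 1) v)
    (h : LowVec (j + 1) v) :
    ∃ w, K.Hom i n w ∧ LowVec j (v - (X ⟨j, hj⟩ : MvPolynomial (Fin (b + 1)) ℂ) • w) := by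
  choose q hq1 hq2 using fun β => exists_sub_X_mul_mem_lowIdeal (j := ⟨j, hj⟩) (h β)
  refine ⟨q, fun β m hm => ?_, fun β => by simpa using hq1 β⟩
  obtain ⟨h1, h2⟩ := hv β _ (hq2 β m hm)
  refine ⟨h1, ?_⟩
  rw [map_add, Finsupp.degree_single] at h2
  omega

theorem exact_of_torsion (hK : K.DHom) {i n : ℕ} {j : Fin (b + 1)} (ht : K.Torsion i j)
    (he : ∀ n', n < n' → K.Exact (i + 1) (j + 1) n') : K.Exact i j n := by
  intro v hv hDv
  obtain ⟨M, y, hy, h⟩ := ht n v hv hDv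
  induction M generalizing y with
  | zero => exact ⟨y, hy, by simpa using h⟩
  | succ M ih =>
    have h1 : LowVec (j + 1) (K.D y) := by
      have h2 : LowVec (j + 1) ((X j ^ (M + 1) : MvPolynomial (Fin (b + 1)) ℂ) • v) := fun β =>
        Ideal.mul_mem_right _ _ (Ideal.pow_mem_of_mem _ (X_mem_lowIdeal (by simp)) _ (by simp))
      have := h2.sub (h.mono (Nat.le_succ _))
      simpa using this
    obtain ⟨z, hz, h3⟩ := he (n + (M + 1)) (by omega) y hy h1
    obtain ⟨w, hw, h4⟩ := exists_X_smul (n := n + M) j.2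
      (show K.Hom (i + 1) (n + M + 1) (y - K.D z) from hy.sub (hK _ _ _ hz)) h3
    refine ih w hw (LowVec.of_X_pow_smul 1 ?_)
    have h5 := (h4.map K.D).add h
    convert h5 using 1
    simp only [map_sub, map_smul, K.D_D, Fin.eta, smul_sub, smul_smul, pow_succ']
    simp

theorem exact_of_torsion_top {i n : ℕ} {j : Fin (b + 1)} (hi : ∀ β, ¬ K.lvl (i + 1) β)
    (ht : K.Torsion i j) : K.Exact i j n := by
  intro v hv hDv
  obtain ⟨M, y, hy, h⟩ := ht n v hv hDv
  have hy0 : y = 0 := by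
    funext β
    by_contra h0
    obtain ⟨m, hm⟩ := Finset.nonempty_iff_ne_empty.2 (fun h => h0 (support_eq_empty.1 h))
    exact hi β (hy β m hm).1
  subst hy0
  refine ⟨0, Hom.zero, ?_⟩
  rw [map_zero, sub_zero] at h ⊢
  exact LowVec.of_X_pow_smul M h

/-- Acyclicity of a complex of length `T` whose homology is torsion. -/
theorem exact_of_lt (hK : K.DHom) {T : ℕ} (hT : ∀ β, ¬ K.lvl (T + 1) β)
    (hTb : T ≤ b + 1) (ht : ∀ i j, i ≤ T → K.Torsion i j) (s : ℕ) :
    ∀ j i n, i + s = T → j < i → K.Exact i j n := by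
  induction s with
  | zero =>
    intro j i n hi hj
    obtain rfl : i = T := by omega
    exact exact_of_torsion_top (j := ⟨j, by omega⟩) hT (ht _ _ le_rfl)
  | succ s ih =>
    intro j i n hi hj
    exact exact_of_torsion (j := ⟨j, by omega⟩) hK (ht _ _ (by omega))
      fun n' _ => ih (j + 1) (i + 1) n' (by omega) (by omega)

/-- Exactness in large degrees, starting from a bound on the degrees in position `b + 1`. -/
theorem exact_of_degree (hK : K.DHom) {S : ℕ} (hS : ∀ β, K.lvl (b + 1) β → K.sh β ≤ S)
    (ht : ∀ i j, i ≤ b → K.Torsion i j) (s : ℕ) :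
    ∀ i n, i + s = b + 1 → S < n + s → K.Exact i i n := by
  induction s with
  | zero =>
    intro i n hi hn v hv _
    refine ⟨0, Hom.zero, ?_⟩
    rw [map_zero, sub_zero]
    intro β
    rw [mem_lowIdeal]
    intro m hm
    obtain ⟨h1, h2⟩ := hv β m hm
    obtain rfl : i = b + 1 := by omega
    have h3 : m ≠ 0 := by
      rintro rfl
      have := hS β h1
      rw [map_zero] at h2
      omega
    obtain ⟨k, hk⟩ := Finsupp.ne_iff.1 h3
    exact ⟨k, k.2, hk⟩
  | succ s ih =>
    intro i n hi hn
    exact exact_of_torsion (j := ⟨i, by omega⟩) hK (ht _ _ (by omega))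
      fun n' _ => ih (i + 1) n' (by omega) (by omega)

/-- An element in position `0`, of degree `b + 1` less than a top generator, that is not a
boundary. -/
theorem exists_not_boundary (hK : K.DHom) (hT : ∀ β, ¬ K.lvl (b + 2) β) (ht : ∀ i j, i ≤ b + 1 → K.Torsion i j) {β₀ : ι}
    (hβ : K.lvl (b + 1) β₀) (hsh : ∀ β, K.lvl b β → K.sh β < K.sh β₀) (s : ℕ) :
    ∀ i n, i + s = b + 1 → n + s = K.sh β₀ →
      ∃ x, K.Hom i n x ∧ LowVec i (K.D x) ∧
        ∀ y, K.Hom (i + 1) n y → ¬ LowVec i (x - K.D y) := by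
  classical
  induction s with
  | zero =>
    intro i n hi hn
    obtain rfl : i = b + 1 := by omega
    have hx : K.Hom (b + 1) n (Pi.single β₀ 1) := by
      intro β m hm
      rcases eq_or_ne β β₀ with rfl | h
      · rw [Pi.single_eq_same, mem_support_iff, coeff_one] at hm
        have h0 : (0 : Fin (b + 1) →₀ ℕ) = m := by
          by_contra hc; exact hm (if_neg hc)
        subst h0
        exact ⟨hβ, by simpa using hn.symm⟩
      · simp [Pi.single_eq_of_ne h] at hm
    refine ⟨_, hx, ?_, ?_⟩
    · intro β
      rw [mem_lowIdeal]
      intro m hm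
      obtain ⟨h1, h2⟩ := hK _ _ _ hx β m hm
      have h3 : m ≠ 0 := by
        rintro rfl
        have := hsh β h1
        rw [map_zero] at h2
        omega
      obtain ⟨k, hk⟩ := Finsupp.ne_iff.1 h3
      exact ⟨k, k.2, hk⟩
    · intro y hy h
      have hy0 : y = 0 := by
        funext β
        by_contra h0
        obtain ⟨m, hm⟩ := Finset.nonempty_iff_ne_empty.2 (fun h => h0 (support_eq_empty.1 h))
        exact hT β (hy β m hm).1
      subst hy0
      have := h β₀
      rw [map_zero, sub_zero, Pi.single_eq_same, mem_lowIdeal] at this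
      obtain ⟨i, -, hi⟩ := this 0 (by simp)
      exact hi rfl
  | succ s ih =>
    intro i n hi hn
    obtain ⟨x, hx, hDx, hnb⟩ := ih (i + 1) (n + 1) (by omega) (by omega)
    obtain ⟨w, hw, h1⟩ := exists_X_smul (j := i) (by omega) (hK _ _ _ hx) hDx
    refine ⟨w, hw, ?_, ?_⟩
    · refine LowVec.of_X_pow_smul (j := ⟨i, by omega⟩) 1 ?_
      have := h1.map K.D
      rw [map_sub, map_smul, K.D_D, zero_sub] at this
      intro β
      simpa using this β
    · intro y hy h2
      have h3 : K.Hom (i + 1) (n + 1) (x - (X ⟨i, by omega⟩ : MvPolynomial (Fin (b + 1)) ℂ) • y) :=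
        hx.sub (hy.smul (isHomogeneous_X _ _))
      have h4 : LowVec i (K.D (x - (X ⟨i, by omega⟩ : MvPolynomial (Fin (b + 1)) ℂ) • y)) := by
        have := h1.add (h2.smul (X ⟨i, by omega⟩))
        rw [map_sub, map_smul]
        convert this using 1
        rw [smul_sub]; abel
      obtain ⟨z, hz, h5⟩ := exact_of_lt hK hT le_rfl ht s i (i + 1) (n + 1) (by omega) (by omega)
        _ h3 h4
      refine hnb z hz ?_
      intro β
      have h6 := lowIdeal_mono (Nat.le_succ i) (h5 β)
      have h7 : (X ⟨i, by omega⟩ : MvPolynomial (Fin (b + 1)) ℂ) * y β ∈ lowIdeal b (i + 1) :=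
        Ideal.mul_mem_right _ _ (X_mem_lowIdeal (by simp))
      have := add_mem h6 h7
      convert this using 1
      simp only [Pi.sub_apply, Pi.smul_apply, smul_eq_mul]; ring

end GradedComplex

section Fock
variable {R O E : Type*} [CommRing R] [LinearOrder O] [DecidableEq E]

/-- The sign `(-1)^#{i ∈ P, i < r}`. -/
def fsgn (R : Type*) [CommRing R] (r : O) (P : Finset O) : R := (-1) ^ (P.filter (· < r)).card

theorem fsgn_mul_self (r : O) (P : Finset O) : fsgn R r P * fsgn R r P = 1 := by
  rw [fsgn, ← mul_pow]; simp

theorem fsgn_insert_of_lt {r s : O} {P : Finset O} (h : s < r) (hs : s ∉ P) :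
    fsgn R r (insert s P) = -fsgn R r P := by
  rw [fsgn, fsgn, Finset.filter_insert, if_pos h, Finset.card_insert_of_notMem (by simp [hs]),
    pow_succ]
  ring

theorem fsgn_insert_of_not_lt {r s : O} {P : Finset O} (h : ¬ s < r) :
    fsgn R r (insert s P) = fsgn R r P := by
  rw [fsgn, fsgn, Finset.filter_insert, if_neg h]

theorem fsgn_erase_self (r : O) (P : Finset O) : fsgn R r (P.erase r) = fsgn R r P := by
  rw [fsgn, fsgn, Finset.filter_erase, Finset.erase_eq_of_notMem (by simp)]

/-- Vectors in the Fock space with fermions indexed by `O` and bosons indexed by `E`. -/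
abbrev Fock (R O E : Type*) := Finset O × (E → ℕ) → R

/-- Fermionic annihilation operator. -/
def an (r : O) : Module.End R (Fock R O E) where
  toFun v β := if r ∈ β.1 then 0 else fsgn R r β.1 * v (insert r β.1, β.2)
  map_add' v w := by funext β; simp only [Pi.add_apply]; split_ifs <;> ring
  map_smul' c v := by
    funext β; simp only [Pi.smul_apply, smul_eq_mul, RingHom.id_apply]; split_ifs <;> ring

/-- Fermionic creation operator. -/
def cr (r : O) : Module.End R (Fock R O E) where
  toFun v β := if r ∈ β.1 then fsgn R r β.1 * v (β.1.erase r, β.2) else 0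
  map_add' v w := by funext β; simp only [Pi.add_apply]; split_ifs <;> ring
  map_smul' c v := by
    funext β; simp only [Pi.smul_apply, smul_eq_mul, RingHom.id_apply]; split_ifs <;> ring

/-- Bosonic lowering operator. -/
def dn (j : E) : Module.End R (Fock R O E) where
  toFun v β := v (β.1, β.2 + Pi.single j 1)
  map_add' _ _ := rfl
  map_smul' _ _ := rfl

/-- Bosonic raising operator. -/
def up (j : E) : Module.End R (Fock R O E) where
  toFun v β := β.2 j * v (β.1, β.2 - Pi.single j 1)
  map_add' v w := by funext β; simp only [Pi.add_apply]; ring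
  map_smul' c v := by
    funext β; simp only [Pi.smul_apply, smul_eq_mul, RingHom.id_apply]; ring

theorem an_apply (r : O) (v : Fock R O E) (P : Finset O) (q : E → ℕ) :
    an r v (P, q) = if r ∈ P then 0 else fsgn R r P * v (insert r P, q) := rfl

theorem cr_apply (r : O) (v : Fock R O E) (P : Finset O) (q : E → ℕ) :
    cr r v (P, q) = if r ∈ P then fsgn R r P * v (P.erase r, q) else 0 := rfl

theorem dn_apply (j : E) (v : Fock R O E) (P : Finset O) (q : E → ℕ) :
    dn j v (P, q) = v (P, q + Pi.single j 1) := rfl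

theorem up_apply (j : E) (v : Fock R O E) (P : Finset O) (q : E → ℕ) :
    up j v (P, q) = q j * v (P, q - Pi.single j 1) := rfl

theorem an_mul_an (r s : O) : (an r * an s : Module.End R (Fock R O E)) = -(an s * an r) := by
  ext v ⟨P, q⟩
  simp only [Module.End.mul_apply, LinearMap.neg_apply, Pi.neg_apply, an_apply, Finset.mem_insert]
  rcases lt_trichotomy r s with h | rfl | h
  · by_cases hr : r ∈ P <;> by_cases hs : s ∈ P <;> simp [hr, hs, h.ne, h.ne']
    rw [fsgn_insert_of_lt h hr, fsgn_insert_of_not_lt h.not_gt, Finset.insert_comm]; ring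
  · simp
  · by_cases hr : r ∈ P <;> by_cases hs : s ∈ P <;> simp [hr, hs, h.ne, h.ne']
    rw [fsgn_insert_of_lt h hs, fsgn_insert_of_not_lt h.not_gt, Finset.insert_comm]; ring

theorem fsgn_erase_of_lt {r s : O} {P : Finset O} (h : s < r) (hs : s ∈ P) :
    fsgn R r (P.erase s) = -fsgn R r P := by
  conv_rhs => rw [← Finset.insert_erase hs, fsgn_insert_of_lt h (Finset.notMem_erase _ _), neg_neg]

theorem fsgn_erase_of_not_lt {r s : O} {P : Finset O} (h : ¬ s < r) :
    fsgn R r (P.erase s) = fsgn R r P := by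
  rw [fsgn, fsgn, Finset.filter_erase, Finset.erase_eq_of_notMem (by simp [h])]

theorem cr_mul_cr (r s : O) : (cr r * cr s : Module.End R (Fock R O E)) = -(cr s * cr r) := by
  ext v ⟨P, q⟩
  simp only [Module.End.mul_apply, LinearMap.neg_apply, Pi.neg_apply, cr_apply, Finset.mem_erase]
  rcases lt_trichotomy r s with h | rfl | h
  · by_cases hr : r ∈ P <;> by_cases hs : s ∈ P <;> simp [hr, hs, h.ne, h.ne']
    rw [fsgn_erase_of_lt h hr, fsgn_erase_of_not_lt h.not_gt, Finset.erase_right_comm]; ring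
  · simp
  · by_cases hr : r ∈ P <;> by_cases hs : s ∈ P <;> simp [hr, hs, h.ne, h.ne']
    rw [fsgn_erase_of_lt h hs, fsgn_erase_of_not_lt h.not_gt, Finset.erase_right_comm]; ring

theorem an_mul_cr (s r : O) : (an s * cr r : Module.End R (Fock R O E)) =
    (if r = s then 1 else 0) - cr r * an s := by
  rw [eq_sub_iff_add_eq]
  ext v ⟨P, q⟩
  simp only [Module.End.mul_apply, LinearMap.add_apply, Pi.add_apply, an_apply, cr_apply,
    Finset.mem_insert, Finset.mem_erase]
  rcases lt_trichotomy r s with h | rfl | h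
  · by_cases hr : r ∈ P <;> by_cases hs : s ∈ P <;> simp [hr, hs, h.ne, h.ne']
    rw [fsgn_erase_of_lt h hr, fsgn_insert_of_not_lt h.not_gt,
      Finset.erase_insert_of_ne h.ne']; ring
  · by_cases hr : r ∈ P <;> simp [hr, ← mul_assoc, fsgn_mul_self, fsgn_erase_self]
    rw [fsgn_insert_of_not_lt (lt_irrefl _), fsgn_mul_self, one_mul]
  · by_cases hr : r ∈ P <;> by_cases hs : s ∈ P <;> simp [hr, hs, h.ne, h.ne']
    rw [fsgn_erase_of_not_lt h.not_gt, fsgn_insert_of_lt h hs, Finset.erase_insert_of_ne h.ne]; ring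

theorem dn_mul_dn (i j : E) : (dn i * dn j : Module.End R (Fock R O E)) = dn j * dn i := by
  ext v ⟨P, q⟩
  simp only [Module.End.mul_apply, dn_apply]
  rw [add_right_comm]

theorem dn_mul_up (i j : E) : (dn i * up j : Module.End R (Fock R O E)) =
    up j * dn i + if i = j then 1 else 0 := by
  ext v ⟨P, q⟩
  simp only [Module.End.mul_apply, LinearMap.add_apply, Pi.add_apply, dn_apply, up_apply]
  rcases eq_or_ne i j with rfl | h
  · simp only [Pi.single_eq_same, add_tsub_cancel_right, if_true, Module.End.one_apply]
    rcases Nat.eq_zero_or_pos (q i) with h0 | h0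
    · simp [h0]
    · rw [tsub_add_cancel_of_le]
      · push_cast; ring
      · intro k; rcases eq_or_ne k i with rfl | hk
        · simpa using Nat.succ_le_of_lt h0
        · simp [Pi.single_eq_of_ne hk]
  · simp only [h, if_false, LinearMap.zero_apply, Pi.zero_apply, add_zero,
      Pi.single_eq_of_ne h.symm]
    congr 3
    funext k
    simp only [Pi.add_apply, Pi.sub_apply]
    rcases eq_or_ne k i with rfl | hk
    · simp [Pi.single_eq_of_ne h]
    · simp [Pi.single_eq_of_ne hk]

theorem up_mul_up (i j : E) : (up i * up j : Module.End R (Fock R O E)) = up j * up i := by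
  ext v ⟨P, q⟩
  simp only [Module.End.mul_apply, up_apply]
  rcases eq_or_ne i j with rfl | h
  · rfl
  · simp only [Pi.sub_apply, Pi.single_eq_of_ne h, Pi.single_eq_of_ne h.symm, tsub_zero]
    rw [tsub_right_comm]; ring

theorem dn_mul_an (i : E) (r : O) : (dn i * an r : Module.End R (Fock R O E)) = an r * dn i := by
  ext v ⟨P, q⟩
  simp only [Module.End.mul_apply, dn_apply, an_apply]

theorem dn_mul_cr (i : E) (r : O) : (dn i * cr r : Module.End R (Fock R O E)) = cr r * dn i := by
  ext v ⟨P, q⟩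
  simp only [Module.End.mul_apply, dn_apply, cr_apply]

theorem up_mul_an (i : E) (r : O) : (up i * an r : Module.End R (Fock R O E)) = an r * up i := by
  ext v ⟨P, q⟩
  simp only [Module.End.mul_apply, up_apply, an_apply]
  split_ifs <;> ring

theorem up_mul_cr (i : E) (r : O) : (up i * cr r : Module.End R (Fock R O E)) = cr r * up i := by
  ext v ⟨P, q⟩
  simp only [Module.End.mul_apply, up_apply, cr_apply]
  split_ifs <;> ring

variable [Fintype O] [Fintype E]

/-- The operator `∑ B r j a_r† ∂_j`. -/
def opT (B : Matrix O E R) : Module.End R (Fock R O E) := ∑ r, ∑ j, B r j • (cr r * dn j)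

/-- The operator `∑ C j r w_j a_r`. -/
def opU (C : Matrix E O R) : Module.End R (Fock R O E) := ∑ r, ∑ j, C j r • (up j * an r)

/-- The operator `∑ X r s a_r† a_s`. -/
def opF (X : Matrix O O R) : Module.End R (Fock R O E) := ∑ r, ∑ s, X r s • (cr r * an s)

/-- The operator `∑ Y i j w_i ∂_j`. -/
def opB (Y : Matrix E E R) : Module.End R (Fock R O E) := ∑ i, ∑ j, Y i j • (up i * dn j)

theorem smul_neg_mul {S A : Type*} [CommRing S] [Ring A] [Module S A] (x : S) (p q : A) :
    x • (-p * q) = -(x • (p * q)) := by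
  rw [neg_mul, smul_neg]

theorem opT_anticomm (B B' : Matrix O E R) : (opT B * opT B' : Module.End R (Fock R O E)) =
    -(opT B' * opT B) := by
  have e : ∀ B B' : Matrix O E R, (opT B * opT B' : Module.End R (Fock R O E)) =
      ∑ r, ∑ s, ∑ j, ∑ i, (B r j * B' s i) • (cr r * dn j * (cr s * dn i)) := by
    intro B B'
    simp only [opT, Finset.sum_mul_sum, smul_mul_smul_comm]
  rw [e, e, Finset.sum_comm, ← Finset.sum_neg_distrib]
  refine Finset.sum_congr rfl fun r _ => ?_
  rw [← Finset.sum_neg_distrib]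
  refine Finset.sum_congr rfl fun s _ => ?_
  rw [Finset.sum_comm, ← Finset.sum_neg_distrib]
  refine Finset.sum_congr rfl fun i _ => ?_
  rw [← Finset.sum_neg_distrib]
  refine Finset.sum_congr rfl fun j _ => ?_
  have h : ∀ r s i j, (cr r * dn j * (cr s * dn i) : Module.End R (Fock R O E)) =
      cr r * cr s * (dn j * dn i) := by
    intro r s i j
    rw [mul_assoc, ← mul_assoc (dn j), dn_mul_cr]; noncomm_ring
  rw [h s r, h r s, cr_mul_cr s r, dn_mul_dn j i, mul_comm (B' r i)]
  exact smul_neg_mul _ _ _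

theorem opU_anticomm (C C' : Matrix E O R) : (opU C * opU C' : Module.End R (Fock R O E)) =
    -(opU C' * opU C) := by
  have e : ∀ C C' : Matrix E O R, (opU C * opU C' : Module.End R (Fock R O E)) =
      ∑ r, ∑ s, ∑ j, ∑ i, (C j r * C' i s) • (up j * an r * (up i * an s)) := by
    intro B B'
    simp only [opU, Finset.sum_mul_sum, smul_mul_smul_comm]
  rw [e, e, Finset.sum_comm, ← Finset.sum_neg_distrib]
  refine Finset.sum_congr rfl fun r _ => ?_
  rw [← Finset.sum_neg_distrib]
  refine Finset.sum_congr rfl fun s _ => ?_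
  rw [Finset.sum_comm, ← Finset.sum_neg_distrib]
  refine Finset.sum_congr rfl fun i _ => ?_
  rw [← Finset.sum_neg_distrib]
  refine Finset.sum_congr rfl fun j _ => ?_
  have h : ∀ r s i j, (up j * an r * (up i * an s) : Module.End R (Fock R O E)) =
      an r * an s * (up j * up i) := by
    intro r s i j
    rw [up_mul_an, up_mul_an, mul_assoc, ← mul_assoc (up j), up_mul_an]; noncomm_ring
  rw [h s r, h r s, an_mul_an s r, up_mul_up j i, mul_comm (C' i r)]
  exact smul_neg_mul _ _ _

theorem opT_opU_anticomm (B : Matrix O E R) (C : Matrix E O R) :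
    (opT B * opU C + opU C * opT B : Module.End R (Fock R O E)) = opF (B * C) + opB (C * B) := by
  have key : ∀ r s i j, (cr r * dn j * (up i * an s) + up i * an s * (cr r * dn j) :
      Module.End R (Fock R O E)) =
      (if j = i then cr r * an s else 0) + if r = s then up i * dn j else 0 := by
    intro r s i j
    have h1 : (cr r * dn j * (up i * an s) : Module.End R (Fock R O E)) =
        cr r * an s * (up i * dn j) + if j = i then cr r * an s else 0 := by
      rw [mul_assoc, ← mul_assoc (dn j), dn_mul_up, add_mul, mul_assoc (up i), dn_mul_an,
        ← mul_assoc (up i), up_mul_an]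
      split_ifs <;> noncomm_ring
    have h2 : (up i * an s * (cr r * dn j) : Module.End R (Fock R O E)) =
        (if r = s then up i * dn j else 0) - cr r * an s * (up i * dn j) := by
      rw [mul_assoc, ← mul_assoc (an s), an_mul_cr, sub_mul, mul_sub]
      congr 1
      · split_ifs <;> simp
      · rw [mul_assoc, ← mul_assoc, up_mul_cr, mul_assoc, ← mul_assoc (up i), up_mul_an]
        noncomm_ring
    rw [h1, h2]; abel
  have e1 : (opT B * opU C : Module.End R (Fock R O E)) =
      ∑ r, ∑ s, ∑ j, ∑ i, (B r j * C i s) • (cr r * dn j * (up i * an s)) := by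
    simp only [opT, opU, Finset.sum_mul_sum, smul_mul_smul_comm]
  have e2 : (opU C * opT B : Module.End R (Fock R O E)) =
      ∑ r, ∑ s, ∑ j, ∑ i, (B r j * C i s) • (up i * an s * (cr r * dn j)) := by
    simp only [opT, opU, Finset.sum_mul_sum, smul_mul_smul_comm]
    rw [Finset.sum_comm]
    refine Finset.sum_congr rfl fun r _ => Finset.sum_congr rfl fun s _ => ?_
    rw [Finset.sum_comm]
    simp only [mul_comm (C _ _)]
  rw [e1, e2]
  simp only [← Finset.sum_add_distrib, ← smul_add, key]
  simp only [smul_add, Finset.sum_add_distrib, smul_ite, smul_zero]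
  congr 1
  · simp [opF, Matrix.mul_apply, Finset.sum_smul]
  · rw [opB]
    simp only [Matrix.mul_apply, Finset.sum_smul]
    have : ∀ r : O, ∑ s, ∑ j, ∑ i, (if r = s then (B r j * C i s) • (up i * dn j) else 0 :
        Module.End R (Fock R O E)) = ∑ j, ∑ i, (C i r * B r j) • (up i * dn j) := by
      intro r
      rw [Finset.sum_eq_single r]
      · simp [mul_comm]
      · intro s _ hs; simp [hs.symm]
      · simp
    simp only [this]
    rw [Finset.sum_comm]
    conv_lhs => enter [2, j]; rw [Finset.sum_comm]
    rw [Finset.sum_comm]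

end Fock

section Weights
variable {R O E : Type*} [CommRing R] [LinearOrder O] [DecidableEq E] [Fintype O] [Fintype E]

/-- The additive weight of a Fock state. -/
def wt (f : O → ℕ) (g : E → ℕ) (β : Finset O × (E → ℕ)) : ℕ :=
  ∑ r ∈ β.1, f r + ∑ i, β.2 i * g i

theorem sum_add_single_mul (q g : E → ℕ) (j : E) :
    ∑ i, (q + Pi.single j 1 : E → ℕ) i * g i = ∑ i, q i * g i + g j := by
  simp [add_mul, Finset.sum_add_distrib, Pi.single_apply, ite_mul]

theorem sub_single_add_single {q : E → ℕ} {j : E} (h : q j ≠ 0) :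
    q - Pi.single j 1 + Pi.single j 1 = q := by
  funext i
  by_cases hi : i = j
  · subst hi; simp; omega
  · simp [hi]

theorem sum_sub_single_mul {q : E → ℕ} (g : E → ℕ) {j : E} (h : q j ≠ 0) :
    ∑ i, (q - Pi.single j 1 : E → ℕ) i * g i + g j = ∑ i, q i * g i := by
  rw [← sum_add_single_mul, sub_single_add_single h]

theorem wt_erase_add (f : O → ℕ) (g : E → ℕ) {P : Finset O} {r : O} (h : r ∈ P) (q : E → ℕ)
    (j : E) : wt f g (P.erase r, q + Pi.single j 1) + f r = wt f g (P, q) + g j := by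
  simp only [wt]
  rw [sum_add_single_mul, ← Finset.sum_erase_add _ _ h]; ring

theorem wt_insert_sub (f : O → ℕ) (g : E → ℕ) {P : Finset O} {r : O} (h : r ∉ P) {q : E → ℕ}
    {j : E} (hq : q j ≠ 0) :
    wt f g (insert r P, q - Pi.single j 1) + g j = wt f g (P, q) + f r := by
  simp only [wt]
  rw [Finset.sum_insert h, ← sum_sub_single_mul g hq]; ring

theorem wt_swap_fermion (f : O → ℕ) (g : E → ℕ) {P : Finset O} {r s : O} (h : r ∈ P)
    (hs : s ∉ P.erase r) (q : E → ℕ) :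
    wt f g (insert s (P.erase r), q) + f r = wt f g (P, q) + f s := by
  simp only [wt]
  rw [Finset.sum_insert hs, ← Finset.sum_erase_add _ _ h]; ring

theorem wt_swap_boson (f : O → ℕ) (g : E → ℕ) (P : Finset O) {q : E → ℕ} {i : E} (j : E)
    (h : q i ≠ 0) :
    wt f g (P, q - Pi.single i 1 + Pi.single j 1) + g i = wt f g (P, q) + g j := by
  simp only [wt]
  rw [sum_add_single_mul, ← sum_sub_single_mul g h]; ring

/-- A filtration index on Fock states: states with vanishing `k₀`-weight are put at the top. -/
def omg (f k₀ : O → ℕ) (g : E → ℕ) (k T : ℕ) (β : Finset O × (E → ℕ)) : ℕ :=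
  if wt k₀ 1 β = 0 then T else wt f g β * (k + 1) + wt k₀ 1 β

theorem opF_apply (X : Matrix O O R) (v : Fock R O E) (β) :
    opF X v β = ∑ r, ∑ s, X r s * cr r (an s v) β := by
  simp [opF, LinearMap.sum_apply, Finset.sum_apply]

theorem opB_apply (Y : Matrix E E R) (v : Fock R O E) (β) :
    opB Y v β = ∑ i, ∑ j, Y i j * up i (dn j v) β := by
  simp [opB, LinearMap.sum_apply, Finset.sum_apply]

theorem opT_apply (B : Matrix O E R) (v : Fock R O E) (β) :
    opT B v β = ∑ r, ∑ j, B r j * cr r (dn j v) β := by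
  simp [opT, LinearMap.sum_apply, Finset.sum_apply]

theorem opU_apply (C : Matrix E O R) (v : Fock R O E) (β) :
    opU C v β = ∑ r, ∑ j, C j r * up j (an r v) β := by
  simp [opU, LinearMap.sum_apply, Finset.sum_apply]

theorem sum_sub_mem {ι : Type*} [Fintype ι] (m : Ideal R) (f g : ι → R)
    (h : ∀ i, f i - g i ∈ m) : ∑ i, f i - ∑ i, g i ∈ m := by
  rw [← Finset.sum_sub_distrib]; exact Ideal.sum_mem _ fun i _ => h i

theorem sum_sub_diag_mem {ι : Type*} [Fintype ι] [DecidableEq ι] (m : Ideal R) (f : ι → R) (i : ι)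
    (x : R) (hi : f i - x ∈ m) (h : ∀ s, s ≠ i → f s ∈ m) : ∑ s, f s - x ∈ m := by
  rw [← Finset.add_sum_erase _ _ (Finset.mem_univ i), add_sub_right_comm]
  exact m.add_mem hi (Ideal.sum_mem _ fun s hs => h s (Finset.ne_of_mem_erase hs))

theorem fock_triangular (m : Ideal R) (w : R) (X : Matrix O O R) (Y : Matrix E E R)
    (f k₀ : O → ℕ) (g : E → ℕ) (k T : ℕ) (hk₀ : ∀ r, k₀ r ≤ 1)
    (hXd : ∀ r, X r r - k₀ r * w ∈ m) (hX : ∀ r s, r ≠ s → X r s ∈ m ∨ f s < f r)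
    (hYd : ∀ i, Y i i - w ∈ m) (hY : ∀ i j, i ≠ j → Y i j ∈ m ∨ g j < g i)
    (h0 : ∀ (P : Finset O) (q : E → ℕ), wt 1 1 (P, q) = k → wt k₀ 1 (P, q) = 0 → ∀ s ∈ P, ∀ r, X r s ∈ m)
    (v : Fock R O E) (s₀ : ℕ) (hs₀ : s₀ < T)
    (hv : ∀ β, wt 1 1 β = k → omg f k₀ g k T β < s₀ → v β ∈ m) (β) (hβ : wt 1 1 β = k)
    (hω : omg f k₀ g k T β ≤ s₀) :
    (opF X + opB Y : Module.End R (Fock R O E)) v β - (wt k₀ 1 β : R) * (w * v β) ∈ m := by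
  obtain ⟨P, q⟩ := β
  have hκ : ∀ β, wt k₀ 1 β ≤ wt (1 : O → ℕ) (1 : E → ℕ) β := fun β => by
    unfold wt
    exact Nat.add_le_add_right (Finset.sum_le_sum fun r _ => hk₀ r) _
  have hne : wt k₀ 1 (P, q) ≠ 0 := by
    intro h; rw [omg, if_pos h] at hω; omega
  have hlow : ∀ β', wt 1 1 β' = k → wt k₀ 1 β' ≠ 0 → wt f g β' < wt f g (P, q) → v β' ∈ m := by
    intro β' hk' hn hlt
    refine hv β' hk' (lt_of_lt_of_le ?_ hω)
    rw [omg, omg, if_neg hn, if_neg hne]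
    have h1 := hκ β'
    have h2 : (wt f g β' + 1) * (k + 1) ≤ wt f g (P, q) * (k + 1) := Nat.mul_le_mul_right _ hlt
    rw [hk'] at h1
    nlinarith
  have hF : opF X v (P, q) - ∑ r, (if r ∈ P then (k₀ r : R) * (w * v (P, q)) else 0) ∈ m := by
    rw [opF_apply]
    refine sum_sub_mem m _ _ fun r => ?_
    by_cases hr : r ∈ P
    · simp only [hr, if_true, cr_apply, an_apply]
      refine sum_sub_diag_mem m _ r _ ?_ fun s hs => ?_
      · have : X r r * (fsgn R r P * (if r ∈ P.erase r then 0 else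
            fsgn R r (P.erase r) * v (insert r (P.erase r), q))) - (k₀ r : R) * (w * v (P, q)) =
            (X r r - k₀ r * w) * v (P, q) := by
          rw [if_neg (by simp), Finset.insert_erase hr, fsgn_erase_self, ← mul_assoc (fsgn R r P),
            fsgn_mul_self]; ring
        rw [this]; exact m.mul_mem_right _ (hXd r)
      · by_cases hsP : s ∈ P.erase r
        · simp [hsP]
        rw [if_neg hsP]
        have htot := wt_swap_fermion (1 : O → ℕ) (1 : E → ℕ) hr hsP q
        have hwt := wt_swap_fermion f g hr hsP q
        simp only [Pi.one_apply, add_left_inj] at htot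
        by_cases h0' : wt k₀ 1 (insert s (P.erase r), q) = 0
        · exact m.mul_mem_right _ (h0 _ _ (htot.trans hβ) h0' s (by simp) r)
        rcases hX r s hs.symm with h | h
        · exact m.mul_mem_right _ h
        · refine m.mul_mem_left _ (m.mul_mem_left _ (m.mul_mem_left _ ?_))
          exact hlow _ (htot.trans hβ) h0' (by omega)
    · simp [hr, cr_apply]
  have hB : opB Y v (P, q) - ∑ i, (q i : R) * (w * v (P, q)) ∈ m := by
    rw [opB_apply]
    refine sum_sub_mem m _ _ fun i => ?_
    by_cases hq : q i = 0
    · simp [up_apply, hq]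
    simp only [up_apply, dn_apply]
    refine sum_sub_diag_mem m _ i _ ?_ fun j hj => ?_
    · rw [sub_single_add_single hq]
      have : Y i i * (q i * v (P, q)) - q i * (w * v (P, q)) = (Y i i - w) * (q i * v (P, q)) := by
        ring
      rw [this]; exact m.mul_mem_right _ (hYd i)
    · have htot := wt_swap_boson (1 : O → ℕ) (1 : E → ℕ) P j hq
      have hwt := wt_swap_boson f g P j hq
      have hkap := wt_swap_boson k₀ (1 : E → ℕ) P j hq
      simp only [Pi.one_apply, add_left_inj] at htot hkap
      rcases hY i j hj.symm with h | h
      · exact m.mul_mem_right _ h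
      · refine m.mul_mem_left _ (m.mul_mem_left _ ?_)
        exact hlow _ (htot.trans hβ) (by omega) (by omega)
  have := m.add_mem hF hB
  convert this using 1
  have e : (wt k₀ (1 : E → ℕ) (P, q) : R) * (w * v (P, q)) =
      (∑ r, if r ∈ P then (k₀ r : R) * (w * v (P, q)) else 0) +
        ∑ i, (q i : R) * (w * v (P, q)) := by
    simp only [wt, Pi.one_apply, mul_one]
    push_cast
    rw [Finset.sum_ite_mem, Finset.univ_inter, ← Finset.sum_mul, ← Finset.sum_mul, add_mul]
  rw [e, LinearMap.add_apply, Pi.add_apply]; ring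

end Weights

section Support
variable {σ : Type*}

/-- Polynomials all of whose monomials have degree in `S`. -/
def degSub (S : ℕ → Prop) : Submodule ℂ (MvPolynomial σ ℂ) where
  carrier := {p | ∀ m ∈ p.support, S m.degree}
  add_mem' := by
    classical
    intro p q hp hq m hm
    rcases Finset.mem_union.1 (support_add hm) with h | h
    · exact hp m h
    · exact hq m h
  zero_mem' := by intro m hm; simp at hm
  smul_mem' := by
    intro c p hp m hm
    exact hp m (support_smul hm)

theorem mem_degSub {S : ℕ → Prop} {p : MvPolynomial σ ℂ} :
    p ∈ degSub S ↔ ∀ m ∈ p.support, S m.degree := Iff.rfl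

theorem mul_mem_degSub {S S' : ℕ → Prop} {e : ℕ} {p q : MvPolynomial σ ℂ}
    (hp : p.IsHomogeneous e) (hq : q ∈ degSub S) (h : ∀ t, S t → S' (e + t)) :
    p * q ∈ degSub S' := by
  classical
  intro m hm
  obtain ⟨m₁, h1, m₂, h2, rfl⟩ := Finset.mem_add.1 (support_mul _ _ hm)
  have h5 : m₁.degree = e := by
    have := hp (mem_support_iff.1 h1)
    rw [← this, Finsupp.degree_eq_weight_one]; rfl
  rw [map_add, h5]
  exact h _ (hq m₂ h2)

theorem natCast_mul_mem_degSub {S : ℕ → Prop} {p : MvPolynomial σ ℂ} (n : ℕ)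
    (hp : p ∈ degSub S) : (n : MvPolynomial σ ℂ) * p ∈ degSub S := by
  rw [← nsmul_eq_mul]; exact nsmul_mem hp n

theorem fsgn_mul_mem_degSub {O : Type*} [LinearOrder O] {S : ℕ → Prop} {p : MvPolynomial σ ℂ}
    (r : O) (P : Finset O) (hp : p ∈ degSub S) : fsgn (MvPolynomial σ ℂ) r P * p ∈ degSub S := by
  rw [fsgn]
  rcases neg_one_pow_eq_or (MvPolynomial σ ℂ) (P.filter (· < r)).card with h | h <;> rw [h]
  · simpa using hp
  · simpa using hp

variable {O E : Type*} [LinearOrder O] [DecidableEq E] [Fintype O] [Fintype E]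

theorem opT_mem_degSub {Q Q' : Finset O × (E → ℕ) → ℕ → Prop}
    (B : Matrix O E (MvPolynomial σ ℂ))
    (hB : ∀ r j, B r j = 0 ∨ ∃ e, (B r j).IsHomogeneous e ∧ ∀ P q t, r ∈ P →
      Q (P.erase r, q + Pi.single j 1) t → Q' (P, q) (e + t))
    (v : Fock (MvPolynomial σ ℂ) O E) (hv : ∀ β, v β ∈ degSub (Q β)) (β) :
    opT B v β ∈ degSub (Q' β) := by
  obtain ⟨P, q⟩ := β
  rw [opT_apply]
  refine sum_mem fun r _ => sum_mem fun j _ => ?_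
  rw [cr_apply, dn_apply]
  split_ifs with hr
  · rcases hB r j with h | ⟨e, he, h⟩
    · rw [h, zero_mul]; exact zero_mem _
    · exact mul_mem_degSub he (fsgn_mul_mem_degSub r P (hv _)) fun t ht => h P q t hr ht
  · rw [mul_zero]; exact zero_mem _

theorem opU_mem_degSub {Q Q' : Finset O × (E → ℕ) → ℕ → Prop}
    (C : Matrix E O (MvPolynomial σ ℂ))
    (hC : ∀ r j, C j r = 0 ∨ ∃ e, (C j r).IsHomogeneous e ∧ ∀ P q t, r ∉ P → q j ≠ 0 →
      Q (insert r P, q - Pi.single j 1) t → Q' (P, q) (e + t))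
    (v : Fock (MvPolynomial σ ℂ) O E) (hv : ∀ β, v β ∈ degSub (Q β)) (β) :
    opU C v β ∈ degSub (Q' β) := by
  obtain ⟨P, q⟩ := β
  rw [opU_apply]
  refine sum_mem fun r _ => sum_mem fun j _ => ?_
  by_cases hq : q j = 0
  · simp [up_apply, hq]
  by_cases hr : r ∈ P
  · simp [up_apply, an_apply, hr]
  · rw [up_apply, an_apply, if_neg hr]
    rcases hC r j with h | ⟨e, he, h⟩
    · rw [h, zero_mul]; exact zero_mem _
    · exact mul_mem_degSub he (natCast_mul_mem_degSub _ (fsgn_mul_mem_degSub r P (hv _)))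
        fun t ht => h P q t hr hq ht

theorem opF_add_opB_eq_zero {R : Type*} [CommRing R] (X : Matrix O O R) (Y : Matrix E E R) {k : ℕ}
    {v : Fock R O E} (hv : ∀ β, wt 1 1 β ≠ k → v β = 0) {β} (hβ : wt 1 1 β ≠ k) :
    (opF X + opB Y : Module.End R (Fock R O E)) v β = 0 := by
  obtain ⟨P, q⟩ := β
  rw [LinearMap.add_apply, Pi.add_apply, opF_apply, opB_apply]
  rw [Finset.sum_eq_zero, Finset.sum_eq_zero, add_zero]
  · intro i _
    refine Finset.sum_eq_zero fun j _ => ?_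
    by_cases hq : q i = 0
    · simp [up_apply, hq]
    have htot := wt_swap_boson (1 : O → ℕ) (1 : E → ℕ) P j hq
    rw [up_apply, dn_apply, hv, mul_zero, mul_zero]
    simp only [Pi.one_apply, add_left_inj] at htot
    rwa [htot]
  · intro r _
    refine Finset.sum_eq_zero fun s _ => ?_
    rw [cr_apply]
    split_ifs with hr
    · rw [an_apply]
      split_ifs with hs
      · simp
      · have htot := wt_swap_fermion (1 : O → ℕ) (1 : E → ℕ) hr hs q
        simp only [Pi.one_apply, add_left_inj] at htot
        rw [hv _ (by rwa [htot])]; simp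
    · simp

end Support

namespace GradedComplex
variable {b : ℕ} {ι : Type*} {K : GradedComplex b ι}

theorem exists_homotopy_step (hK : K.DHom) (j : Fin (b + 1)) (e i T : ℕ)
    (h : Module.End (MvPolynomial (Fin (b + 1)) ℂ) (ι → MvPolynomial (Fin (b + 1)) ℂ))
    (hh : ∀ n v, K.Hom i n v → K.Hom (i + 1) (n + e) (h v)) (ω : ι → ℕ) (κ : ℕ → ℂ)
    (hκ : ∀ s, κ s ≠ 0)
    (tri : ∀ n v s, s < T → K.Hom i n v → (∀ β, ω β < s → v β ∈ lowIdeal b j) →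
      ∀ β, ω β ≤ s → (K.D (h v) + h (K.D v)) β - C (κ s) * (X j ^ e * v β) ∈ lowIdeal b j)
    {n : ℕ} {v} (hv : K.Hom i n v) (hDv : LowVec j (K.D v)) (s : ℕ) (hs : s ≤ T) :
    ∃ M y v', K.Hom (i + 1) (n + M) y ∧ K.Hom i (n + M) v' ∧
      LowVec j ((X j ^ M : MvPolynomial (Fin (b + 1)) ℂ) • v - K.D y - v') ∧
      ∀ β, ω β < s → v' β ∈ lowIdeal b j := by
  induction s with
  | zero =>
    refine ⟨0, 0, v, Hom.zero, hv, ?_, by simp⟩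
    simpa using LowVec.zero
  | succ s ih =>
    obtain ⟨M, y, v', hy, hv', hl, hω⟩ := ih (by omega)
    have hXe : (X j ^ e : MvPolynomial (Fin (b + 1)) ℂ).IsHomogeneous e := by
      simpa using (isHomogeneous_X ℂ j).pow e
    have hDv' : LowVec j (K.D v') := by
      have h1 := hl.map K.D
      rw [map_sub, map_sub, map_smul, K.D_D, sub_zero] at h1
      have := (hDv.smul (X j ^ M)).sub h1
      rwa [sub_sub_cancel] at this
    have hC : (C (κ s)⁻¹ : MvPolynomial (Fin (b + 1)) ℂ).IsHomogeneous 0 := isHomogeneous_C _ _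
    have hhv : K.Hom (i + 1) (n + (M + e)) ((C (κ s)⁻¹ : MvPolynomial (Fin (b + 1)) ℂ) • h v') := by
      have := (hh _ _ hv').smul hC
      rwa [add_zero, add_assoc] at this
    refine ⟨M + e, (X j ^ e : MvPolynomial (Fin (b + 1)) ℂ) • y +
      (C (κ s)⁻¹ : MvPolynomial (Fin (b + 1)) ℂ) • h v',
      (X j ^ e : MvPolynomial (Fin (b + 1)) ℂ) • v' -
        K.D ((C (κ s)⁻¹ : MvPolynomial (Fin (b + 1)) ℂ) • h v'), ?_, ?_, ?_, ?_⟩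
    · refine Hom.add ?_ hhv
      rw [← add_assoc]; exact hy.smul hXe
    · refine Hom.sub ?_ (hK _ _ _ hhv)
      rw [← add_assoc]; exact hv'.smul hXe
    · have := hl.smul (X j ^ e)
      convert this using 1
      rw [map_add, map_smul, pow_add, mul_comm, mul_smul, smul_sub, smul_sub]
      abel
    · intro β hβ
      have h1 := tri _ _ s (by omega) hv' hω β (by omega)
      have h2 := (hDv'.map h) β
      have h3 := (lowIdeal b j).mul_mem_left (-C (κ s)⁻¹) ((lowIdeal b j).sub_mem h1 h2)
      convert h3 using 1
      have h4 : (C (κ s)⁻¹ * C (κ s) : MvPolynomial (Fin (b + 1)) ℂ) = 1 := by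
        rw [← C_mul, inv_mul_cancel₀ (hκ s), C_1]
      simp only [map_smul, Pi.sub_apply, Pi.add_apply, Pi.smul_apply, smul_eq_mul]
      linear_combination (-X j ^ e * v' β) * h4

end GradedComplex

section General

theorem coeff_X_mul_derivative {S : Type*} [CommRing S] (q : Polynomial S) (n : ℕ) :
    (Polynomial.X * Polynomial.derivative q).coeff n = n * q.coeff n := by
  cases n with
  | zero => simp
  | succ n => rw [Polynomial.coeff_X_mul, Polynomial.coeff_derivative]; push_cast; ring

theorem coeff_mul_derivative_sub {S : Type*} [CommRing S] (a : ℕ) (g f : Polynomial S) (r : ℕ) :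
    (a * Polynomial.derivative g * f - g * Polynomial.derivative f).coeff r =
      ∑ i ∈ Finset.range (r + 2),
        ((a : S) * (r + 1 - i : ℕ) - i) * g.coeff (r + 1 - i) * f.coeff i := by
  rw [← Polynomial.coeff_X_mul]
  have e : Polynomial.X * ((a : Polynomial S) * Polynomial.derivative g * f -
      g * Polynomial.derivative f) =
      (a : Polynomial S) * (f * (Polynomial.X * Polynomial.derivative g)) -
      (Polynomial.X * Polynomial.derivative f) * g := by ring
  rw [e, Polynomial.coeff_sub, Polynomial.coeff_natCast_mul, Polynomial.coeff_mul,
    Polynomial.coeff_mul, Finset.mul_sum, ← Finset.sum_sub_distrib,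
    Finset.Nat.sum_antidiagonal_eq_sum_range_succ_mk]
  refine Finset.sum_congr rfl fun p _ => ?_
  rw [coeff_X_mul_derivative, coeff_X_mul_derivative]; ring

theorem coeff_pow_of_low {S : Type*} [CommRing S] {p : Polynomial S} {j : ℕ}
    (h : ∀ i < j, p.coeff i = 0) (a : ℕ) :
    (∀ i < a * j, (p ^ a).coeff i = 0) ∧ (p ^ a).coeff (a * j) = p.coeff j ^ a := by
  obtain ⟨q, rfl⟩ := Polynomial.X_pow_dvd_iff.2 h
  rw [mul_pow, ← pow_mul, mul_comm j a]
  refine ⟨fun i hi => ?_, ?_⟩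
  · rw [Polynomial.coeff_X_pow_mul', if_neg (by omega)]
  · rw [Polynomial.coeff_X_pow_mul', if_pos le_rfl, Nat.sub_self, Polynomial.coeff_X_pow_mul',
      if_pos le_rfl, Nat.sub_self, Polynomial.coeff_zero_eq_eval_zero,
      Polynomial.coeff_zero_eq_eval_zero, Polynomial.eval_pow]

variable {O E R : Type*} [CommRing R] [LinearOrder O] [DecidableEq E] [Fintype O] [Fintype E]

theorem opF_add (X Y : Matrix O O R) :
    (opF (X + Y) : Module.End R (Fock R O E)) = opF X + opF Y := by
  simp [opF, add_smul, Finset.sum_add_distrib]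

theorem opB_add (X Y : Matrix E E R) :
    (opB (X + Y) : Module.End R (Fock R O E)) = opB X + opB Y := by
  simp [opB, add_smul, Finset.sum_add_distrib]

theorem opF_zero : (opF (0 : Matrix O O R) : Module.End R (Fock R O E)) = 0 := by simp [opF]

theorem opB_zero : (opB (0 : Matrix E E R) : Module.End R (Fock R O E)) = 0 := by simp [opB]

theorem homotopy_anticomm (B B' : Matrix O E R) (C C' : Matrix E O R) :
    ((opT B + opU C) * (opU C' + opT B') + (opU C' + opT B') * (opT B + opU C) :
      Module.End R (Fock R O E)) = opF (B * C' + B' * C) + opB (C' * B + C * B') := by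
  have h1 := opT_opU_anticomm (R := R) B C'
  have h2 := opT_opU_anticomm (R := R) B' C
  have h3 := opT_anticomm (R := R) B B'
  have h4 := opU_anticomm (R := R) C C'
  rw [opF_add, opB_add]
  calc _ = (opT B * opU C' + opU C' * opT B) + (opT B' * opU C + opU C * opT B') +
        (opT B * opT B' + opT B' * opT B) + (opU C * opU C' + opU C' * opU C) := by noncomm_ring
    _ = _ := by rw [h1, h2, h3, h4]; abel

theorem opT_sq [IsDomain R] [CharZero R] (B : Matrix O E R) :
    (opT B * opT B : Module.End R (Fock R O E)) = 0 := by
  have h := opT_anticomm B B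
  ext v β
  have h1 := congrFun (LinearMap.congr_fun h v) β
  simp only [LinearMap.neg_apply, Pi.neg_apply] at h1
  simpa using self_eq_neg.1 h1

theorem opU_sq [IsDomain R] [CharZero R] (B : Matrix E O R) :
    (opU B * opU B : Module.End R (Fock R O E)) = 0 := by
  have h := opU_anticomm B B
  ext v β
  have h1 := congrFun (LinearMap.congr_fun h v) β
  simp only [LinearMap.neg_apply, Pi.neg_apply] at h1
  simpa using self_eq_neg.1 h1

theorem opT_add_opU_sq [IsDomain R] [CharZero R] (B : Matrix O E R) (C : Matrix E O R)
    (h : B * C = 0) (h' : C * B = 0) :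
    ((opT B + opU C) * (opT B + opU C) : Module.End R (Fock R O E)) = 0 := by
  have h1 := opT_opU_anticomm B C
  rw [h, h', opF_zero, opB_zero, add_zero] at h1
  calc _ = opT B * opT B + opU C * opU C + (opT B * opU C + opU C * opT B) := by noncomm_ring
    _ = 0 := by rw [h1, opT_sq, opU_sq]; simp

end General

/-- The variables `u i`, extended by zero. -/
noncomputable def uu (b i : ℕ) : MvPolynomial (Fin (b + 1)) ℂ :=
  if h : i < b + 1 then X ⟨i, h⟩ else 0

theorem uu_mem_lowIdeal {b i j : ℕ} (h : i < j) : uu b i ∈ lowIdeal b j := by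
  rw [uu]; split_ifs with h'
  · exact X_mem_lowIdeal h
  · exact zero_mem _

theorem uu_fin {b : ℕ} (j : Fin (b + 1)) : uu b j = X j := by
  rw [uu, dif_pos j.2]

theorem uu_isHomogeneous (b i : ℕ) : (uu b i).IsHomogeneous 1 := by
  rw [uu]; split_ifs with h
  · exact isHomogeneous_X _ _
  · exact isHomogeneous_zero _ _ _

theorem uu_of_lt {b i : ℕ} (h : b < i) : uu b i = 0 := by
  rw [uu, dif_neg (by omega)]

/-- The generic polynomial of degree `b` in one variable. -/
noncomputable def Gp (b : ℕ) : Polynomial (MvPolynomial (Fin (b + 1)) ℂ) :=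
  ∑ i ∈ Finset.range (b + 1), Polynomial.C (uu b i) * Polynomial.X ^ i

theorem Gp_coeff (b i : ℕ) : (Gp b).coeff i = uu b i := by
  simp only [Gp, Polynomial.finsetSum_coeff, Polynomial.coeff_C_mul_X_pow]
  rw [Finset.sum_ite_eq]
  split_ifs with h
  · rfl
  · rw [uu_of_lt]; simpa using h

theorem Gp_natDegree_le (b : ℕ) : (Gp b).natDegree ≤ b := by
  rw [Polynomial.natDegree_le_iff_coeff_eq_zero]
  intro n hn
  rw [Gp_coeff, uu_of_lt hn]

/-- The coefficients of the `a`-th power of the generic polynomial. -/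
noncomputable def cc (a b i : ℕ) : MvPolynomial (Fin (b + 1)) ℂ := (Gp b ^ a).coeff i

theorem cc_of_lt {a b i : ℕ} (h : a * b < i) : cc a b i = 0 :=
  Polynomial.coeff_eq_zero_of_natDegree_lt
    ((Polynomial.natDegree_pow_le.trans (Nat.mul_le_mul_left a (Gp_natDegree_le b))).trans_lt h)

theorem cc_isHomogeneous (a b i : ℕ) : (cc a b i).IsHomogeneous a := by
  induction a generalizing i with
  | zero =>
    rw [cc, pow_zero, Polynomial.coeff_one]
    split_ifs
    · exact isHomogeneous_one _ _
    · exact isHomogeneous_zero _ _ _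
  | succ a ih =>
    rw [cc, pow_succ, Polynomial.coeff_mul]
    refine IsHomogeneous.sum _ _ _ fun p _ => ?_
    rw [Gp_coeff]
    exact (ih _).mul (uu_isHomogeneous _ _)

theorem cc_low (a b j : ℕ) : (∀ i < a * j, cc a b i ∈ lowIdeal b j) ∧
    cc a b (a * j) - uu b j ^ a ∈ lowIdeal b j := by
  have h := coeff_pow_of_low (p := (Gp b).map (Ideal.Quotient.mk (lowIdeal b j))) (j := j)
    (fun i hi => by
      rw [Polynomial.coeff_map, Gp_coeff, Ideal.Quotient.eq_zero_iff_mem]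
      exact uu_mem_lowIdeal hi) a
  rw [← Polynomial.map_pow] at h
  refine ⟨fun i hi => ?_, ?_⟩
  · have := h.1 i hi
    rwa [Polynomial.coeff_map, Ideal.Quotient.eq_zero_iff_mem] at this
  · have := h.2
    rwa [Polynomial.coeff_map, Polynomial.coeff_map, Gp_coeff, ← map_pow, Ideal.Quotient.eq] at this

section Matrices
variable (a b N : ℕ)

/-- The matrix of `F ↦ a G' F - G F'`. -/
noncomputable def Am : Matrix (Fin (N + 1)) (Fin (a * b + 1)) (MvPolynomial (Fin (b + 1)) ℂ) :=
  fun r i => if (i : ℕ) ≤ r + 1 then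
    C ((a : ℂ) * ((r + 1 - i : ℕ) : ℂ) - (i : ℕ)) * uu b (r + 1 - i) else 0

/-- The coefficients of `G ^ a`, placed in the last column. -/
noncomputable def cm : Matrix (Fin (a * b + 1)) (Fin (N + 1)) (MvPolynomial (Fin (b + 1)) ℂ) :=
  fun i r => if r = Fin.last N then cc a b i else 0

theorem Am_mul_vec (f : Polynomial (MvPolynomial (Fin (b + 1)) ℂ)) (hf : f.natDegree ≤ a * b)
    (r : Fin (N + 1)) : ∑ i, Am a b N r i * f.coeff i =
      (a * Polynomial.derivative (Gp b) * f - Gp b * Polynomial.derivative f).coeff r := by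
  rw [coeff_mul_derivative_sub]
  have h1 : ∀ i : ℕ, (if i ≤ (r : ℕ) + 1 then
      C ((a : ℂ) * ((r + 1 - i : ℕ) : ℂ) - (i : ℕ)) * uu b (r + 1 - i) else 0) * f.coeff i =
      if i ∈ Finset.range ((r : ℕ) + 2) then ((a : MvPolynomial (Fin (b + 1)) ℂ) *
        (r + 1 - i : ℕ) - i) * (Gp b).coeff (r + 1 - i) * f.coeff i else 0 := by
    intro i
    by_cases h : i ≤ (r : ℕ) + 1
    · rw [if_pos h, if_pos (by simp; omega), Gp_coeff]; simp
    · rw [if_neg h, if_neg (by simp; omega), zero_mul]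
  simp only [Am, h1]
  rw [Fin.sum_univ_eq_sum_range (fun i => if i ∈ Finset.range ((r : ℕ) + 2) then
    ((a : MvPolynomial (Fin (b + 1)) ℂ) * (r + 1 - i : ℕ) - i) * (Gp b).coeff (r + 1 - i) *
      f.coeff i else 0)]
  rw [Finset.sum_ite_mem]
  refine Finset.sum_subset Finset.inter_subset_right ?_
  intro i hi hni
  rw [Polynomial.coeff_eq_zero_of_natDegree_lt (p := f), mul_zero]
  simp only [Finset.mem_inter, Finset.mem_range] at hi hni
  by_contra h
  exact hni ⟨by omega, hi⟩

theorem Am_mul_cc (r : Fin (N + 1)) : ∑ i : Fin (a * b + 1), Am a b N r i * cc a b i = 0 := by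
  have := Am_mul_vec a b N (Gp b ^ a)
    (Polynomial.natDegree_pow_le.trans (Nat.mul_le_mul_left a (Gp_natDegree_le b))) r
  simp only [cc]
  rw [this, Polynomial.derivative_pow]
  cases a with
  | zero => simp
  | succ a =>
    rw [Nat.add_sub_cancel, pow_succ, ← Polynomial.coeff_zero r, map_natCast]
    congr 1; ring

theorem Am_mul_cm : Am a b N * cm a b N = 0 := by
  ext1 r s
  rw [Matrix.mul_apply, Matrix.zero_apply]
  by_cases hs : s = Fin.last N
  · simp only [cm, if_pos hs]; exact Am_mul_cc a b N r
  · simp [cm, hs]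

variable {a b N}

theorem Am_last (hN : N + 1 = a * b + b) (i) : Am a b N (Fin.last N) i = 0 := by
  rw [Am]
  split_ifs with h
  · have hi := i.2
    simp only [Fin.val_last] at *
    rcases Nat.lt_or_ge b (N + 1 - i) with h1 | h1
    · rw [uu_of_lt h1, mul_zero]
    · have h2 : (i : ℕ) = a * b := by omega
      have h3 : N + 1 - (i : ℕ) = b := by omega
      rw [h3, h2]; push_cast; simp
  · rfl

theorem cm_mul_Am (hN : N + 1 = a * b + b) : cm a b N * Am a b N = 0 := by
  ext1 i j
  rw [Matrix.mul_apply, Matrix.zero_apply]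
  refine Finset.sum_eq_zero fun r _ => ?_
  by_cases hr : r = Fin.last N
  · subst hr; rw [Am_last hN, mul_zero]
  · simp [cm, hr]

variable (a b N) (j : ℕ)

/-- The `U`-part of the contracting homotopy. -/
noncomputable def tau : Matrix (Fin (a * b + 1)) (Fin (N + 1)) (MvPolynomial (Fin (b + 1)) ℂ) :=
  fun i s => if (s : ℕ) + 1 = i + j ∧ (i : ℕ) ≠ a * j then
    C ((a * j : ℂ) - (i : ℕ))⁻¹ * uu b j ^ (a - 1) else 0

/-- The `T`-part of the contracting homotopy. -/
noncomputable def psi : Matrix (Fin (N + 1)) (Fin (a * b + 1)) (MvPolynomial (Fin (b + 1)) ℂ) :=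
  fun r i => if r = Fin.last N ∧ (i : ℕ) = a * j then 1 else 0

/-- The rows that are not pivots. -/
def nonpivots : Finset (Fin (N + 1)) :=
  Finset.univ.filter fun s => s ≠ Fin.last N ∧ ∀ i : Fin (a * b + 1), (s : ℕ) + 1 = i + j →
    (i : ℕ) = a * j

/-- The fermionic part of the homotopy Laplacian. -/
noncomputable def Xm : Matrix (Fin (N + 1)) (Fin (N + 1)) (MvPolynomial (Fin (b + 1)) ℂ) :=
  Am a b N * tau a b N j + psi a b N j * cm a b N

/-- The bosonic part of the homotopy Laplacian. -/
noncomputable def Ym : Matrix (Fin (a * b + 1)) (Fin (a * b + 1)) (MvPolynomial (Fin (b + 1)) ℂ) :=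
  tau a b N j * Am a b N + cm a b N * psi a b N j

variable {a b N j}

theorem psi_mul_cm_apply (hj : j ≤ b) (r s) : (psi a b N j * cm a b N) r s =
    if r = Fin.last N ∧ s = Fin.last N then cc a b (a * j) else 0 := by
  rw [Matrix.mul_apply]
  have hlt : a * j < a * b + 1 := Nat.lt_succ_of_le (Nat.mul_le_mul_left a hj)
  rw [Finset.sum_eq_single (⟨a * j, hlt⟩ : Fin (a * b + 1))]
  · simp only [psi, cm]
    by_cases h1 : r = Fin.last N <;> by_cases h2 : s = Fin.last N <;> simp [h1, h2]
  · intro i _ hi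
    have : (i : ℕ) ≠ a * j := fun h => hi (Fin.ext h)
    simp [psi, this]
  · simp

theorem cm_mul_psi_apply (i i') : (cm a b N * psi a b N j) i i' =
    if (i' : ℕ) = a * j then cc a b i else 0 := by
  rw [Matrix.mul_apply, Finset.sum_eq_single (Fin.last N)]
  · simp [cm, psi]
  · intro r _ hr; simp [cm, hr]
  · simp

theorem Am_mul_tau_apply {i : Fin (a * b + 1)} {s : Fin (N + 1)} (h : (s : ℕ) + 1 = i + j)
    (hi : (i : ℕ) ≠ a * j) (r) : (Am a b N * tau a b N j) r s =
      Am a b N r i * (C ((a * j : ℂ) - (i : ℕ))⁻¹ * uu b j ^ (a - 1)) := by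
  rw [Matrix.mul_apply, Finset.sum_eq_single i]
  · rw [tau, if_pos ⟨h, hi⟩]
  · intro i' _ hi'
    rw [tau, if_neg, mul_zero]
    rintro ⟨h', -⟩
    exact hi' (Fin.ext (by omega))
  · simp

theorem Am_mul_tau_apply_eq_zero {s : Fin (N + 1)}
    (h : ∀ i : Fin (a * b + 1), (s : ℕ) + 1 = i + j → (i : ℕ) = a * j) (r) :
    (Am a b N * tau a b N j) r s = 0 := by
  rw [Matrix.mul_apply]
  refine Finset.sum_eq_zero fun i _ => ?_
  rw [tau, if_neg, mul_zero]
  rintro ⟨h1, h2⟩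
  exact h2 (h i h1)

theorem Am_last_col_eq (hN : N + 1 = a * b + b) (hj : j ≤ b) (i : Fin (a * b + 1))
    (h : (Fin.last N : ℕ) + 1 = i + j) : (i : ℕ) = a * j := by
  have := i.2
  rw [Fin.val_last] at h
  have h1 : j = b := by omega
  subst h1; omega

theorem Am_mul_inv_eq (ha : 1 ≤ a) {i : Fin (a * b + 1)} {r : Fin (N + 1)}
    (h : (r : ℕ) + 1 = i + j) (hi : (i : ℕ) ≠ a * j) :
    Am a b N r i * (C ((a * j : ℂ) - (i : ℕ))⁻¹ * uu b j ^ (a - 1)) = uu b j ^ a := by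
  have e : (r : ℕ) + 1 - i = j := by omega
  rw [Am, if_pos (by omega), e]
  obtain ⟨a, rfl⟩ := Nat.exists_eq_add_of_le' ha
  have h0 : ((((a + 1 : ℕ) : ℂ) * j) - (i : ℕ)) ≠ 0 := by
    rw [sub_ne_zero]
    exact_mod_cast hi.symm
  rw [Nat.add_sub_cancel, pow_succ]
  have h4 : (C (((a + 1 : ℕ) : ℂ) * j - (i : ℕ)) * C (((a + 1 : ℕ) : ℂ) * j - (i : ℕ))⁻¹ :
      MvPolynomial (Fin (b + 1)) ℂ) = 1 := by
    rw [← C_mul, mul_inv_cancel₀ h0, C_1]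
  linear_combination (uu b j * uu b j ^ a) * h4

theorem Am_mem_lowIdeal {i : Fin (a * b + 1)} {r : Fin (N + 1)} (h : (r : ℕ) + 1 < i + j) :
    Am a b N r i ∈ lowIdeal b j := by
  rw [Am]
  split_ifs with h1
  · exact Ideal.mul_mem_left _ _ (uu_mem_lowIdeal (by omega))
  · exact zero_mem _

theorem Xm_col (hj : j ≤ b) {s} (hs : s ∈ nonpivots a b N j) (r) :
    Xm a b N j r s = 0 := by
  simp only [nonpivots, Finset.mem_filter, Finset.mem_univ, true_and] at hs
  rw [Xm, Matrix.add_apply, psi_mul_cm_apply hj, if_neg (by tauto),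
    Am_mul_tau_apply_eq_zero hs.2, zero_add]

theorem Xm_diag (ha : 1 ≤ a) (hN : N + 1 = a * b + b) (hj : j ≤ b) (r) :
    Xm a b N j r r - ((if r ∈ nonpivots a b N j then 0 else 1 : ℕ) : MvPolynomial (Fin (b + 1)) ℂ) *
      uu b j ^ a ∈ lowIdeal b j := by
  by_cases hr : r ∈ nonpivots a b N j
  · rw [Xm_col hj hr]; simp [hr]
  rw [if_neg hr, Nat.cast_one, one_mul]
  by_cases hl : r = Fin.last N
  · subst hl
    rw [Xm, Matrix.add_apply, psi_mul_cm_apply hj, if_pos ⟨rfl, rfl⟩,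
      Am_mul_tau_apply_eq_zero (Am_last_col_eq hN hj), zero_add]
    exact (cc_low a b j).2
  · simp only [nonpivots, Finset.mem_filter, Finset.mem_univ, true_and, hl, ne_eq,
      not_false_eq_true, not_forall] at hr
    obtain ⟨i, h1, h2⟩ := hr
    rw [Xm, Matrix.add_apply, psi_mul_cm_apply hj, if_neg (by tauto), add_zero,
      Am_mul_tau_apply h1 h2, Am_mul_inv_eq ha h1 h2, sub_self]
    exact zero_mem _

theorem Xm_off (hj : j ≤ b) (r s) (hrs : r ≠ s) :
    Xm a b N j r s ∈ lowIdeal b j ∨ (s : ℕ) < r := by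
  rcases lt_or_gt_of_ne hrs with h | h
  swap
  · exact Or.inr h
  left
  have hrl : r ≠ Fin.last N := (h.trans_le (Fin.le_last s)).ne
  rw [Xm, Matrix.add_apply, psi_mul_cm_apply hj, if_neg (by tauto), add_zero]
  by_cases hs : ∀ i : Fin (a * b + 1), (s : ℕ) + 1 = i + j → (i : ℕ) = a * j
  · rw [Am_mul_tau_apply_eq_zero hs]; exact zero_mem _
  · push Not at hs
    obtain ⟨i, h1, h2⟩ := hs
    rw [Am_mul_tau_apply h1 h2]
    have : (r : ℕ) < s := h
    exact Ideal.mul_mem_right _ _ (Am_mem_lowIdeal (by omega))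

theorem tau_mul_Am_apply (hN : N + 1 = a * b + b) (hj : j ≤ b) {i : Fin (a * b + 1)}
    (hi : (i : ℕ) ≠ a * j) : ∃ s : Fin (N + 1), (s : ℕ) + 1 = i + j ∧ ∀ i',
      (tau a b N j * Am a b N) i i' =
        Am a b N s i' * (C ((a * j : ℂ) - (i : ℕ))⁻¹ * uu b j ^ (a - 1)) := by
  have h0 : 1 ≤ (i : ℕ) + j := by
    rcases Nat.eq_zero_or_pos j with rfl | h
    · rw [mul_zero] at hi; omega
    · omega
  have := i.2
  refine ⟨⟨i + j - 1, by omega⟩, by simp; omega, fun i' => ?_⟩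
  rw [Matrix.mul_apply, Finset.sum_eq_single ⟨i + j - 1, by omega⟩]
  · rw [tau, if_pos ⟨by simp; omega, hi⟩, mul_comm]
  · intro s _ hs
    rw [tau, if_neg, zero_mul]
    rintro ⟨h, -⟩
    exact hs (Fin.ext (by simp; omega))
  · simp

theorem tau_mul_Am_apply_eq_zero {i : Fin (a * b + 1)} (hi : (i : ℕ) = a * j) (i') :
    (tau a b N j * Am a b N) i i' = 0 := by
  rw [Matrix.mul_apply]
  refine Finset.sum_eq_zero fun s _ => ?_
  rw [tau, if_neg (by tauto), zero_mul]

theorem Ym_diag (ha : 1 ≤ a) (hN : N + 1 = a * b + b) (hj : j ≤ b) (i) :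
    Ym a b N j i i - uu b j ^ a ∈ lowIdeal b j := by
  rw [Ym, Matrix.add_apply, cm_mul_psi_apply]
  by_cases hi : (i : ℕ) = a * j
  · rw [if_pos hi, tau_mul_Am_apply_eq_zero hi, zero_add, hi]
    exact (cc_low a b j).2
  · obtain ⟨s, h1, h2⟩ := tau_mul_Am_apply hN hj hi
    rw [if_neg hi, h2, Am_mul_inv_eq ha h1 hi, add_zero, sub_self]
    exact zero_mem _

theorem Ym_off (hN : N + 1 = a * b + b) (hj : j ≤ b) (i i') (hii : i ≠ i') :
    Ym a b N j i i' ∈ lowIdeal b j ∨ (i' : ℕ) < i := by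
  rcases lt_or_gt_of_ne hii with h | h
  swap
  · exact Or.inr h
  left
  have h' : (i : ℕ) < i' := h
  rw [Ym, Matrix.add_apply, cm_mul_psi_apply]
  refine Ideal.add_mem _ ?_ ?_
  · by_cases hi : (i : ℕ) = a * j
    · rw [tau_mul_Am_apply_eq_zero hi]; exact zero_mem _
    · obtain ⟨s, h1, h2⟩ := tau_mul_Am_apply hN hj hi
      rw [h2]
      exact Ideal.mul_mem_right _ _ (Am_mem_lowIdeal (by omega))
  · split_ifs with hi
    · exact (cc_low a b j).1 _ (by omega)
    · exact zero_mem _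

theorem card_nonpivots (hN : N + 1 = a * b + b) (hj : j ≤ b) :
    (nonpivots a b N j).card + 1 = b := by
  have hlt : a * j < a * b + 1 := Nat.lt_succ_of_le (Nat.mul_le_mul_left a hj)
  have h0 : ∀ i : Fin (a * b + 1), (i : ℕ) ≠ a * j → 1 ≤ (i : ℕ) + j := by
    intro i hi
    rcases Nat.eq_zero_or_pos j with rfl | h
    · rw [mul_zero] at hi; omega
    · omega
  let f : Fin (a * b + 1) → Fin (N + 1) := fun i => ⟨i + j - 1, by have := i.2; omega⟩
  have hf : ∀ i, (f i : ℕ) = i + j - 1 := fun i => rfl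
  have e : nonpivots a b N j = (insert (Fin.last N)
      ((Finset.univ.erase (⟨a * j, hlt⟩ : Fin (a * b + 1))).image f))ᶜ := by
    ext s
    simp only [nonpivots, Finset.mem_filter, Finset.mem_univ, true_and, Finset.mem_compl,
      Finset.mem_insert, Finset.mem_image, Finset.mem_erase, and_true, not_or, not_exists, not_and]
    refine and_congr_right fun _ => ⟨fun h i hi he => ?_, fun h i hi => ?_⟩
    · have hi' : (i : ℕ) ≠ a * j := fun h => hi (Fin.ext h)
      refine hi' (h i ?_)
      have := h0 i hi'
      rw [← he, hf]; omega
    · by_contra hi'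
      refine h i (fun h => hi' (by rw [h])) (Fin.ext ?_)
      rw [hf]; omega
  rw [e, Finset.card_compl, Finset.card_insert_of_notMem, Finset.card_image_of_injOn,
    Finset.card_erase_of_mem (Finset.mem_univ _), Finset.card_univ, Fintype.card_fin,
    Fintype.card_fin, hN, Nat.add_sub_cancel, Nat.sub_add_eq, Nat.add_sub_cancel_left]
  · have : b ≠ 0 := by rintro rfl; simp at hN
    omega
  · intro i hi i' hi' h
    simp only [Finset.coe_erase, Finset.coe_univ, Set.mem_sdiff, Set.mem_univ, true_and,
      Set.mem_singleton_iff] at hi hi'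
    have h1 := h0 i fun h => hi (Fin.ext h)
    have h2 := h0 i' fun h => hi' (Fin.ext h)
    have h3 := congrArg Fin.val h
    rw [hf, hf] at h3
    exact Fin.ext (by omega)
  · simp only [Finset.mem_image, Finset.mem_erase, Finset.mem_univ, and_true, not_exists, not_and]
    intro i hi h
    have h3 := congrArg Fin.val h
    rw [hf, Fin.val_last] at h3
    have h1 := h0 i fun h => hi (Fin.ext h)
    exact hi (Fin.ext (Am_last_col_eq hN hj i (by rw [Fin.val_last]; omega)))

end Matrices

theorem wt_le {O E : Type*} [Fintype E] (f : O → ℕ) (g : E → ℕ) (W : ℕ) (hf : ∀ r, f r ≤ W)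
    (hg : ∀ i, g i ≤ W) (β : Finset O × (E → ℕ)) : wt f g β ≤ W * wt 1 1 β := by
  simp only [wt, Pi.one_apply, mul_one, mul_add, Finset.mul_sum]
  refine Nat.add_le_add (Finset.sum_le_sum fun r _ => hf r) (Finset.sum_le_sum fun i _ => ?_)
  rw [mul_comm W]
  exact Nat.mul_le_mul_left _ (hg i)

namespace GradedComplex

theorem Hom.eq_zero {b : ℕ} {ι : Type*} {K : GradedComplex b ι} {i n : ℕ} {v}
    (hv : K.Hom i n v) {β} (hβ : ¬ K.lvl i β) : v β = 0 := by
  rw [← support_eq_empty, Finset.eq_empty_iff_forall_notMem]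
  exact fun m hm => hβ (hv β m hm).1

variable {b : ℕ} {O E : Type*} [LinearOrder O] [DecidableEq E] [Fintype O] [Fintype E]

theorem exists_fock_torsion (K : GradedComplex b (Finset O × (E → ℕ))) (hK : K.DHom)
    (j : Fin (b + 1)) (e i k W : ℕ)
    (h : Module.End (MvPolynomial (Fin (b + 1)) ℂ) (Fock (MvPolynomial (Fin (b + 1)) ℂ) O E))
    (hh : ∀ n v, K.Hom i n v → K.Hom (i + 1) (n + e) (h v))
    (hlvl : ∀ β, K.lvl i β → wt 1 1 β = k)
    (X : Matrix O O (MvPolynomial (Fin (b + 1)) ℂ)) (Y : Matrix E E (MvPolynomial (Fin (b + 1)) ℂ))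
    (hL : (K.D * h + h * K.D : Module.End _ _) = opF X + opB Y)
    (f k₀ : O → ℕ) (g : E → ℕ) (hf : ∀ r, f r ≤ W) (hg : ∀ i, g i ≤ W) (hk₀ : ∀ r, k₀ r ≤ 1)
    (hXd : ∀ r, X r r - (k₀ r : MvPolynomial (Fin (b + 1)) ℂ) * MvPolynomial.X j ^ e ∈ lowIdeal b j)
    (hX : ∀ r s, r ≠ s → X r s ∈ lowIdeal b j ∨ f s < f r)
    (hYd : ∀ i, Y i i - MvPolynomial.X j ^ e ∈ lowIdeal b j)
    (hY : ∀ i i', i ≠ i' → Y i i' ∈ lowIdeal b j ∨ g i' < g i)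
    (h0 : ∀ (P : Finset O) (q : E → ℕ), wt 1 1 (P, q) = k → wt k₀ 1 (P, q) = 0 → ∀ s ∈ P, ∀ r,
      X r s ∈ lowIdeal b j)
    {n : ℕ} {v} (hv : K.Hom i n v) (hDv : LowVec j (K.D v)) :
    ∃ M y v', K.Hom (i + 1) (n + M) y ∧ K.Hom i (n + M) v' ∧
      LowVec j ((MvPolynomial.X j ^ M : MvPolynomial (Fin (b + 1)) ℂ) • v - K.D y - v') ∧
      ∀ β, wt k₀ 1 β ≠ 0 → v' β ∈ lowIdeal b j := by
  set T := (W * k + 1) * (k + 1) with hT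
  have hκ : ∀ β, wt k₀ 1 β ≤ wt (1 : O → ℕ) (1 : E → ℕ) β := fun β => by
    unfold wt
    exact Nat.add_le_add_right (Finset.sum_le_sum fun r _ => hk₀ r) _
  let κ : ℕ → ℂ := fun s => if s % (k + 1) = 0 then 1 else (s % (k + 1) : ℕ)
  have hκ0 : ∀ s, κ s ≠ 0 := by
    intro s
    simp only [κ]
    split_ifs with h
    · exact one_ne_zero
    · exact_mod_cast h
  have tri : ∀ n v s, s < T → K.Hom i n v → (∀ β, omg f k₀ g k T β < s → v β ∈ lowIdeal b j) →
      ∀ β, omg f k₀ g k T β ≤ s →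
        (K.D (h v) + h (K.D v)) β - C (κ s) * (MvPolynomial.X j ^ e * v β) ∈ lowIdeal b j := by
    intro n v s hs hv hlow β hβ
    have e1 : (K.D (h v) + h (K.D v)) = (opF X + opB Y : Module.End _ _) v := by
      rw [← hL]; rfl
    have hv0 : ∀ β, wt 1 1 β ≠ k → v β = 0 := fun β hβ => hv.eq_zero fun h => hβ (hlvl β h)
    rw [e1]
    by_cases hkβ : wt 1 1 β = k
    · have h1 := fock_triangular (lowIdeal b j) (MvPolynomial.X j ^ e) X Y f k₀ g k T hk₀ hXd hX hYd
        hY h0 v s hs (fun β _ => hlow β) β hkβ hβ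
      rcases hβ.lt_or_eq with hlt | heq
      · have h2 := hlow β hlt
        have h3 := (lowIdeal b j).mul_mem_left ((wt k₀ 1 β : MvPolynomial (Fin (b + 1)) ℂ) *
          MvPolynomial.X j ^ e - C (κ s) * MvPolynomial.X j ^ e) h2
        have := (lowIdeal b j).add_mem h1 h3
        convert this using 1; ring
      · have hne : wt k₀ 1 β ≠ 0 := by
          intro h; rw [omg, if_pos h] at heq; omega
        have hlt : wt k₀ 1 β < k + 1 := by have := hκ β; omega
        have : s % (k + 1) = wt k₀ 1 β := by
          rw [← heq, omg, if_neg hne, Nat.mul_comm, Nat.mul_add_mod, Nat.mod_eq_of_lt hlt]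
        have hs : κ s = (wt k₀ 1 β : ℕ) := by
          simp only [κ]
          rw [this, if_neg hne]
        rw [hs, map_natCast]
        exact h1
    · rw [opF_add_opB_eq_zero X Y hv0 hkβ, hv0 β hkβ]; simp
  obtain ⟨M, y, v', hy, hv', hl, hω⟩ := exists_homotopy_step hK j e i T h hh (omg f k₀ g k T) κ hκ0
    tri hv hDv T le_rfl
  refine ⟨M, y, v', hy, hv', hl, fun β hβ => ?_⟩
  by_cases hkβ : wt 1 1 β = k
  · refine hω β ?_
    rw [omg, if_neg hβ]
    have h1 := wt_le f g W hf hg β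
    have h2 := hκ β
    rw [hkβ] at h1 h2
    calc _ ≤ W * k * (k + 1) + k := Nat.add_le_add (Nat.mul_le_mul_right _ h1) h2
      _ < T := by rw [hT]; nlinarith
  · rw [hv'.eq_zero fun h => hkβ (hlvl β h)]; exact zero_mem _

end GradedComplex

section Complexes
variable {a b N : ℕ}

theorem tau_last (hN : N + 1 = a * b + b) {j : ℕ} (hj : j ≤ b) (i) :
    tau a b N j i (Fin.last N) = 0 := by
  rw [tau, if_neg]
  rintro ⟨h1, h2⟩
  exact h2 (Am_last_col_eq hN hj i h1)

theorem tau_isHomogeneous (j : ℕ) (i s) : (tau a b N j i s).IsHomogeneous (a - 1) := by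
  rw [tau]
  split_ifs
  · have := (isHomogeneous_C (Fin (b + 1)) ((a * j : ℂ) - (i : ℕ))⁻¹).mul
      ((uu_isHomogeneous b j).pow (a - 1))
    simpa using this
  · exact isHomogeneous_zero _ _ _

theorem Am_isHomogeneous (r i) : (Am a b N r i).IsHomogeneous 1 := by
  rw [Am]
  split_ifs
  · have := (isHomogeneous_C (Fin (b + 1)) ((a : ℂ) * ((r + 1 - i : ℕ) : ℂ) - (i : ℕ))).mul
      (uu_isHomogeneous b (r + 1 - i))
    simpa using this
  · exact isHomogeneous_zero _ _ _

/-- A weight on rows which is `x` on the last row and `y` elsewhere. -/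
def lastWt (N x y : ℕ) : Fin (N + 1) → ℕ := fun r => if r = Fin.last N then x else y

theorem lastWt_last (N x y : ℕ) : lastWt N x y (Fin.last N) = x := if_pos rfl

theorem lastWt_of_ne {N : ℕ} (x y : ℕ) {r : Fin (N + 1)} (h : r ≠ Fin.last N) :
    lastWt N x y r = y := if_neg h

variable (a b N) in
/-- The dual complex. -/
noncomputable def dualComplex (hN : N + 1 = a * b + b) :
    GradedComplex b (Finset (Fin (N + 1)) × (Fin (a * b + 1) → ℕ)) where
  lvl i β := wt 1 1 β = b ∧ wt (lastWt N 0 2) 1 β + 1 = i + b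
  sh β := wt (lastWt N 0 (1 + a)) (fun _ => a) β
  D := opT (cm a b N).transpose + opU (Am a b N).transpose
  D_D v := by
    have := opT_add_opU_sq (cm a b N).transpose (Am a b N).transpose
      (by rw [← Matrix.transpose_mul, Am_mul_cm, Matrix.transpose_zero])
      (by rw [← Matrix.transpose_mul, cm_mul_Am hN, Matrix.transpose_zero])
    exact LinearMap.congr_fun this v

theorem dualComplex_DHom (hN : N + 1 = a * b + b) : (dualComplex a b N hN).DHom := by
  intro i n v hv β
  suffices h : opT (cm a b N).transpose v β + opU (Am a b N).transpose v β ∈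
      degSub fun t => (dualComplex a b N hN).lvl i β ∧ t + (dualComplex a b N hN).sh β = n from h
  refine add_mem ?_ ?_
  · refine opT_mem_degSub (Q := fun β t => (wt 1 1 β = b ∧ wt (lastWt N 0 2) 1 β + 1 = i + 1 + b) ∧
      t + wt (lastWt N 0 (1 + a)) (fun _ => a) β = n)
      (Q' := fun β t => (wt 1 1 β = b ∧ wt (lastWt N 0 2) 1 β + 1 = i + b) ∧
      t + wt (lastWt N 0 (1 + a)) (fun _ => a) β = n) _ ?_ v hv β
    intro r j
    by_cases hr : r = Fin.last N
    · subst hr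
      refine Or.inr ⟨a, by simpa [cm] using cc_isHomogeneous a b j, fun P q t hP ht => ?_⟩
      have h1 := wt_erase_add (1 : Fin (N + 1) → ℕ) 1 hP q j
      have h2 := wt_erase_add (lastWt N 0 2) 1 hP q j
      have h3 := wt_erase_add (lastWt N 0 (1 + a)) (fun _ => a) hP q j
      rw [lastWt_last] at h2 h3
      simp only [Pi.one_apply] at h1 h2
      omega
    · left; simp [cm, hr]
  · refine opU_mem_degSub (Q := fun β t => (wt 1 1 β = b ∧ wt (lastWt N 0 2) 1 β + 1 = i + 1 + b) ∧
      t + wt (lastWt N 0 (1 + a)) (fun _ => a) β = n)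
      (Q' := fun β t => (wt 1 1 β = b ∧ wt (lastWt N 0 2) 1 β + 1 = i + b) ∧
      t + wt (lastWt N 0 (1 + a)) (fun _ => a) β = n) _ ?_ v hv β
    intro r j
    by_cases hr : r = Fin.last N
    · left; rw [hr, Matrix.transpose_apply, Am_last hN]
    · refine Or.inr ⟨1, Am_isHomogeneous r j, fun P q t hP hq ht => ?_⟩
      have h1 := wt_insert_sub (1 : Fin (N + 1) → ℕ) 1 hP hq
      have h2 := wt_insert_sub (lastWt N 0 2) 1 hP hq
      have h3 := wt_insert_sub (lastWt N 0 (1 + a)) (fun _ => a) hP hq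
      rw [lastWt_of_ne _ _ hr] at h2 h3
      simp only [Pi.one_apply] at h1 h2
      omega

theorem dualComplex_torsion (ha : 1 ≤ a) (hN : N + 1 = a * b + b) (i : ℕ) (j : Fin (b + 1)) :
    (dualComplex a b N hN).Torsion i j := by
  intro n v hv hDv
  have hj : (j : ℕ) ≤ b := by omega
  have hcard := card_nonpivots hN hj
  have hpos : ∀ β : Finset (Fin (N + 1)) × (Fin (a * b + 1) → ℕ), wt 1 1 β = b →
      wt (fun r => if r ∈ nonpivots a b N j then 0 else 1) 1 β ≠ 0 := by
    intro β hβ h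
    simp only [wt, Pi.one_apply, mul_one, Nat.add_eq_zero_iff, Finset.sum_eq_zero_iff] at h hβ
    have hsub : β.1 ⊆ nonpivots a b N j := by
      intro r hr
      have := h.1 r hr
      by_contra hn
      simp [hn] at this
    have h2 := Finset.card_le_card hsub
    have h3 : ∑ i, β.2 i = 0 := Finset.sum_eq_zero h.2
    simp [h3] at hβ
    omega
  have hh : ∀ n v, (dualComplex a b N hN).Hom i n v → (dualComplex a b N hN).Hom (i + 1) (n + a)
      ((opU (psi a b N j).transpose + opT (tau a b N j).transpose : Module.End _ _) v) := by
    intro n v hv β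
    suffices h : opU (psi a b N j).transpose v β + opT (tau a b N j).transpose v β ∈
        degSub fun t => (dualComplex a b N hN).lvl (i + 1) β ∧
          t + (dualComplex a b N hN).sh β = n + a from h
    refine add_mem ?_ ?_
    · refine opU_mem_degSub (Q := fun β t => (wt 1 1 β = b ∧ wt (lastWt N 0 2) 1 β + 1 = i + b) ∧
        t + wt (lastWt N 0 (1 + a)) (fun _ => a) β = n)
        (Q' := fun β t => (wt 1 1 β = b ∧ wt (lastWt N 0 2) 1 β + 1 = i + 1 + b) ∧
        t + wt (lastWt N 0 (1 + a)) (fun _ => a) β = n + a) _ ?_ v hv β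
      intro r i'
      by_cases hr : r = Fin.last N ∧ (i' : ℕ) = a * j
      · refine Or.inr ⟨0, by simpa [psi, hr] using isHomogeneous_one _ _, fun P q t hP hq ht => ?_⟩
        have h1 := wt_insert_sub (1 : Fin (N + 1) → ℕ) 1 hP hq
        have h2 := wt_insert_sub (lastWt N 0 2) 1 hP hq
        have h3 := wt_insert_sub (lastWt N 0 (1 + a)) (fun _ => a) hP hq
        rw [hr.1, lastWt_last] at h2 h3
        simp only [Pi.one_apply] at h1 h2
        rw [hr.1] at *
        omega
      · left; rw [Matrix.transpose_apply, psi, if_neg hr]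
    · refine opT_mem_degSub (Q := fun β t => (wt 1 1 β = b ∧ wt (lastWt N 0 2) 1 β + 1 = i + b) ∧
        t + wt (lastWt N 0 (1 + a)) (fun _ => a) β = n)
        (Q' := fun β t => (wt 1 1 β = b ∧ wt (lastWt N 0 2) 1 β + 1 = i + 1 + b) ∧
        t + wt (lastWt N 0 (1 + a)) (fun _ => a) β = n + a) _ ?_ v hv β
      intro r i'
      by_cases hr : r = Fin.last N
      · left; rw [Matrix.transpose_apply, hr, tau_last hN hj]
      · refine Or.inr ⟨a - 1, tau_isHomogeneous _ _ _, fun P q t hP ht => ?_⟩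
        have h1 := wt_erase_add (1 : Fin (N + 1) → ℕ) 1 hP q i'
        have h2 := wt_erase_add (lastWt N 0 2) 1 hP q i'
        have h3 := wt_erase_add (lastWt N 0 (1 + a)) (fun _ => a) hP q i'
        rw [lastWt_of_ne _ _ hr] at h2 h3
        simp only [Pi.one_apply] at h1 h2
        omega
  have hL : ((dualComplex a b N hN).D * (opU (psi a b N j).transpose +
      opT (tau a b N j).transpose) + (opU (psi a b N j).transpose + opT (tau a b N j).transpose) *
      (dualComplex a b N hN).D : Module.End _ _) =
      opF (Xm a b N j).transpose + opB (Ym a b N j).transpose := by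
    have := homotopy_anticomm (cm a b N).transpose (tau a b N j).transpose (Am a b N).transpose
      (psi a b N j).transpose
    simp only [← Matrix.transpose_mul, ← Matrix.transpose_add] at this
    rw [Xm, Ym, add_comm (Am a b N * _), add_comm (tau a b N j * _)]
    exact this
  have hX : ∀ r s, r ≠ s → (Xm a b N j).transpose r s ∈ lowIdeal b j ∨ N - s.1 < N - r.1 := by
    intro r s hrs
    rcases Xm_off (a := a) (N := N) hj s r hrs.symm with h | h
    · exact Or.inl h
    · have := s.2
      right; omega
  have hY : ∀ r s, r ≠ s → (Ym a b N j).transpose r s ∈ lowIdeal b j ∨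
      a * b - s.1 < a * b - r.1 := by
    intro r s hrs
    rcases Ym_off (a := a) hN hj s r hrs.symm with h | h
    · exact Or.inl h
    · have := s.2
      right; omega
  obtain ⟨M, y, v', hy, hv', hl, h0⟩ := (dualComplex a b N hN).exists_fock_torsion
    (dualComplex_DHom hN) j a i b (N + a * b)
    (opU (psi a b N j).transpose + opT (tau a b N j).transpose) hh (fun β h => h.1)
    (Xm a b N j).transpose (Ym a b N j).transpose hL (fun r => N - r)
    (fun r => if r ∈ nonpivots a b N j then 0 else 1) (fun i => a * b - i)
    (fun r => by omega) (fun i => by omega) (fun r => by split_ifs <;> omega)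
    (fun r => by rw [Matrix.transpose_apply, ← uu_fin]; exact Xm_diag ha hN hj r) hX
    (fun r => by rw [Matrix.transpose_apply, ← uu_fin]; exact Ym_diag ha hN hj r) hY
    (fun P q h h' => absurd h' (hpos _ h)) hv hDv
  refine ⟨M, y, hy, ?_⟩
  intro β
  have h1 := hl β
  have h2 : v' β ∈ lowIdeal b j := by
    by_cases hβ : wt 1 1 β = b
    · exact h0 β (hpos β hβ)
    · rw [hv'.eq_zero fun h => hβ h.1]; exact zero_mem _
  have := (lowIdeal b j).add_mem h1 h2
  simpa using this

end Complexes

section Wedge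
variable {R O E : Type*} [CommRing R] [IsDomain R] [CharZero R] [LinearOrder O] [Fintype O]
  [DecidableEq E]

variable (R O E) in
/-- Creation of a fermion in the state given by a vector. -/
def cv : (O → R) →ₗ[R] Module.End R (Fock R O E) where
  toFun n := ∑ r, n r • cr r
  map_add' n m := by simp [add_smul, Finset.sum_add_distrib]
  map_smul' c n := by simp [Finset.smul_sum, smul_smul]

theorem cv_apply (n : O → R) (v : Fock R O E) (P q) :
    cv R O E n v (P, q) = ∑ r ∈ P, n r * (fsgn R r P * v (P.erase r, q)) := by
  have : cv R O E n v (P, q) = ∑ r, n r * cr r v (P, q) := by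
    simp [cv, LinearMap.sum_apply, Finset.sum_apply]
  rw [this, ← Finset.sum_filter_add_sum_filter_not Finset.univ (· ∈ P)]
  rw [Finset.sum_eq_zero (s := Finset.univ.filter fun r => ¬ r ∈ P), add_zero]
  · refine Finset.sum_congr (by ext; simp) fun r hr => ?_
    rw [cr_apply, if_pos hr]
  · intro r hr
    rw [cr_apply, if_neg (by simpa using hr), mul_zero]

theorem cv_anticomm (n m : O → R) : cv R O E n * cv R O E m = -(cv R O E m * cv R O E n) := by
  simp only [cv, LinearMap.coe_mk, AddHom.coe_mk, Finset.sum_mul_sum]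
  rw [Finset.sum_comm, ← Finset.sum_neg_distrib]
  refine Finset.sum_congr rfl fun r _ => ?_
  rw [← Finset.sum_neg_distrib]
  refine Finset.sum_congr rfl fun s _ => ?_
  rw [smul_mul_smul_comm, smul_mul_smul_comm, cr_mul_cr, smul_neg, mul_comm]

theorem cv_sq (n : O → R) : cv R O E n * cv R O E n = 0 := by
  have h := cv_anticomm (E := E) n n
  ext v β
  have := congrFun (LinearMap.congr_fun h v) β
  exact self_eq_neg.1 this

variable (R O E) in
/-- The action of the exterior algebra by creation operators. -/
noncomputable def extAct : ExteriorAlgebra R (O → R) →ₐ[R] Module.End R (Fock R O E) :=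
  ExteriorAlgebra.lift R ⟨cv R O E, cv_sq⟩

variable (R O E) in
/-- Products of creation operators, as an alternating map. -/
noncomputable def wedge (d : ℕ) : (O → R) [⋀^Fin d]→ₗ[R] Module.End R (Fock R O E) :=
  (extAct R O E).toLinearMap.compAlternatingMap (ExteriorAlgebra.ιMulti R d)

theorem wedge_apply {d : ℕ} (n : Fin d → O → R) :
    wedge R O E d n = (List.ofFn fun i => cv R O E (n i)).prod := by
  rw [wedge, LinearMap.compAlternatingMap_apply, ExteriorAlgebra.ιMulti_apply,
    AlgHom.toLinearMap_apply, map_list_prod, List.map_ofFn]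
  congr 2
  funext i
  exact ExteriorAlgebra.lift_ι_apply R _ _ _

theorem list_prod_mul_of_mem {A ι : Type*} [Ring A] (f : ι → A) (hf : ∀ i j, f i * f j = -(f j * f i))
    (h2 : ∀ i, f i * f i = 0) (l : List ι) {i : ι} (hi : i ∈ l) : (l.map f).prod * f i = 0 := by
  induction l with
  | nil => simp at hi
  | cons k l ih =>
    rw [List.map_cons, List.prod_cons, mul_assoc]
    by_cases h : i ∈ l
    · rw [ih h, mul_zero]
    · obtain rfl : i = k := by simpa [h] using hi
      have : ∀ l : List ι, (l.map f).prod * f i = f i * (l.map f).prod ∨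
          (l.map f).prod * f i = -(f i * (l.map f).prod) := by
        intro l
        induction l with
        | nil => simp
        | cons k l ih =>
          rw [List.map_cons, List.prod_cons, mul_assoc]
          rcases ih with h | h <;> rw [h]
          · right; rw [← mul_assoc, hf k i]; noncomm_ring
          · left; rw [mul_neg, ← mul_assoc, hf k i]; noncomm_ring
      rcases this l with h | h <;> rw [h]
      · rw [← mul_assoc, h2, zero_mul]
      · rw [mul_neg, ← mul_assoc, h2, zero_mul, neg_zero]

theorem wedge_mul_cv {d : ℕ} (n : Fin d → O → R) (i : Fin d) :
    wedge R O E d n * cv R O E (n i) = 0 := by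
  have := list_prod_mul_of_mem (fun i => cv R O E (n i)) (fun i j => cv_anticomm _ _)
    (fun i => cv_sq _) (List.finRange d) (List.mem_finRange i)
  rwa [← List.ofFn_eq_map, ← wedge_apply] at this

theorem wedge_append {d e : ℕ} (n : Fin d → O → R) (m : Fin e → O → R) :
    wedge R O E (d + e) (Fin.append n m) = wedge R O E d n * wedge R O E e m := by
  rw [wedge_apply, wedge_apply, wedge_apply, ← List.prod_append, ← List.ofFn_fin_append]
  congr 2
  funext i
  refine Fin.addCases (fun i => ?_) (fun i => ?_) i <;> simp

theorem wedge_succ {d : ℕ} (n : Fin (d + 1) → O → R) :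
    wedge R O E (d + 1) n = cv R O E (n 0) * wedge R O E d (fun i => n i.succ) := by
  rw [wedge_apply, wedge_apply, List.ofFn_succ, List.prod_cons]

/-- `∑ c_i n_i = 0` gives proportionality of maximal products. -/
theorem smul_wedge_update {M M' : Type*} [AddCommGroup M] [Module R M] [AddCommGroup M']
    [Module R M'] {d : ℕ} (w : M [⋀^Fin d]→ₗ[R] M') (n : Fin (d + 1) → M) (c : Fin (d + 1) → R)
    (h : ∑ i, c i • n i = 0) (i : Fin d) :
    c i.succ • w (fun i => n i.succ) =
      -(c 0 • w (Function.update (fun i => n i.succ) i (n 0))) := by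
  have h1 : c i.succ • n i.succ = -(c 0 • n 0) - ∑ k ∈ Finset.univ.erase i, c k.succ • n k.succ := by
    rw [Fin.sum_univ_succ, ← Finset.add_sum_erase _ _ (Finset.mem_univ i)] at h
    rw [eq_sub_iff_add_eq, eq_neg_iff_add_eq_zero, add_comm]; exact h
  have h2 : w (Function.update (fun i => n i.succ) i (c i.succ • n i.succ)) =
      c i.succ • w (fun i => n i.succ) := by
    rw [AlternatingMap.map_update_smul]
    congr 2
    exact Function.update_eq_self i (fun i => n i.succ)
  rw [← h2, h1, AlternatingMap.map_update_sub, AlternatingMap.map_update_neg,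
    AlternatingMap.map_update_smul, AlternatingMap.map_update_sum]
  rw [Finset.sum_eq_zero, sub_zero]
  intro k hk
  rw [AlternatingMap.map_update_smul, AlternatingMap.map_update_self, smul_zero]
  exact (Finset.ne_of_mem_erase hk).symm

theorem cv_congr {v w : Fock R O E} {q : E → ℕ} (h : ∀ P, v (P, q) = w (P, q)) (n : O → R) (P) :
    cv R O E n v (P, q) = cv R O E n w (P, q) := by
  simp [cv_apply, h]

theorem wedge_congr {v w : Fock R O E} {q : E → ℕ} (h : ∀ P, v (P, q) = w (P, q)) {d : ℕ}
    (n : Fin d → O → R) (P) : wedge R O E d n v (P, q) = wedge R O E d n w (P, q) := by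
  induction d generalizing P with
  | zero => simpa [wedge_apply] using h P
  | succ d ih =>
    rw [wedge_succ, Module.End.mul_apply, Module.End.mul_apply]
    exact cv_congr (fun P => ih _ P) _ P

end Wedge

section Support
variable {R O E : Type*} [CommRing R] [IsDomain R] [CharZero R] [LinearOrder O] [Fintype O]
  [DecidableEq E]

variable (R E) in
/-- The basis vector of the Fock space with fermions `P` and no bosons. -/
noncomputable def vac (P : Finset O) : Fock R O E := by
  classical exact Pi.single (P, 0) 1

theorem vac_apply (P Q : Finset O) : vac R E P (Q, 0) = if Q = P then 1 else 0 := by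
  classical
  rw [vac, Pi.single_apply]
  simp

theorem wedge_apply_eq_sum {d : ℕ} (n : Fin d → O → R) (v : Fock R O E) (Q) :
    wedge R O E d n v (Q, 0) = ∑ P, v (P, 0) * wedge R O E d n (vac R E P) (Q, 0) := by
  have := wedge_congr (q := 0) (v := v) (w := ∑ P, v (P, 0) • vac R E P) (fun P => by
    simp [Finset.sum_apply, vac_apply]) n Q
  rw [this, map_sum, Finset.sum_apply]
  simp

end Support

section Divisibility
variable {σ : Type*} {O E : Type*} [LinearOrder O] [Fintype O] [DecidableEq E]

theorem IsHomogeneous.mem_degSub {p : MvPolynomial σ ℂ} {n : ℕ} (h : p.IsHomogeneous n) :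
    p ∈ degSub fun t => t = n := by
  intro m hm
  have := h (mem_support_iff.1 hm)
  rw [← this, Finsupp.degree_eq_weight_one]; rfl

theorem isHomogeneous_of_mem_degSub {p : MvPolynomial σ ℂ} {n : ℕ} (h : p ∈ degSub fun t => t = n) :
    p.IsHomogeneous n := by
  intro m hm
  have := h m (mem_support_iff.2 hm)
  rw [← this, Finsupp.degree_eq_weight_one]; rfl

theorem wedge_vac_mem {d : ℕ} (n : Fin d → O → MvPolynomial σ ℂ) (hn : ∀ i r, (n i r).IsHomogeneous 1)
    {e : O} (he : ∀ i, n i e = 0) (P Q : Finset O) :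
    wedge _ O E d n (vac _ E P) (Q, 0) ∈ degSub fun t => t = d ∧ Q.card = P.card + d ∧
      (e ∈ Q ↔ e ∈ P) := by
  induction d generalizing Q with
  | zero =>
    rw [wedge_apply, List.ofFn_zero, List.prod_nil, Module.End.one_apply, vac_apply]
    split_ifs with h
    · intro m hm
      have := IsHomogeneous.mem_degSub (isHomogeneous_one σ ℂ) m hm
      simp [this, h]
    · exact zero_mem _
  | succ d ih =>
    rw [wedge_succ, Module.End.mul_apply, cv_apply]
    refine sum_mem fun r hr => ?_
    by_cases hre : r = e
    · rw [hre, he, zero_mul]; exact zero_mem _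
    refine mul_mem_degSub (hn 0 r) (fsgn_mul_mem_degSub r Q
      (ih (fun i => n i.succ) (fun i r => hn _ _) (fun i => he _) (Q.erase r))) ?_
    rintro t ⟨h1, h2, h3⟩
    rw [Finset.card_erase_of_mem hr] at h2
    have := Finset.card_pos.2 ⟨r, hr⟩
    refine ⟨by omega, by omega, ?_⟩
    rw [← h3, Finset.mem_erase]
    exact ⟨fun h => ⟨Ne.symm hre, h⟩, fun h => h.2⟩

theorem IsHomogeneous.of_X_pow_mul {i : σ} {e n : ℕ} {p : MvPolynomial σ ℂ}
    (h : (X i ^ e * p).IsHomogeneous (n + e)) : p.IsHomogeneous n := by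
  intro m hm
  have h1 := h (d := Finsupp.single i e + m) (by
    rw [X_pow_eq_monomial, coeff_monomial_mul]; simpa using hm)
  rw [map_add] at h1
  have h2 : (Finsupp.weight (1 : σ → ℕ)) (Finsupp.single i e) = e := by
    rw [Finsupp.weight_single]; simp
  omega

end Divisibility

section Delta
variable (a b N : ℕ)

local notation "RR" => MvPolynomial (Fin (b + 1)) ℂ

theorem cc_zero : cc a b 0 = X 0 ^ a := by
  have := (cc_low a b 0).2
  rw [mul_zero, mem_lowIdeal] at this
  have h : cc a b 0 - uu b 0 ^ a = 0 := by
    rw [← support_eq_empty, Finset.eq_empty_iff_forall_notMem]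
    intro m hm
    obtain ⟨i, hi, -⟩ := this m hm
    omega
  rw [sub_eq_zero.1 h]
  exact congrArg (· ^ a) (uu_fin (0 : Fin (b + 1)))

theorem cc_top : cc a b (a * b) = X (Fin.last b) ^ a := by
  rw [cc, Polynomial.coeff_pow_of_natDegree_le (Gp_natDegree_le b), Gp_coeff]
  exact congrArg (· ^ a) (uu_fin (Fin.last b))

/-- The product of all but the zeroth column of the matrix `Am`. -/
noncomputable def omega : Module.End RR (Fock RR (Fin (N + 1)) (Fin (a * b + 1))) :=
  wedge RR (Fin (N + 1)) (Fin (a * b + 1)) (a * b) fun i r => Am a b N r i.succ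

/-- All rows but the last one. -/
def full : Finset (Fin (N + 1)) := Finset.univ.erase (Fin.last N)

/-- The functional on `Fock` picking the coefficient of all rows. -/
noncomputable def fullPart : Fock RR (Fin (N + 1)) (Fin (a * b + 1)) →ₗ[RR] RR :=
  LinearMap.proj (full N, 0)

/-- The wedge with the full part taken, as an alternating map. -/
noncomputable def fullWedge (v : Fock RR (Fin (N + 1)) (Fin (a * b + 1))) :
    (Fin (N + 1) → RR) [⋀^Fin (a * b)]→ₗ[RR] RR :=
  ((fullPart a b N).comp (LinearMap.applyₗ v)).compAlternatingMap
    (wedge RR (Fin (N + 1)) (Fin (a * b + 1)) (a * b))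

theorem fullWedge_apply (v) (n) : fullWedge a b N v n =
    wedge RR (Fin (N + 1)) (Fin (a * b + 1)) (a * b) n v (full N, 0) := rfl

theorem sum_cc_smul_Am : ∑ i : Fin (a * b + 1), cc a b i • (fun r => Am a b N r i) = 0 := by
  funext r
  rw [Finset.sum_apply]
  refine Eq.trans ?_ (Am_mul_cc a b N r)
  exact Finset.sum_congr rfl fun i _ => mul_comm _ _

theorem cc_mul_omega (v) (i : Fin (a * b)) : cc a b (i.succ : ℕ) * omega a b N v (full N, 0) =
    -(cc a b 0 * fullWedge a b N v (Function.update (fun i r => Am a b N r i.succ) i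
      fun r => Am a b N r 0)) :=
  smul_wedge_update (fullWedge a b N v) (fun i r => Am a b N r i) (fun i => cc a b i)
    (sum_cc_smul_Am a b N) i

variable {a b N}

theorem cc_zero_dvd_omega (ha : 1 ≤ a) (hb : 1 ≤ b) (v) :
    cc a b 0 ∣ omega a b N v (full N, 0) := by
  obtain ⟨d, hd⟩ : ∃ d, a * b = d + 1 := Nat.exists_eq_add_of_le' (Nat.mul_pos ha hb)
  have h := cc_mul_omega a b N v ⟨d, by omega⟩
  rw [show ((Fin.succ (⟨d, by omega⟩ : Fin (a * b)) : Fin (a * b + 1)) : ℕ) = a * b by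
    simp [hd], cc_top] at h
  have h1 : cc a b 0 ∣ X (Fin.last b) ^ a * omega a b N v (full N, 0) := by
    rw [h]; exact (Dvd.intro _ rfl).neg_right
  rw [cc_zero] at h1 ⊢
  have hp : Prime (X 0 : RR) := MvPolynomial.X_prime
  refine hp.pow_dvd_of_dvd_mul_left a ?_ h1
  intro h2
  have h3 := hp.dvd_of_dvd_pow h2
  rw [MvPolynomial.X_dvd_X] at h3
  have := congrArg Fin.val h3
  simp at this
  omega

theorem card_full : (full N).card = N := by
  simp [full]

variable (a b N) in
/-- The value of the augmentation on the basis vector with fermions `P`. -/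
noncomputable def deltaP (P : Finset (Fin (N + 1))) : RR := by
  classical exact if h : cc a b 0 ∣ omega a b N (vac _ _ P) (full N, 0) then h.choose else 0

theorem cc_mul_deltaP (ha : 1 ≤ a) (hb : 1 ≤ b) (P) :
    cc a b 0 * deltaP a b N P = omega a b N (vac _ _ P) (full N, 0) := by
  have h := cc_zero_dvd_omega (N := N) ha hb (vac _ _ P)
  rw [deltaP, dif_pos h]
  exact h.choose_spec.symm

theorem cc_zero_ne_zero : cc a b 0 ≠ 0 := by
  rw [cc_zero]; exact pow_ne_zero _ (X_ne_zero _)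

theorem omega_vac_mem (hN : N + 1 = a * b + b) (P) : omega a b N (vac _ _ P) (full N, 0) ∈
    degSub fun t => t = a * b ∧ N = P.card + a * b ∧ Fin.last N ∉ P := by
  have := wedge_vac_mem (E := Fin (a * b + 1)) (fun (i : Fin (a * b)) r => Am a b N r i.succ)
    (fun i r => Am_isHomogeneous _ _) (e := Fin.last N) (fun i => Am_last hN _) P (full N)
  rw [card_full] at this
  refine fun m hm => ?_
  obtain ⟨h1, h2, h3⟩ := this m hm
  exact ⟨h1, h2, fun h => by simpa [full] using h3.2 h⟩

theorem deltaP_isHomogeneous (ha : 1 ≤ a) (hb : 1 ≤ b) (hN : N + 1 = a * b + b) (P) :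
    (deltaP a b N P).IsHomogeneous (a * (b - 1)) := by
  refine IsHomogeneous.of_X_pow_mul (i := 0) (e := a) ?_
  rw [← cc_zero, cc_mul_deltaP ha hb]
  refine isHomogeneous_of_mem_degSub fun m hm => ?_
  rw [(omega_vac_mem hN P m hm).1]
  obtain ⟨b, rfl⟩ := Nat.exists_eq_add_of_le' hb
  simp [mul_add]

theorem deltaP_eq_zero (ha : 1 ≤ a) (hb : 1 ≤ b) (hN : N + 1 = a * b + b) {P}
    (h : ¬ (P.card + 1 = b ∧ Fin.last N ∉ P)) : deltaP a b N P = 0 := by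
  have : cc a b 0 * deltaP a b N P = 0 := by
    rw [cc_mul_deltaP ha hb, ← support_eq_empty, Finset.eq_empty_iff_forall_notMem]
    intro m hm
    obtain ⟨-, h1, h2⟩ := omega_vac_mem hN P m hm
    exact h ⟨by omega, h2⟩
  exact (mul_eq_zero.1 this).resolve_left cc_zero_ne_zero

variable (a b N) in
/-- The augmentation. -/
noncomputable def delta : Fock RR (Fin (N + 1)) (Fin (a * b + 1)) →ₗ[RR] RR :=
  ∑ P, deltaP a b N P • LinearMap.proj (P, 0)

theorem delta_apply (v) : delta a b N v = ∑ P, v (P, 0) * deltaP a b N P := by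
  simp [delta, LinearMap.sum_apply, mul_comm]

theorem delta_vac (P) : delta a b N (vac _ _ P) = deltaP a b N P := by
  simp [delta_apply, vac_apply]

theorem cc_mul_delta (ha : 1 ≤ a) (hb : 1 ≤ b) (v) :
    cc a b 0 * delta a b N v = omega a b N v (full N, 0) := by
  rw [omega, wedge_apply_eq_sum, delta_apply, Finset.mul_sum]
  refine Finset.sum_congr rfl fun P _ => ?_
  rw [mul_left_comm, cc_mul_deltaP ha hb, omega]

theorem delta_cv_Am (ha : 1 ≤ a) (hb : 1 ≤ b) (v) (j : Fin (a * b + 1)) :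
    delta a b N (cv _ _ _ (fun r => Am a b N r j) v) = 0 := by
  have hs : ∀ j : Fin (a * b), delta a b N (cv _ _ _ (fun r => Am a b N r j.succ) v) = 0 := by
    intro j
    refine (mul_eq_zero.1 ?_).resolve_left (cc_zero_ne_zero (a := a) (b := b))
    rw [cc_mul_delta ha hb, omega, ← Module.End.mul_apply]
    have := wedge_mul_cv (E := Fin (a * b + 1)) (fun (i : Fin (a * b)) r => Am a b N r i.succ) j
    rw [this]; rfl
  refine Fin.cases ?_ hs j
  have h := congrArg (fun n => delta a b N (cv RR _ (Fin (a * b + 1)) n v)) (sum_cc_smul_Am a b N)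
  simp only [Fin.sum_univ_succ, map_add, map_sum, map_smul, map_zero, LinearMap.add_apply,
    LinearMap.smul_apply, LinearMap.sum_apply, LinearMap.zero_apply, hs,
    Finset.sum_const_zero, mul_zero, add_zero, smul_eq_mul] at h
  exact (mul_eq_zero.1 h).resolve_left (cc_zero_ne_zero (a := a) (b := b))

theorem delta_opT (ha : 1 ≤ a) (hb : 1 ≤ b) (v) : delta a b N (opT (Am a b N) v) = 0 := by
  have : (opT (Am a b N) : Module.End RR (Fock RR (Fin (N + 1)) (Fin (a * b + 1)))) =
      ∑ j, cv _ _ _ (fun r => Am a b N r j) * dn j := by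
    rw [opT, Finset.sum_comm]
    refine Finset.sum_congr rfl fun j _ => ?_
    simp [cv, Finset.sum_mul]
  rw [this, LinearMap.sum_apply, map_sum]
  exact Finset.sum_eq_zero fun j _ => delta_cv_Am ha hb _ j

theorem delta_opU (v) : delta a b N (opU (cm a b N) v) = 0 := by
  rw [delta_apply]
  refine Finset.sum_eq_zero fun P _ => ?_
  have : opU (cm a b N) v (P, 0) = 0 := by
    rw [opU_apply]
    simp [up_apply]
  rw [this, zero_mul]

end Delta

section Vac
variable {R O E : Type*} [CommRing R] [IsDomain R] [CharZero R] [LinearOrder O] [Fintype O]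
  [DecidableEq E]

theorem vac_apply_of_ne (P Q : Finset O) {q : E → ℕ} (hq : q ≠ 0) : vac R E P (Q, q) = 0 := by
  classical
  rw [vac, Pi.single_apply, if_neg (by simp [hq])]

theorem cr_vac {r : O} {P : Finset O} (h : r ∉ P) :
    cr r (vac R E P) = fsgn R r P • vac R E (insert r P) := by
  funext ⟨Q, q⟩
  rw [cr_apply, Pi.smul_apply]
  by_cases hq : q = 0
  swap
  · simp [vac_apply_of_ne, hq]
  subst hq
  rw [vac_apply, vac_apply]
  by_cases hr : r ∈ Q
  · rw [if_pos hr]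
    by_cases hQ : Q = insert r P
    · subst hQ
      rw [Finset.erase_insert h, ← fsgn_erase_self, Finset.erase_insert h]
      simp
    · have : Q.erase r ≠ P := by
        rintro rfl; exact hQ (Finset.insert_erase hr).symm
      simp [hQ, this]
  · rw [if_neg hr]
    have : Q ≠ insert r P := by rintro rfl; simp at hr
    simp [this]

theorem cr_vac_of_mem {r : O} {P : Finset O} (h : r ∈ P) : cr r (vac R E P) = 0 := by
  funext ⟨Q, q⟩
  rw [cr_apply]
  by_cases hq : q = 0
  swap
  · simp [vac_apply_of_ne, hq]
  subst hq
  have : Q.erase r ≠ P := by rintro rfl; simp at h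
  simp [this, vac_apply]

theorem cv_vac (n : O → R) (P : Finset O) :
    cv R O E n (vac R E P) = ∑ r, n r • cr r (vac R E P) := by
  simp [cv, LinearMap.sum_apply]

end Vac

section Value
variable {a b N : ℕ}

local notation "RR" => MvPolynomial (Fin (b + 1)) ℂ

theorem fsgn_eq (O : Type*) [LinearOrder O] (r : O) (P : Finset O) :
    ∃ κ : ℂ, κ ≠ 0 ∧ fsgn RR r P = C κ := by
  rw [fsgn]
  exact ⟨(-1) ^ (P.filter (· < r)).card, pow_ne_zero _ (by norm_num), by simp⟩

theorem prod_cv_vac (hN : N + 1 = a * b + b) {j : ℕ} (hj : j ≤ b) (l : List (Fin (a * b + 1)))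
    (hs : l.Pairwise (· < ·)) (h0 : ∀ i ∈ l, (i : ℕ) ≠ a * j)
    (hup : ∀ i ∈ l, ∀ i', i < i' → (i' : ℕ) ≠ a * j → i' ∈ l) :
    ∃ κ : ℂ, κ ≠ 0 ∧ LowVec j ((l.map fun i => cv RR _ (Fin (a * b + 1)) fun r =>
        Am a b N r i).prod (vac _ _ (nonpivots a b N j)) -
      (C κ * uu b j ^ l.length) • vac _ _ (nonpivots a b N j ∪
        Finset.univ.filter fun r => ∃ i ∈ l, (r : ℕ) + 1 = i + j)) := by
  induction l with
  | nil =>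
    refine ⟨1, one_ne_zero, ?_⟩
    simpa using LowVec.zero
  | cons i l ih =>
    rw [List.pairwise_cons] at hs
    obtain ⟨κ, hκ, h⟩ := ih hs.2 (fun i hi => h0 i (List.mem_cons_of_mem _ hi))
      (fun i' hi' i'' hlt hne => by
        rcases List.mem_cons.1 (hup i' (List.mem_cons_of_mem _ hi') i'' hlt hne) with h | h
        · have := hs.1 i' hi'
          rw [h] at hlt
          exact absurd this hlt.not_gt
        · exact h)
    set P := nonpivots a b N j ∪ Finset.univ.filter fun r : Fin (N + 1) =>
      ∃ i ∈ l, (r : ℕ) + 1 = i + j with hP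
    have hi0 := h0 i List.mem_cons_self
    obtain ⟨ρ, hρ⟩ : ∃ ρ : Fin (N + 1), (ρ : ℕ) + 1 = i + j := by
      have : i + j ≠ 0 := by
        intro h
        have h1 : j = 0 := by omega
        rw [h1, mul_zero] at hi0; omega
      exact ⟨⟨i + j - 1, by omega⟩, by simp only; omega⟩
    have hρP : ρ ∉ P := by
      rw [hP, Finset.mem_union, not_or]
      refine ⟨fun h => hi0 ?_, fun h => ?_⟩
      · exact (Finset.mem_filter.1 h).2.2 i hρ
      · obtain ⟨i', hi', h⟩ := (Finset.mem_filter.1 h).2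
        have := hs.1 i' hi'
        rw [Fin.lt_def] at this
        omega
    have hins : nonpivots a b N j ∪ Finset.univ.filter (fun r : Fin (N + 1) =>
        ∃ i' ∈ i :: l, (r : ℕ) + 1 = i' + j) = insert ρ P := by
      ext r
      simp only [hP, Finset.mem_union, Finset.mem_insert, Finset.mem_filter, Finset.mem_univ,
        true_and, List.mem_cons, exists_eq_or_imp]
      have : (r : ℕ) + 1 = i + j ↔ r = ρ := by rw [Fin.ext_iff]; omega
      rw [this]
      tauto
    obtain ⟨ε, hε, hε'⟩ := fsgn_eq (b := b) _ ρ P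
    have hA : Am a b N ρ i = C ((a : ℂ) * j - (i : ℕ)) * uu b j := by
      rw [Am, if_pos (by omega), show (ρ : ℕ) + 1 - i = j by omega]
    have hne : ((a : ℂ) * j - (i : ℕ)) ≠ 0 := by
      rw [sub_ne_zero]; exact_mod_cast hi0.symm
    refine ⟨ε * ((a : ℂ) * j - (i : ℕ)) * κ, mul_ne_zero (mul_ne_zero hε hne) hκ, ?_⟩
    rw [hins, List.map_cons, List.prod_cons, Module.End.mul_apply, List.length_cons]
    have h1 := h.map (cv RR _ (Fin (a * b + 1)) fun r => Am a b N r i)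
    rw [map_sub, map_smul] at h1
    have h2 : LowVec j (cv RR _ (Fin (a * b + 1)) (fun r => Am a b N r i) (vac _ _ P) -
        (C (ε * ((a : ℂ) * j - (i : ℕ))) * uu b j) • vac _ _ (insert ρ P)) := by
      rw [cv_vac, ← Finset.add_sum_erase _ _ (Finset.mem_univ ρ), cr_vac hρP, smul_smul, hA, hε',
        show C ((a : ℂ) * j - (i : ℕ)) * uu b j * C ε =
          C (ε * ((a : ℂ) * j - (i : ℕ))) * uu b j by rw [C_mul]; ring, add_sub_cancel_left]
      intro β
      rw [Finset.sum_apply]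
      refine sum_mem fun r hr => ?_
      have hrρ := Finset.ne_of_mem_erase hr
      rcases Nat.lt_or_ge ((r : ℕ) + 1) (i + j) with h | h
      · exact Ideal.mul_mem_right _ _ (Am_mem_lowIdeal h)
      · have hlt : (i : ℕ) + j < r + 1 := by
          refine lt_of_le_of_ne h fun h => hrρ ?_
          rw [Fin.ext_iff]; omega
        by_cases hl : r = Fin.last N
        · rw [hl, Am_last hN, zero_smul]; exact zero_mem _
        · have : r ∈ P := by
            rw [hP, Finset.mem_union]
            by_cases hr' : r ∈ nonpivots a b N j
            · exact Or.inl hr'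
            · right
              rw [nonpivots, Finset.mem_filter] at hr'
              push Not at hr'
              obtain ⟨i', h1, h2⟩ := hr' (Finset.mem_univ r) hl
              refine Finset.mem_filter.2 ⟨Finset.mem_univ _, i', ?_, h1⟩
              have h3 : i < i' := by rw [Fin.lt_def]; omega
              rcases List.mem_cons.1 (hup i List.mem_cons_self i' h3 h2) with h | h
              · exact absurd h h3.ne'
              · exact h
          rw [cr_vac_of_mem this, smul_zero]; exact zero_mem _
    have h3 := h1.add (h2.smul (C κ * uu b j ^ l.length))
    convert h3 using 1
    rw [smul_sub, smul_smul, sub_add_sub_cancel]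
    congr 2
    rw [C_mul (a := ε * _)]; ring

theorem fullWedge_vac (hN : N + 1 = a * b + b) {j : ℕ} (hj : j ≤ b) {i₀ : Fin (a * b + 1)}
    (hi₀ : (i₀ : ℕ) = a * j) : ∃ κ : ℂ, κ ≠ 0 ∧
      fullWedge a b N (vac _ _ (nonpivots a b N j)) (fun i r => Am a b N r (i₀.succAbove i)) -
      C κ * uu b j ^ (a * b) ∈ lowIdeal b j := by
  obtain ⟨κ, hκ, h⟩ := prod_cv_vac hN hj (List.ofFn i₀.succAbove) (by
    rw [List.pairwise_ofFn]
    exact fun i i' h => (Fin.strictMono_succAbove i₀) h) (by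
    intro i hi h
    obtain ⟨k, rfl⟩ := (List.mem_ofFn' _ _).1 hi
    exact Fin.succAbove_ne i₀ k (Fin.ext (h.trans hi₀.symm))) (by
    intro i hi i' _ h
    obtain ⟨k, hk⟩ := Fin.exists_succAbove_eq (x := i') (y := i₀) (fun h' => h (by rw [h', hi₀]))
    exact (List.mem_ofFn' _ _).2 ⟨k, hk⟩)
  refine ⟨κ, hκ, ?_⟩
  have h1 := h (full N, 0)
  rw [List.length_ofFn, List.map_ofFn, Pi.sub_apply, Pi.smul_apply, vac_apply, if_pos, smul_eq_mul,
    mul_one] at h1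
  · rw [fullWedge_apply, wedge_apply]; exact h1
  · ext r
    simp only [full, nonpivots, Finset.mem_erase, Finset.mem_union, Finset.mem_filter,
      Finset.mem_univ, true_and, and_true]
    constructor
    · intro hr
      by_cases hp : ∀ i : Fin (a * b + 1), (r : ℕ) + 1 = i + j → (i : ℕ) = a * j
      · exact Or.inl ⟨hr, hp⟩
      · push Not at hp
        obtain ⟨i, h1, h2⟩ := hp
        obtain ⟨k, hk⟩ := Fin.exists_succAbove_eq (x := i) (y := i₀)
          (fun h' => h2 (by rw [h', hi₀]))
        exact Or.inr ⟨i, (List.mem_ofFn' _ _).2 ⟨k, hk⟩, h1⟩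
    · rintro (h | ⟨i, hi, h⟩)
      · exact h.1
      · rintro rfl
        obtain ⟨k, rfl⟩ := (List.mem_ofFn' _ _).1 hi
        exact Fin.succAbove_ne i₀ k (Fin.ext ((Am_last_col_eq hN hj _ h).trans hi₀.symm))

theorem cc_mul_deltaP_eq (ha : 1 ≤ a) (hb : 1 ≤ b) (P) (i₀ : Fin (a * b + 1)) :
    ∃ κ : ℂ, κ ≠ 0 ∧ cc a b i₀ * deltaP a b N P =
      C κ * fullWedge a b N (vac _ _ P) (fun i r => Am a b N r (i₀.succAbove i)) := by
  induction i₀ using Fin.cases with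
  | zero =>
    refine ⟨1, one_ne_zero, ?_⟩
    rw [Fin.val_zero, cc_mul_deltaP ha hb, C_1, one_mul]
    rfl
  | succ k =>
    have h := cc_mul_omega a b N (vac _ _ P) k
    rw [← cc_mul_deltaP ha hb, mul_left_comm, ← mul_neg] at h
    have h1 := mul_left_cancel₀ cc_zero_ne_zero h
    set g : Fin (a * b) → Fin (a * b + 1) := Function.update Fin.succ k 0 with hg
    have hg' : Function.update (fun i r => Am a b N r i.succ) k (fun r => Am a b N r 0) =
        fun i r => Am a b N r (g i) := by
      funext i
      by_cases h : i = k
      · subst h; simp [hg]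
      · simp [hg, h]
    have hgk : ∀ i, g i ≠ k.succ := by
      intro i
      by_cases h : i = k
      · subst h; simp [hg, (Fin.succ_ne_zero _).symm]
      · simp [hg, h]
    have hinj : Function.Injective g := by
      intro i i' h
      by_cases h1 : i = k <;> by_cases h2 : i' = k
      · rw [h1, h2]
      · subst h1; simp [hg, h2] at h; exact absurd h.symm (Fin.succ_ne_zero _)
      · subst h2; simp [hg, h1] at h
      · simpa [hg, h1, h2] using h
    choose σ hσ using fun i => Fin.exists_succAbove_eq (hgk i)
    have hσi : Function.Injective σ := by
      intro i i' h
      apply hinj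
      rw [← hσ, ← hσ, h]
    let τ : Equiv.Perm (Fin (a * b)) := Equiv.ofBijective σ (Finite.injective_iff_bijective.1 hσi)
    have h2 := (fullWedge a b N (vac _ _ P)).map_perm
      (fun i r => Am a b N r (k.succ.succAbove i)) τ
    have h3 : (fun i r => Am a b N r (k.succ.succAbove i)) ∘ τ = fun i r => Am a b N r (g i) := by
      funext i r
      simp only [Function.comp, ← hσ]
      rfl
    rw [h3, ← hg'] at h2
    rw [h2] at h1
    rcases Int.units_eq_one_or τ.sign with h4 | h4
    · refine ⟨-1, by norm_num, ?_⟩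
      rw [h4] at h1
      rw [h1]; simp
    · refine ⟨1, by norm_num, ?_⟩
      rw [h4] at h1
      rw [h1]; simp

theorem deltaP_nonpivots (ha : 1 ≤ a) (hb : 1 ≤ b) (hN : N + 1 = a * b + b) (j : Fin (b + 1)) :
    ∃ κ : ℂ, κ ≠ 0 ∧
      deltaP a b N (nonpivots a b N j) - C κ * X j ^ (a * (b - 1)) ∈ lowIdeal b j := by
  have hj : (j : ℕ) ≤ b := by omega
  obtain ⟨κ, hκ, h⟩ := cc_mul_deltaP_eq (N := N) ha hb (nonpivots a b N j)
    ⟨a * j, Nat.lt_succ_of_le (Nat.mul_le_mul_left a hj)⟩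
  obtain ⟨κ', hκ', h'⟩ := fullWedge_vac (i₀ := ⟨a * j, Nat.lt_succ_of_le (Nat.mul_le_mul_left a hj)⟩)
    hN hj rfl
  refine ⟨κ * κ', mul_ne_zero hκ hκ', mem_lowIdeal_of_X_pow_mul a ?_⟩
  have h2 := Ideal.mul_mem_left _ (C κ) h'
  have h3 := Ideal.mul_mem_right (deltaP a b N (nonpivots a b N j)) _ (cc_low a b j).2
  have h4 := sub_mem h2 h3
  rw [mul_sub, ← h, uu_fin] at h4
  have hab : a * b = a + a * (b - 1) := by
    rw [← mul_one_add, Nat.add_sub_cancel' hb]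
  have hX : (X j : RR) ^ (a * b) = X j ^ a * X j ^ (a * (b - 1)) := by rw [← pow_add, ← hab]
  convert h4 using 1
  rw [C_mul, hX]
  ring

end Value

section Plain
variable {a b N : ℕ}

local notation "RR" => MvPolynomial (Fin (b + 1)) ℂ

variable (a b N) in
/-- The main complex, without its augmentation. -/
noncomputable def plainComplex (hN : N + 1 = a * b + b) :
    GradedComplex b (Finset (Fin (N + 1)) × (Fin (a * b + 1) → ℕ)) where
  lvl i β := wt 1 1 β + 1 = b ∧ wt (lastWt N 2 0) 1 β = i
  sh β := wt (lastWt N (1 + a) 0) 1 β + a * (b - 1)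
  D := opT (Am a b N) + opU (cm a b N)
  D_D v := LinearMap.congr_fun (opT_add_opU_sq _ _ (Am_mul_cm a b N) (cm_mul_Am hN)) v

theorem plainComplex_DHom (hN : N + 1 = a * b + b) : (plainComplex a b N hN).DHom := by
  intro i n v hv β
  suffices h : opT (Am a b N) v β + opU (cm a b N) v β ∈
      degSub fun t => (plainComplex a b N hN).lvl i β ∧ t + (plainComplex a b N hN).sh β = n from h
  refine add_mem ?_ ?_
  · refine opT_mem_degSub (Q := fun β t => (wt 1 1 β + 1 = b ∧ wt (lastWt N 2 0) 1 β = i + 1) ∧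
      t + (wt (lastWt N (1 + a) 0) 1 β + a * (b - 1)) = n)
      (Q' := fun β t => (wt 1 1 β + 1 = b ∧ wt (lastWt N 2 0) 1 β = i) ∧
      t + (wt (lastWt N (1 + a) 0) 1 β + a * (b - 1)) = n) _ ?_ v hv β
    intro r j
    by_cases hr : r = Fin.last N
    · left; rw [hr, Am_last hN]
    · refine Or.inr ⟨1, Am_isHomogeneous r j, fun P q t hP ht => ?_⟩
      have h1 := wt_erase_add (1 : Fin (N + 1) → ℕ) 1 hP q j
      have h2 := wt_erase_add (lastWt N 2 0) 1 hP q j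
      have h3 := wt_erase_add (lastWt N (1 + a) 0) 1 hP q j
      rw [lastWt_of_ne _ _ hr] at h2 h3
      simp only [Pi.one_apply] at h1 h2 h3
      omega
  · refine opU_mem_degSub (Q := fun β t => (wt 1 1 β + 1 = b ∧ wt (lastWt N 2 0) 1 β = i + 1) ∧
      t + (wt (lastWt N (1 + a) 0) 1 β + a * (b - 1)) = n)
      (Q' := fun β t => (wt 1 1 β + 1 = b ∧ wt (lastWt N 2 0) 1 β = i) ∧
      t + (wt (lastWt N (1 + a) 0) 1 β + a * (b - 1)) = n) _ ?_ v hv β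
    intro r j
    by_cases hr : r = Fin.last N
    · subst hr
      refine Or.inr ⟨a, by simpa [cm] using cc_isHomogeneous a b j, fun P q t hP hq ht => ?_⟩
      have h1 := wt_insert_sub (1 : Fin (N + 1) → ℕ) 1 hP hq
      have h2 := wt_insert_sub (lastWt N 2 0) 1 hP hq
      have h3 := wt_insert_sub (lastWt N (1 + a) 0) 1 hP hq
      rw [lastWt_last] at h2 h3
      simp only [Pi.one_apply] at h1 h2 h3
      omega
    · left; simp [cm, hr]

theorem plainComplex_D_of_zero (hN : N + 1 = a * b + b) {n v}
    (hv : (plainComplex a b N hN).Hom 0 n v) : (plainComplex a b N hN).D v = 0 := by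
  funext β
  suffices h : opT (Am a b N) v β + opU (cm a b N) v β ∈ degSub fun _ => False by
    have h' : (plainComplex a b N hN).D v β ∈ degSub fun _ => False := h
    rw [Pi.zero_apply, ← support_eq_empty, Finset.eq_empty_iff_forall_notMem]
    exact h'
  refine add_mem ?_ ?_
  · refine opT_mem_degSub (Q := fun β t => (wt 1 1 β + 1 = b ∧ wt (lastWt N 2 0) 1 β = 0) ∧
      t + (wt (lastWt N (1 + a) 0) 1 β + a * (b - 1)) = n)
      (Q' := fun β t => False) _ ?_ v hv β
    intro r j
    by_cases hr : r = Fin.last N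
    · left; rw [hr, Am_last hN]
    · refine Or.inr ⟨1, Am_isHomogeneous r j, fun P q t hP ht => ?_⟩
      have h2 := wt_erase_add (lastWt N 2 0) 1 hP q j
      rw [lastWt_of_ne _ _ hr] at h2
      simp only [Pi.one_apply] at h2
      omega
  · refine opU_mem_degSub (Q := fun β t => (wt 1 1 β + 1 = b ∧ wt (lastWt N 2 0) 1 β = 0) ∧
      t + (wt (lastWt N (1 + a) 0) 1 β + a * (b - 1)) = n)
      (Q' := fun β t => False) _ ?_ v hv β
    intro r j
    by_cases hr : r = Fin.last N
    · subst hr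
      refine Or.inr ⟨a, by simpa [cm] using cc_isHomogeneous a b j, fun P q t hP hq ht => ?_⟩
      have h2 := wt_insert_sub (lastWt N 2 0) 1 hP hq
      rw [lastWt_last] at h2
      simp only [Pi.one_apply] at h2
      omega
    · left; simp [cm, hr]

theorem plainComplex_torsion (ha : 1 ≤ a) (hN : N + 1 = a * b + b) (i : ℕ) (j : Fin (b + 1)) {n v}
    (hv : (plainComplex a b N hN).Hom i n v) (hDv : LowVec j ((plainComplex a b N hN).D v)) :
    ∃ M y v', (plainComplex a b N hN).Hom (i + 1) (n + M) y ∧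
      (plainComplex a b N hN).Hom i (n + M) v' ∧
      LowVec j ((X j ^ M : RR) • v - (plainComplex a b N hN).D y - v') ∧
      ∀ β, β ≠ (nonpivots a b N j, 0) → v' β ∈ lowIdeal b j := by
  have hj : (j : ℕ) ≤ b := by omega
  have hcard := card_nonpivots hN hj
  have hsub : ∀ β : Finset (Fin (N + 1)) × (Fin (a * b + 1) → ℕ),
      wt (fun r => if r ∈ nonpivots a b N j then 0 else 1) 1 β = 0 →
      β.1 ⊆ nonpivots a b N j ∧ β.2 = 0 := by
    intro β h
    simp only [wt, Pi.one_apply, mul_one, Nat.add_eq_zero_iff, Finset.sum_eq_zero_iff] at h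
    refine ⟨fun r hr => ?_, funext fun i => h.2 i (Finset.mem_univ i)⟩
    have := h.1 r hr
    by_contra hn
    simp [hn] at this
  have hh : ∀ n v, (plainComplex a b N hN).Hom i n v → (plainComplex a b N hN).Hom (i + 1) (n + a)
      ((opU (tau a b N j) + opT (psi a b N j) : Module.End _ _) v) := by
    intro n v hv β
    suffices h : opU (tau a b N j) v β + opT (psi a b N j) v β ∈
        degSub fun t => (plainComplex a b N hN).lvl (i + 1) β ∧
          t + (plainComplex a b N hN).sh β = n + a from h
    refine add_mem ?_ ?_
    · refine opU_mem_degSub (Q := fun β t => (wt 1 1 β + 1 = b ∧ wt (lastWt N 2 0) 1 β = i) ∧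
        t + (wt (lastWt N (1 + a) 0) 1 β + a * (b - 1)) = n)
        (Q' := fun β t => (wt 1 1 β + 1 = b ∧ wt (lastWt N 2 0) 1 β = i + 1) ∧
        t + (wt (lastWt N (1 + a) 0) 1 β + a * (b - 1)) = n + a) _ ?_ v hv β
      intro r i'
      by_cases hr : r = Fin.last N
      · left; rw [hr, tau_last hN hj]
      · refine Or.inr ⟨a - 1, tau_isHomogeneous _ _ _, fun P q t hP hq ht => ?_⟩
        have h1 := wt_insert_sub (1 : Fin (N + 1) → ℕ) 1 hP hq
        have h2 := wt_insert_sub (lastWt N 2 0) 1 hP hq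
        have h3 := wt_insert_sub (lastWt N (1 + a) 0) 1 hP hq
        rw [lastWt_of_ne _ _ hr] at h2 h3
        simp only [Pi.one_apply] at h1 h2 h3
        omega
    · refine opT_mem_degSub (Q := fun β t => (wt 1 1 β + 1 = b ∧ wt (lastWt N 2 0) 1 β = i) ∧
        t + (wt (lastWt N (1 + a) 0) 1 β + a * (b - 1)) = n)
        (Q' := fun β t => (wt 1 1 β + 1 = b ∧ wt (lastWt N 2 0) 1 β = i + 1) ∧
        t + (wt (lastWt N (1 + a) 0) 1 β + a * (b - 1)) = n + a) _ ?_ v hv β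
      intro r i'
      by_cases hr : r = Fin.last N ∧ (i' : ℕ) = a * j
      · refine Or.inr ⟨0, by simpa [psi, hr] using isHomogeneous_one _ _, fun P q t hP ht => ?_⟩
        have h1 := wt_erase_add (1 : Fin (N + 1) → ℕ) 1 hP q i'
        have h2 := wt_erase_add (lastWt N 2 0) 1 hP q i'
        have h3 := wt_erase_add (lastWt N (1 + a) 0) 1 hP q i'
        rw [hr.1, lastWt_last] at h2 h3
        simp only [Pi.one_apply] at h1 h2 h3
        rw [hr.1] at *
        omega
      · left; rw [psi, if_neg hr]
  have hL : ((plainComplex a b N hN).D * (opU (tau a b N j) + opT (psi a b N j)) +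
      (opU (tau a b N j) + opT (psi a b N j)) * (plainComplex a b N hN).D : Module.End _ _) =
      opF (Xm a b N j) + opB (Ym a b N j) :=
    homotopy_anticomm (Am a b N) (psi a b N j) (cm a b N) (tau a b N j)
  obtain ⟨M, y, v', hy, hv', hl, h0⟩ := (plainComplex a b N hN).exists_fock_torsion
    (plainComplex_DHom hN) j a i (b - 1) (N + a * b)
    (opU (tau a b N j) + opT (psi a b N j)) hh (fun β h => by have := h.1; omega)
    (Xm a b N j) (Ym a b N j) hL (fun r => r)
    (fun r => if r ∈ nonpivots a b N j then 0 else 1) (fun i => i)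
    (fun r => by omega) (fun i => by omega) (fun r => by split_ifs <;> omega)
    (fun r => by rw [← uu_fin]; exact Xm_diag ha hN hj r) (fun r s hrs => Xm_off hj r s hrs)
    (fun r => by rw [← uu_fin]; exact Ym_diag ha hN hj r) (fun r s hrs => Ym_off hN hj r s hrs)
    (fun P q h h' s hs r => by rw [Xm_col hj ((hsub _ h').1 hs)]; exact zero_mem _) hv hDv
  refine ⟨M, y, v', hy, hv', hl, fun β hβ => ?_⟩
  by_cases h1 : wt (fun r => if r ∈ nonpivots a b N j then 0 else 1) 1 β = 0
  · by_cases h2 : wt 1 1 β + 1 = b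
    · obtain ⟨h3, h4⟩ := hsub β h1
      refine absurd (Prod.ext (Finset.eq_of_subset_of_card_le h3 ?_) h4) hβ
      simp [wt, h4] at h2
      change (nonpivots a b N j).card ≤ _
      omega
    · rw [hv'.eq_zero fun h => h2 h.1]; exact zero_mem _
  · exact h0 β h1

end Plain

section Aug
variable {a b N : ℕ}

local notation "RR" => MvPolynomial (Fin (b + 1)) ℂ

theorem wt_eq (β : Finset (Fin (N + 1)) × (Fin (a * b + 1) → ℕ)) (x : ℕ) :
    wt (lastWt N x 0) 1 β = (if Fin.last N ∈ β.1 then x else 0) + ∑ i, β.2 i := by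
  simp [wt, lastWt, Finset.sum_ite_eq']

theorem wt_one_eq (β : Finset (Fin (N + 1)) × (Fin (a * b + 1) → ℕ)) :
    wt 1 1 β = β.1.card + ∑ i, β.2 i := by
  simp [wt]

theorem delta_of_pos (ha : 1 ≤ a) (hb : 1 ≤ b) (hN : N + 1 = a * b + b) {i n w}
    (hw : (plainComplex a b N hN).Hom (i + 1) n w) : delta a b N w = 0 := by
  rw [delta_apply]
  refine Finset.sum_eq_zero fun P _ => ?_
  by_cases h : (plainComplex a b N hN).lvl (i + 1) (P, 0)
  · have h1 := h.2
    rw [wt_eq] at h1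
    rw [deltaP_eq_zero ha hb hN, mul_zero]
    rintro ⟨-, h2⟩
    simp [h2] at h1
  · rw [hw.eq_zero h, zero_mul]

theorem delta_isHomogeneous (ha : 1 ≤ a) (hb : 1 ≤ b) (hN : N + 1 = a * b + b) {n w}
    (hw : (plainComplex a b N hN).Hom 0 n w) : delta a b N w ∈ degSub fun t => t = n := by
  rw [delta_apply]
  refine sum_mem fun P _ => ?_
  rw [mul_comm]
  by_cases h : Fin.last N ∈ P
  · rw [deltaP_eq_zero ha hb hN fun h' => h'.2 h, zero_mul]; exact zero_mem _
  · refine mul_mem_degSub (S := fun t => (plainComplex a b N hN).lvl 0 (P, 0) ∧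
      t + (plainComplex a b N hN).sh (P, 0) = n) (deltaP_isHomogeneous ha hb hN P)
      (fun m hm => hw (P, 0) m hm) ?_
    rintro t ⟨-, ht⟩
    have : (plainComplex a b N hN).sh (P, 0) = wt (lastWt N (1 + a) 0) 1 (P, 0) + a * (b - 1) := rfl
    rw [this, wt_eq] at ht
    simp [h] at ht
    omega

variable (a b N) in
/-- The main complex with its augmentation. -/
noncomputable def augComplex (ha : 1 ≤ a) (hb : 1 ≤ b) (hN : N + 1 = a * b + b) :
    GradedComplex b (Option (Finset (Fin (N + 1)) × (Fin (a * b + 1) → ℕ))) where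
  lvl i x := match i, x with
    | 0, none => True
    | 0, some _ => False
    | _ + 1, none => False
    | i + 1, some β => (plainComplex a b N hN).lvl i β
  sh x := match x with
    | none => 0
    | some β => (plainComplex a b N hN).sh β
  D :=
    { toFun := fun v x => match x with
        | none => delta a b N (v ∘ some)
        | some β => (plainComplex a b N hN).D (v ∘ some) β
      map_add' := fun v w => by
        funext x
        rcases x with _ | β
        · exact map_add (delta a b N) (v ∘ some) (w ∘ some)
        · exact congrFun (map_add (plainComplex a b N hN).D (v ∘ some) (w ∘ some)) β
      map_smul' := fun c v => by
        funext x
        rcases x with _ | β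
        · exact map_smul (delta a b N) c (v ∘ some)
        · exact congrFun (map_smul (plainComplex a b N hN).D c (v ∘ some)) β }
  D_D v := by
    funext x
    rcases x with _ | β
    · have : delta a b N (opT (Am a b N) (v ∘ some) + opU (cm a b N) (v ∘ some)) = 0 := by
        rw [map_add, delta_opT ha hb, delta_opU, add_zero]
      exact this
    · exact congrFun ((plainComplex a b N hN).D_D (v ∘ some)) β

theorem delta_plain_D (ha : 1 ≤ a) (hb : 1 ≤ b) (hN : N + 1 = a * b + b) (v) :
    delta a b N ((plainComplex a b N hN).D v) = 0 := by
  have : delta a b N (opT (Am a b N) v + opU (cm a b N) v) = 0 := by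
    rw [map_add, delta_opT ha hb, delta_opU, add_zero]
  exact this

section
variable (ha : 1 ≤ a) (hb : 1 ≤ b) (hN : N + 1 = a * b + b)

theorem augComplex_hom_succ_iff {i n v} : (augComplex a b N ha hb hN).Hom (i + 1) n v ↔
    v none = 0 ∧ (plainComplex a b N hN).Hom i n (v ∘ some) := by
  constructor
  · intro h
    exact ⟨h.eq_zero (β := none) id, fun β m hm => h (some β) m hm⟩
  · rintro ⟨h1, h2⟩ (_ | β) m hm
    · simp [h1] at hm
    · exact h2 β m hm

theorem augComplex_hom_zero_iff {n v} : (augComplex a b N ha hb hN).Hom 0 n v ↔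
    v none ∈ (degSub fun t => t = n) ∧ ∀ β, v (some β) = 0 := by
  constructor
  · intro h
    exact ⟨fun m hm => (h none m hm).2, fun β => h.eq_zero (β := some β) id⟩
  · rintro ⟨h1, h2⟩ (_ | β) m hm
    · exact ⟨trivial, h1 m hm⟩
    · simp [h2] at hm

theorem augComplex_D_none (v) : (augComplex a b N ha hb hN).D v none = delta a b N (v ∘ some) := rfl

theorem augComplex_D_some (v) (β) : (augComplex a b N ha hb hN).D v (some β) =
    (plainComplex a b N hN).D (v ∘ some) β := rfl

theorem augComplex_DHom : (augComplex a b N ha hb hN).DHom := by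
  intro i n v hv
  have h := ((augComplex_hom_succ_iff ha hb hN).1 hv).2
  rcases i with _ | i
  · rw [augComplex_hom_zero_iff]
    refine ⟨delta_isHomogeneous ha hb hN h, fun β => ?_⟩
    rw [augComplex_D_some, plainComplex_D_of_zero hN h]; rfl
  · rw [augComplex_hom_succ_iff]
    exact ⟨delta_of_pos ha hb hN h, plainComplex_DHom hN i n _ h⟩

/-- Extension by zero at the augmentation. -/
noncomputable def optLift {ι : Type*} (y : ι → RR) : Option ι → RR := fun x => x.elim 0 y

theorem vac_hom_zero (hN : N + 1 = a * b + b) {P : Finset (Fin (N + 1))} (hP : P.card + 1 = b)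
    (hl : Fin.last N ∉ P) {n : ℕ} {p : RR} (hp : p ∈ degSub fun t => t = n) :
    (plainComplex a b N hN).Hom 0 (n + a * (b - 1)) (p • vac _ _ P) := by
  rintro ⟨Q, q⟩ m hm
  rw [Pi.smul_apply, smul_eq_mul] at hm
  by_cases hq : q = 0
  swap
  · simp [vac_apply_of_ne _ _ hq] at hm
  subst hq
  rw [vac_apply] at hm
  split_ifs at hm with hQ
  swap
  · simp at hm
  subst hQ
  rw [mul_one] at hm
  refine ⟨⟨?_, ?_⟩, ?_⟩
  · rw [wt_one_eq]; simpa using hP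
  · rw [wt_eq]; simp [hl]
  · change m.degree + (wt (lastWt N (1 + a) 0) 1 (Q, 0) + a * (b - 1)) = _
    rw [wt_eq, hp m hm]; simp [hl]

theorem augComplex_torsion (i : ℕ) (j : Fin (b + 1)) : (augComplex a b N ha hb hN).Torsion i j := by
  intro n v hv hDv
  have hj : (j : ℕ) ≤ b := by omega
  obtain ⟨κ, hκ, hδ⟩ := deltaP_nonpivots (N := N) ha hb hN j
  have hcard := card_nonpivots hN hj
  have hlast : Fin.last N ∉ nonpivots a b N j := fun h => (Finset.mem_filter.1 h).2.1 rfl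
  rcases i with _ | i
  · obtain ⟨h1, h2⟩ := (augComplex_hom_zero_iff ha hb hN).1 hv
    have hp : C κ⁻¹ * v none ∈ degSub fun t => t = n :=
      mul_mem_degSub (isHomogeneous_C _ _) h1 (by intro t ht; omega)
    have hy := vac_hom_zero hN hcard hlast hp
    refine ⟨a * (b - 1), optLift ((C κ⁻¹ * v none) • vac _ _ (nonpivots a b N j)),
      (augComplex_hom_succ_iff ha hb hN).2 ⟨rfl, hy⟩, ?_⟩
    rintro (_ | β)
    · rw [Pi.sub_apply, augComplex_D_none, show optLift ((C κ⁻¹ * v none) •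
        vac RR (Fin (a * b + 1)) (nonpivots a b N j)) ∘ some = (C κ⁻¹ * v none) •
        vac RR (Fin (a * b + 1)) (nonpivots a b N j) from rfl, map_smul, delta_vac, Pi.smul_apply,
        smul_eq_mul, smul_eq_mul]
      have := Ideal.mul_mem_left _ (-(C κ⁻¹ * v none)) hδ
      convert this using 1
      have h3 : (C κ⁻¹ * C κ : RR) = 1 := by rw [← C_mul, inv_mul_cancel₀ hκ, C_1]
      linear_combination -(v none * X j ^ (a * (b - 1))) * h3
    · rw [Pi.sub_apply, augComplex_D_some, Pi.smul_apply, h2,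
        show optLift ((C κ⁻¹ * v none) •
        vac RR (Fin (a * b + 1)) (nonpivots a b N j)) ∘ some = (C κ⁻¹ * v none) •
        vac RR (Fin (a * b + 1)) (nonpivots a b N j) from rfl, plainComplex_D_of_zero hN hy]
      simp
  · obtain ⟨h1, h2⟩ := (augComplex_hom_succ_iff ha hb hN).1 hv
    obtain ⟨M, y, v', hy, hv', hl, h0⟩ := plainComplex_torsion ha hN i j h2 fun β => hDv (some β)
    have hv'l : LowVec j v' := by
      intro β
      by_cases hβ : β = (nonpivots a b N j, 0)
      swap
      · exact h0 β hβ
      rcases i with _ | i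
      · have h3 : delta a b N (v ∘ some) ∈ lowIdeal b j := hDv none
        have h4 : delta a b N v' ∈ lowIdeal b j := by
          have h5 : delta a b N ((X j ^ M : RR) • (v ∘ some) -
              (plainComplex a b N hN).D y - v') ∈ lowIdeal b j := by
            rw [delta_apply]
            exact sum_mem fun P _ => Ideal.mul_mem_right _ _ (hl (P, 0))
          rw [map_sub, map_sub, map_smul, delta_plain_D ha hb hN, sub_zero, smul_eq_mul] at h5
          have := sub_mem (Ideal.mul_mem_left _ (X j ^ M) h3) h5
          simpa using this
        rw [delta_apply, ← Finset.add_sum_erase _ _ (Finset.mem_univ (nonpivots a b N j))] at h4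
        have h6 : ∑ P ∈ Finset.univ.erase (nonpivots a b N j), v' (P, 0) * deltaP a b N P ∈
            lowIdeal b j := by
          refine sum_mem fun P hP => Ideal.mul_mem_right _ _ (h0 _ ?_)
          intro h
          exact (Finset.ne_of_mem_erase hP) (congrArg Prod.fst h)
        rw [add_mem_cancel_right h6] at h4
        have h7 := sub_mem h4 (Ideal.mul_mem_left _ (v' (nonpivots a b N j, 0)) hδ)
        have h8 := Ideal.mul_mem_left _ (C κ⁻¹) h7
        rw [hβ]
        refine mem_lowIdeal_of_X_pow_mul (a * (b - 1)) ?_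
        convert h8 using 1
        have h3 : (C κ⁻¹ * C κ : RR) = 1 := by rw [← C_mul, inv_mul_cancel₀ hκ, C_1]
        linear_combination -(v' (nonpivots a b N j, 0) * X j ^ (a * (b - 1))) * h3
      · rw [hβ, hv'.eq_zero]
        · exact zero_mem _
        · rintro ⟨-, h⟩
          rw [wt_eq] at h
          simp [hlast] at h
    refine ⟨M, optLift y, (augComplex_hom_succ_iff ha hb hN).2 ⟨rfl, hy⟩, ?_⟩
    rintro (_ | β)
    · rw [Pi.sub_apply, augComplex_D_none, show optLift y ∘ some = y from rfl,
        delta_of_pos ha hb hN hy, Pi.smul_apply, h1]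
      simp
    · have := add_mem (hl β) (hv'l β)
      rw [Pi.sub_apply, sub_add_cancel] at this
      exact this

end
end Aug

section Consequences
variable {a b N : ℕ}

local notation "RR" => MvPolynomial (Fin (b + 1)) ℂ

theorem eq_zero_of_mem_lowIdeal_zero {p : RR} (h : p ∈ lowIdeal b 0) : p = 0 := by
  rw [mem_lowIdeal] at h
  rw [← support_eq_empty, Finset.eq_empty_iff_forall_notMem]
  intro m hm
  obtain ⟨i, hi, -⟩ := h m hm
  omega

theorem LowVec.eq_zero {ι : Type*} {v : ι → RR} (h : LowVec 0 v) : v = 0 :=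
  funext fun β => eq_zero_of_mem_lowIdeal_zero (h β)

section
variable (ha : 1 ≤ a) (hb : 1 ≤ b) (hN : N + 1 = a * b + b)

theorem augComplex_lvl_top {x} (h : (augComplex a b N ha hb hN).lvl (b + 1) x) :
    (augComplex a b N ha hb hN).sh x ≤ a * b + b - 1 := by
  rcases x with _ | β
  · exact h.elim
  · obtain ⟨h1, h2⟩ : wt 1 1 β + 1 = b ∧ wt (lastWt N 2 0) 1 β = b := h
    change wt (lastWt N (1 + a) 0) 1 β + a * (b - 1) ≤ _
    obtain ⟨b, rfl⟩ : ∃ b', b = b' + 1 := Nat.exists_eq_add_of_le' hb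
    rw [wt_eq] at h2 ⊢
    rw [wt_one_eq] at h1
    have hab : a * (b + 1) = a * b + a := mul_add_one a b
    rw [Nat.add_sub_cancel]
    split_ifs at h2 ⊢ <;> omega

theorem augComplex_not_lvl {x} : ¬ (augComplex a b N ha hb hN).lvl (b + 2) x := by
  rcases x with _ | β
  · exact id
  · rintro ⟨h1, h2⟩
    rw [wt_eq] at h2
    rw [wt_one_eq] at h1
    split_ifs at h2 with h
    · have := Finset.card_pos.2 ⟨_, h⟩
      omega
    · omega

include ha hb hN in
/-- In high degrees the augmentation is surjective. -/
theorem exists_eq_sum_deltaP {n : ℕ} (hn : a * b - 1 ≤ n) {p : RR} (hp : p.IsHomogeneous n) :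
    ∃ r : Finset (Fin (N + 1)) → RR, p = ∑ P, r P * deltaP a b N P := by
  have hE := GradedComplex.exact_of_degree (augComplex_DHom ha hb hN)
    (fun _ h => augComplex_lvl_top ha hb hN h)
    (fun i j _ => augComplex_torsion ha hb hN i j) (b + 1) 0 n (by omega) (by omega)
  have hv : (augComplex a b N ha hb hN).Hom 0 n (fun x => x.elim p 0) :=
    (augComplex_hom_zero_iff ha hb hN).2 ⟨IsHomogeneous.mem_degSub hp, fun _ => rfl⟩
  obtain ⟨y, hy, h⟩ := hE _ hv (fun x => by
    have : (augComplex a b N ha hb hN).D (fun x => x.elim p 0) = 0 := by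
      funext x
      rcases x with _ | β
      · rw [augComplex_D_none]; exact map_zero (delta a b N)
      · rw [augComplex_D_some]; exact congrFun (map_zero (plainComplex a b N hN).D) β
    rw [this]; exact zero_mem _)
  refine ⟨fun P => y (some (P, 0)), ?_⟩
  have := congrFun h.eq_zero none
  rw [Pi.sub_apply, augComplex_D_none, delta_apply, Pi.zero_apply, sub_eq_zero] at this
  exact this

/-- The vector with prescribed coefficients on admissible fermion states. -/
noncomputable def admVec (r : Finset (Fin (N + 1)) → RR) :
    Fock RR (Fin (N + 1)) (Fin (a * b + 1)) :=
  ∑ P ∈ Finset.univ.filter fun P => P.card + 1 = b ∧ Fin.last N ∉ P, r P • vac _ _ P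

include ha hb hN in
theorem delta_admVec (r : Finset (Fin (N + 1)) → RR) :
    delta a b N (admVec r) = ∑ P, r P * deltaP a b N P := by
  rw [admVec, map_sum, Finset.sum_filter]
  refine Finset.sum_congr rfl fun P _ => ?_
  split_ifs with h
  · rw [map_smul, delta_vac, smul_eq_mul]
  · rw [deltaP_eq_zero ha hb hN h, mul_zero]

theorem admVec_apply (r : Finset (Fin (N + 1)) → RR) {P : Finset (Fin (N + 1))}
    (h : P.card + 1 = b ∧ Fin.last N ∉ P) : (admVec r : Fock _ _ (Fin (a * b + 1))) (P, 0) = r P := by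
  rw [admVec, Finset.sum_apply, Finset.sum_eq_single_of_mem P (by simpa using h)]
  · simp [vac_apply]
  · intro Q _ hQ
    simp [vac_apply, hQ.symm]

theorem admVec_hom {n : ℕ} {r : Finset (Fin (N + 1)) → RR} (hr : ∀ P, (r P).IsHomogeneous n) :
    (plainComplex a b N hN).Hom 0 (n + a * (b - 1)) (admVec r) := by
  rw [admVec]
  refine Finset.sum_induction _ ((plainComplex a b N hN).Hom 0 (n + a * (b - 1)))
    (fun _ _ => GradedComplex.Hom.add) GradedComplex.Hom.zero fun P hP => ?_
  have := (Finset.mem_filter.1 hP).2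
  exact vac_hom_zero hN this.1 this.2 (IsHomogeneous.mem_degSub (hr P))

theorem augComplex_D_optLift {n : ℕ} {v} (hv : (plainComplex a b N hN).Hom 0 n v) :
    (augComplex a b N ha hb hN).D (optLift v) = fun x => x.elim (delta a b N v) 0 := by
  funext x
  rcases x with _ | β
  · rw [augComplex_D_none]; rfl
  · rw [augComplex_D_some]
    exact congrFun (plainComplex_D_of_zero hN hv) β

include ha hb hN in
/-- The values of the augmentation are linearly independent. -/
theorem eq_zero_of_sum_deltaP_eq_zero {κ : Finset (Fin (N + 1)) → ℂ}
    (h : ∑ P, C (κ P) * deltaP a b N P = 0) {P : Finset (Fin (N + 1))}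
    (hP : P.card + 1 = b ∧ Fin.last N ∉ P) : κ P = 0 := by
  have hE := GradedComplex.exact_of_lt (augComplex_DHom ha hb hN) (T := b + 1)
    (fun _ => augComplex_not_lvl ha hb hN) le_rfl
    (fun i j _ => augComplex_torsion ha hb hN i j) b 0 1 (0 + a * (b - 1)) (by omega) (by omega)
  have hv := admVec_hom (a := a) hN (n := 0) (r := fun P => C (κ P)) fun P => isHomogeneous_C _ _
  obtain ⟨y, hy, h2⟩ := hE (optLift (admVec fun P => C (κ P)))
    ((augComplex_hom_succ_iff ha hb hN).2 ⟨rfl, hv⟩) (by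
      rw [augComplex_D_optLift ha hb hN hv, delta_admVec ha hb hN, h]
      rintro (_ | _) <;> exact zero_mem _)
  have hy0 : y = 0 := by
    obtain ⟨h3, h4⟩ := (augComplex_hom_succ_iff ha hb hN).1 hy
    funext x
    rcases x with _ | β
    · exact h3
    · change y (some β) = 0
      rw [← support_eq_empty, Finset.eq_empty_iff_forall_notMem]
      intro m hm
      obtain ⟨⟨h5, h6⟩, h7⟩ := h4 β m hm
      change m.degree + (wt (lastWt N (1 + a) 0) 1 β + a * (b - 1)) = _ at h7
      rw [wt_eq] at h6 h7
      split_ifs at h6 h7 <;> omega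
  rw [hy0, map_zero, sub_zero] at h2
  have := congrFun h2.eq_zero (some (P, 0))
  change (admVec _ : Fock _ _ (Fin (a * b + 1))) (P, 0) = 0 at this
  rw [admVec_apply _ hP] at this
  simpa using this

end

theorem homogeneousComponent_mul_of_isHomogeneous {σ : Type*} {p q : MvPolynomial σ ℂ} {e n : ℕ}
    (hq : q.IsHomogeneous e) :
    homogeneousComponent (n + e) (p * q) = homogeneousComponent n p * q := by
  conv_lhs => rw [← sum_homogeneousComponent p, Finset.sum_mul, map_sum]
  have h1 : ∀ i, homogeneousComponent (n + e) (homogeneousComponent i p * q) =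
      if i = n then homogeneousComponent n p * q else 0 := by
    intro i
    rw [homogeneousComponent_of_mem (((homogeneousComponent_isHomogeneous i p).mul hq))]
    by_cases h : i = n
    · simp [h]
    · rw [if_neg (by omega), if_neg h]
  simp only [h1]
  rw [Finset.sum_ite_eq']
  split_ifs with h
  · rfl
  · rw [homogeneousComponent_eq_zero _ _ (by simp at h; omega), zero_mul]

theorem exists_notMem_span_deltaP (ha : 2 ≤ a) (hb : 2 ≤ b) (hN : N + 1 = a * b + b) :
    ∃ p : RR, p.IsHomogeneous (a * b - 2) ∧
      ∀ r : Finset (Fin (N + 1)) → RR, p ≠ ∑ P, r P * deltaP a b N P := by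
  have ha' : 1 ≤ a := by omega
  have hb' : 1 ≤ b := by omega
  have hab : a * (b - 1) + a = a * b := by
    obtain ⟨b, rfl⟩ : ∃ b', b = b' + 1 := Nat.exists_eq_add_of_le' hb'
    rw [Nat.add_sub_cancel, mul_add, mul_one]
  have hsum : ∑ i, (Pi.single 0 (b - 2) : Fin (a * b + 1) → ℕ) i = b - 2 := by
    simp
  obtain ⟨x, hx, -, hx2⟩ := GradedComplex.exists_not_boundary (augComplex_DHom ha' hb' hN)
    (fun _ => augComplex_not_lvl ha' hb' hN)
    (fun i j _ => augComplex_torsion ha' hb' hN i j)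
    (β₀ := some ({Fin.last N}, Pi.single 0 (b - 2)))
    (by
      refine ⟨?_, ?_⟩
      · rw [wt_one_eq, hsum]; simp; omega
      · rw [wt_eq, hsum]; simp; omega)
    (by
      intro x hx
      obtain ⟨b, rfl⟩ : ∃ b', b = b' + 1 := Nat.exists_eq_add_of_le' hb'
      rcases x with _ | β
      · exact hx.elim
      · obtain ⟨h1, h2⟩ : wt 1 1 β + 1 = b + 1 ∧ wt (lastWt N 2 0) 1 β = b := hx
        change wt (lastWt N (1 + a) 0) 1 β + _ < wt (lastWt N (1 + a) 0) 1 _ + _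
        rw [wt_eq] at h2
        rw [wt_eq, wt_eq, hsum]
        simp only [Finset.mem_singleton, if_true]
        split_ifs at h2 ⊢ <;> omega)
    (b + 1) 0 (a * b - 2) (by omega) (by
      change _ = wt (lastWt N (1 + a) 0) 1 _ + a * (b - 1)
      rw [wt_eq, hsum]
      simp only [Finset.mem_singleton, if_true]
      have : 2 * b ≤ a * b := Nat.mul_le_mul_right b ha
      omega)
  obtain ⟨h1, h2⟩ := (augComplex_hom_zero_iff ha' hb' hN).1 hx
  refine ⟨x none, isHomogeneous_of_mem_degSub h1, fun r hr => ?_⟩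
  have hn : a * b - 2 = (a - 2) + a * (b - 1) := by omega
  have hv := admVec_hom (a := a) hN (n := a - 2) (r := fun P => homogeneousComponent (a - 2) (r P))
    fun P => homogeneousComponent_isHomogeneous _ _
  refine hx2 (optLift (admVec fun P => homogeneousComponent (a - 2) (r P)))
    ((augComplex_hom_succ_iff ha' hb' hN).2 ⟨rfl, hn ▸ hv⟩) ?_
  rw [augComplex_D_optLift ha' hb' hN hv, delta_admVec ha' hb' hN]
  have : x none = ∑ P, homogeneousComponent (a - 2) (r P) * deltaP a b N P := by
    conv_lhs => rw [← if_pos (c := a - 2 + a * (b - 1) = a * b - 2) (t := x none) (e := 0) hn.symm,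
      ← homogeneousComponent_of_mem (isHomogeneous_of_mem_degSub h1), hr, map_sum]
    exact Finset.sum_congr rfl fun P _ =>
      homogeneousComponent_mul_of_isHomogeneous (deltaP_isHomogeneous ha' hb' hN P)
  rintro (_ | β)
  · rw [← this]
    change x none - x none ∈ _
    rw [sub_self]
    exact zero_mem _
  · change x (some β) - 0 ∈ _
    rw [h2, sub_zero]; exact zero_mem _

end Consequences

section Powers
variable (a b : ℕ)

local notation "RR" => MvPolynomial (Fin (b + 1)) ℂ

/-- The ideal of the coefficients of the power of the generic form. -/
noncomputable def ccIdeal : Ideal RR := Ideal.span (Set.range fun j : Fin (a * b + 1) => cc a b j)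

variable {a b}

/-- Monomials in the coefficients. -/
noncomputable def cmon (q : Fin (a * b + 1) → ℕ) : RR :=
  ∏ j : Fin (a * b + 1), cc a b j ^ q j

theorem cc_mem (j : Fin (a * b + 1)) : cc a b j ∈ ccIdeal a b := Ideal.subset_span ⟨j, rfl⟩

theorem cmon_mem {q : Fin (a * b + 1) → ℕ} : cmon q ∈ ccIdeal a b ^ ∑ j, q j := by
  rw [cmon, ← Finset.prod_pow_eq_pow_sum]
  exact Ideal.prod_mem_prod fun j _ => Ideal.pow_mem_pow (cc_mem j) _

theorem cmon_isHomogeneous (q : Fin (a * b + 1) → ℕ) :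
    (cmon q : RR).IsHomogeneous (a * ∑ j, q j) := by
  rw [Finset.mul_sum]
  exact IsHomogeneous.prod _ _ _ fun j _ => (cc_isHomogeneous a b j).pow _

theorem exists_eq_sum_cmon {k : ℕ} {p : RR} (hp : p ∈ ccIdeal a b ^ k) :
    ∃ h : (Fin (a * b + 1) → ℕ) → RR, p = ∑ q ∈ Finset.piAntidiag Finset.univ k, h q * cmon q := by
  rw [ccIdeal, Ideal.span_pow_eq_map_homogeneousSubmodule] at hp
  obtain ⟨F, hF, rfl⟩ := hp
  refine ⟨fun q => F.coeff (Finsupp.equivFunOnFinite.symm q), ?_⟩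
  rw [AlgHom.toLinearMap_apply, aeval_def, eval₂_eq']
  refine Finset.sum_of_injOn Finsupp.equivFunOnFinite
    Finsupp.equivFunOnFinite.injective.injOn ?_ ?_ ?_
  · intro m hm
    have := hF (mem_support_iff.1 hm)
    rw [Finset.mem_coe, Finset.mem_piAntidiag]
    refine ⟨?_, by simp⟩
    rw [← this]
    simp [Finsupp.weight_apply, Finsupp.sum_fintype]
  · intro q _ hq
    have : F.coeff (Finsupp.equivFunOnFinite.symm q) = 0 := by
      by_contra h
      exact hq ⟨_, mem_support_iff.2 h, by simp⟩
    simp [this]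
  · intro m _
    simp [cmon]

theorem exists_eq_sum_cmon_of_isHomogeneous {k n : ℕ} {p : RR} (hp : p ∈ ccIdeal a b ^ k)
    (hn : p.IsHomogeneous (n + a * k)) : ∃ h : (Fin (a * b + 1) → ℕ) → RR,
      (∀ q, (h q).IsHomogeneous n) ∧ p = ∑ q ∈ Finset.piAntidiag Finset.univ k, h q * cmon q := by
  obtain ⟨h, rfl⟩ := exists_eq_sum_cmon hp
  refine ⟨fun q => homogeneousComponent n (h q), fun q => homogeneousComponent_isHomogeneous _ _, ?_⟩
  conv_lhs => rw [← if_pos (c := n + a * k = n + a * k) (t := Finset.sum _ _) (e := 0) rfl,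
    ← homogeneousComponent_of_mem hn, map_sum]
  refine Finset.sum_congr rfl fun q hq => ?_
  have := cmon_isHomogeneous q
  rw [(Finset.mem_piAntidiag.1 hq).1] at this
  exact homogeneousComponent_mul_of_isHomogeneous this

/-- Divided monomials in the coefficients. -/
noncomputable def dmon (q : Fin (a * b + 1) → ℕ) : RR := C (∏ j, ((q j).factorial : ℂ))⁻¹ * cmon q

theorem mul_dmon_add (q : Fin (a * b + 1) → ℕ) (j : Fin (a * b + 1)) :
    ((q + Pi.single j 1 : Fin (a * b + 1) → ℕ) j : RR) * dmon (q + Pi.single j 1) =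
      cc a b j * dmon q := by
  have h1 : (cmon (q + Pi.single j 1) : RR) = cc a b j * cmon q := by
    rw [cmon, cmon]
    simp only [Pi.add_apply, pow_add, Finset.prod_mul_distrib]
    rw [mul_comm, Finset.prod_eq_single j (fun i _ hi => by simp [hi]) (by simp)]
    simp
  have h2 : ∏ i, (((q + Pi.single j 1 : Fin (a * b + 1) → ℕ) i).factorial : ℂ) =
      (q j + 1) * ∏ i, ((q i).factorial : ℂ) := by
    rw [← Finset.mul_prod_erase _ _ (Finset.mem_univ j),
      ← Finset.mul_prod_erase _ (fun i => ((q i).factorial : ℂ)) (Finset.mem_univ j)]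
    rw [Finset.prod_congr (g := fun i => ((q i).factorial : ℂ)) rfl]
    · simp [Nat.factorial_succ]; ring
    · intro i hi
      simp [Finset.ne_of_mem_erase hi]
  rw [dmon, dmon, h1, h2]
  have h3 : ((q + Pi.single j 1 : Fin (a * b + 1) → ℕ) j : RR) = C ((q j : ℂ) + 1) := by
    simp
  have h4 : ((q j : ℂ) + 1) ≠ 0 := by exact_mod_cast Nat.succ_ne_zero (q j)
  rw [h3, mul_inv, C_mul]
  have h5 : (C ((q j : ℂ) + 1) * C ((q j : ℂ) + 1)⁻¹ : RR) = 1 := by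
    rw [← C_mul, mul_inv_cancel₀ h4, C_1]
  linear_combination (C (∏ i, ((q i).factorial : ℂ))⁻¹ * (cc a b j * cmon q)) * h5

theorem sum_mul_dmon (k : ℕ) (f : (Fin (a * b + 1) → ℕ) → RR) (j : Fin (a * b + 1)) :
    ∑ q ∈ Finset.piAntidiag Finset.univ (k + 1), (q j : RR) * f (q - Pi.single j 1) * dmon q =
      cc a b j * ∑ q ∈ Finset.piAntidiag Finset.univ k, f q * dmon q := by
  rw [← Finset.sum_filter_of_ne (p := fun q => q j ≠ 0)]
  swap
  · intro q _ h h0; simp [h0] at h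
  rw [Finset.mul_sum]
  symm
  have hs : ∀ q : Fin (a * b + 1) → ℕ, q j ≠ 0 → q - Pi.single j 1 + Pi.single j 1 = q := by
    intro q hq
    funext i
    by_cases h : i = j
    · subst h; simp; omega
    · simp [h]
  refine Finset.sum_nbij' (fun q => q + Pi.single j 1) (fun q => q - Pi.single j 1) ?_ ?_ ?_ ?_ ?_
  · intro q hq
    simp only [Finset.mem_filter, Finset.mem_piAntidiag, Finset.mem_univ, implies_true,
      and_true] at hq ⊢
    simp [Finset.sum_add_distrib, hq]
  · intro q hq
    simp only [Finset.mem_filter, Finset.mem_piAntidiag, Finset.mem_univ, implies_true,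
      and_true] at hq ⊢
    have := hq.1
    rw [← hs q hq.2] at this
    simp only [Pi.add_apply, Finset.sum_add_distrib] at this
    simpa using this
  · intro q hq
    funext i; simp
  · intro q hq
    exact hs q (Finset.mem_filter.1 hq).2
  · intro q hq
    have := mul_dmon_add q j
    rw [add_tsub_cancel_right]
    linear_combination -f q * this

variable {N : ℕ}

theorem wt_lastWt_zero_two (β : Finset (Fin (N + 1)) × (Fin (a * b + 1) → ℕ)) :
    wt (lastWt N 0 2) 1 β + (if Fin.last N ∈ β.1 then 2 else 0) = 2 * β.1.card + ∑ i, β.2 i := by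
  have h1 : ∑ r ∈ β.1, lastWt N 0 2 r + ∑ r ∈ β.1, (if r = Fin.last N then 2 else 0) =
      ∑ r ∈ β.1, 2 := by
    rw [← Finset.sum_add_distrib]
    refine Finset.sum_congr rfl fun r _ => ?_
    rw [lastWt]; split_ifs <;> rfl
  rw [Finset.sum_ite_eq', Finset.sum_const, smul_eq_mul] at h1
  simp only [wt, Pi.one_apply, mul_one]
  omega

theorem dualComplex_D_of_zero (hN : N + 1 = a * b + b) {n v}
    (hv : (dualComplex a b N hN).Hom 0 n v) : (dualComplex a b N hN).D v = 0 := by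
  funext β
  suffices h : opT (cm a b N).transpose v β + opU (Am a b N).transpose v β ∈
      degSub fun _ => False by
    have h' : (dualComplex a b N hN).D v β ∈ degSub fun _ => False := h
    rw [Pi.zero_apply, ← support_eq_empty, Finset.eq_empty_iff_forall_notMem]
    exact h'
  refine add_mem ?_ ?_
  · refine opT_mem_degSub (Q := fun β t => (wt 1 1 β = b ∧ wt (lastWt N 0 2) 1 β + 1 = 0 + b) ∧
      t + wt (lastWt N 0 (1 + a)) (fun _ => a) β = n)
      (Q' := fun β t => False) _ ?_ v hv β
    intro r j
    by_cases hr : r = Fin.last N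
    · subst hr
      refine Or.inr ⟨a, by simpa [cm] using cc_isHomogeneous a b j, fun P q t hP ht => ?_⟩
      have h2 := ht.1
      have h3 := wt_lastWt_zero_two (a := a) (b := b) (P.erase (Fin.last N), q + Pi.single j 1)
      rw [wt_one_eq] at h2
      rw [if_neg (by simp)] at h3
      omega
    · left; simp [cm, hr]
  · refine opU_mem_degSub (Q := fun β t => (wt 1 1 β = b ∧ wt (lastWt N 0 2) 1 β + 1 = 0 + b) ∧
      t + wt (lastWt N 0 (1 + a)) (fun _ => a) β = n)
      (Q' := fun β t => False) _ ?_ v hv β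
    intro r j
    by_cases hr : r = Fin.last N
    · left; rw [hr, Matrix.transpose_apply, Am_last hN]
    · refine Or.inr ⟨1, Am_isHomogeneous r j, fun P q t hP hq ht => ?_⟩
      have h2 := ht.1
      have h3 := wt_lastWt_zero_two (a := a) (b := b) (insert r P, q - Pi.single j 1)
      rw [wt_one_eq] at h2
      rw [Finset.card_insert_of_notMem hP] at h2 h3
      split_ifs at h3 with h
      · have := Finset.card_pos.2 ⟨_, Finset.mem_of_mem_insert_of_ne h (Ne.symm hr)⟩
        omega
      · omega

theorem mem_ccIdeal_pow_of_pred (ha : 1 ≤ a) (hb : 1 ≤ b) {p : RR} (hn : p.IsHomogeneous (a * b))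
    (hp : p ∈ ccIdeal a b ^ (b - 1)) : p ∈ ccIdeal a b ^ b := by
  obtain ⟨k, rfl⟩ : ∃ b', b = b' + 1 := Nat.exists_eq_add_of_le' hb
  rw [Nat.add_sub_cancel] at hp
  obtain ⟨h, hh, hsum⟩ := exists_eq_sum_cmon_of_isHomogeneous (n := a) hp
    (by convert hn using 1; ring)
  obtain ⟨N, hN⟩ : ∃ N, N + 1 = a * (k + 1) + (k + 1) := ⟨_, rfl⟩
  have hcard : ∀ q : Fin (a * (k + 1) + 1) → ℕ, ∏ j, ((q j).factorial : ℂ) ≠ 0 := fun q =>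
    Finset.prod_ne_zero_iff.2 fun j _ => by exact_mod_cast Nat.factorial_ne_zero _
  set v : Fock (MvPolynomial (Fin (k + 1 + 1)) ℂ) (Fin (N + 1)) (Fin (a * (k + 1) + 1)) :=
    fun β => if β.1 = {Fin.last N} ∧ ∑ i, β.2 i = k then C (∏ j, ((β.2 j).factorial : ℂ)) * h β.2
      else 0 with hv
  have hE := GradedComplex.exact_of_degree (dualComplex_DHom hN) (S := a * (k + 1) + (k + 1))
    (fun β hβ => by
      obtain ⟨h1, h2⟩ : wt 1 1 β = k + 1 ∧ wt (lastWt N 0 2) 1 β + 1 = k + 1 + 1 + (k + 1) := hβ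
      have h3 := wt_lastWt_zero_two β
      rw [wt_one_eq] at h1
      have h4 : ∑ i, β.2 i = 0 := by split_ifs at h3 <;> omega
      have h5 : ∀ i, β.2 i = 0 := fun i => (Finset.sum_eq_zero_iff.1 h4) i (Finset.mem_univ i)
      change wt (lastWt N 0 (1 + a)) (fun _ => a) β ≤ _
      have h6 : ∑ r ∈ β.1, lastWt N 0 (1 + a) r ≤ β.1.card * (1 + a) :=
        Finset.sum_le_card_nsmul _ _ _ fun r _ => by rw [lastWt]; split_ifs <;> omega
      rw [show β.1.card = k + 1 by omega] at h6
      simp only [wt, h5, zero_mul, Finset.sum_const_zero]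
      have : (k + 1) * (1 + a) = a * (k + 1) + (k + 1) := by ring
      omega)
    (fun i j _ => dualComplex_torsion ha hN i j) (k + 1 + 1) 0 (a * (k + 1)) (by omega) (by omega)
  have hvh : (dualComplex a (k + 1) N hN).Hom 0 (a * (k + 1)) v := by
    rintro ⟨P, q⟩ m hm
    rw [hv] at hm
    dsimp only at hm
    split_ifs at hm with hc
    swap
    · simp at hm
    obtain ⟨rfl, hq⟩ := hc
    have hm' : m.degree = a :=
      IsHomogeneous.mem_degSub ((hh q).C_mul _) m hm
    have h3 := wt_lastWt_zero_two (a := a) (b := k + 1) (N := N) ({Fin.last N}, q)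
    rw [if_pos (by simp)] at h3
    refine ⟨⟨?_, ?_⟩, ?_⟩
    · rw [wt_one_eq, hq]; simp [add_comm]
    · simp at h3; omega
    · change m.degree + wt (lastWt N 0 (1 + a)) (fun _ => a) _ = _
      simp only [wt, ← Finset.sum_mul, hq, Finset.sum_singleton, lastWt_last]
      rw [hm']; ring
  obtain ⟨y, -, hy⟩ := hE v hvh (by rw [dualComplex_D_of_zero hN hvh]; exact LowVec.zero)
  have hy2 := sub_eq_zero.1 hy.eq_zero
  have hvq : ∀ q, ∑ i, q i = k → v ({Fin.last N}, q) * dmon q = h q * cmon q := by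
    intro q hq
    have : v ({Fin.last N}, q) = C (∏ j, ((q j).factorial : ℂ)) * h q := if_pos ⟨rfl, hq⟩
    rw [this, dmon]
    have h5 : (C (∏ j, ((q j).factorial : ℂ)) * C (∏ j, ((q j).factorial : ℂ))⁻¹ :
        MvPolynomial (Fin (k + 1 + 1)) ℂ) = 1 := by
      rw [← C_mul, mul_inv_cancel₀ (hcard q), C_1]
    linear_combination (h q * cmon q) * h5
  have hvD : ∀ q, v ({Fin.last N}, q) =
      ∑ r, ∑ j, (cm a (k + 1) N).transpose r j * cr r (dn j y) ({Fin.last N}, q) +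
      ∑ r, ∑ j, (Am a (k + 1) N).transpose j r * up j (an r y) ({Fin.last N}, q) := by
    intro q
    rw [← opT_apply, ← opU_apply]
    exact congrFun hy2 _
  have hsum2 : p = ∑ q ∈ Finset.piAntidiag Finset.univ k, v ({Fin.last N}, q) * dmon q := by
    rw [hsum]
    exact Finset.sum_congr rfl fun q hq => (hvq q (Finset.mem_piAntidiag.1 hq).1).symm
  rw [hsum2]
  simp only [hvD, add_mul, Finset.sum_add_distrib]
  refine add_mem ?_ ?_
  · refine Ideal.sum_mem _ fun q hq => ?_
    simp only [Finset.sum_mul]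
    refine Ideal.sum_mem _ fun r _ => Ideal.sum_mem _ fun j _ => ?_
    rw [Matrix.transpose_apply, cm]
    split_ifs with hr
    swap
    · simp
    have h1 : cc a (k + 1) j * cmon q ∈ ccIdeal a (k + 1) ^ (k + 1) := by
      rw [pow_succ']
      refine Ideal.mul_mem_mul (cc_mem j) ?_
      have := cmon_mem (q := q)
      rwa [(Finset.mem_piAntidiag.1 hq).1] at this
    rw [dmon]
    have := Ideal.mul_mem_left _ (cr r (dn j y) ({Fin.last N}, q) *
      C (∏ j, ((q j).factorial : ℂ))⁻¹) h1
    convert this using 1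
    ring
  · have hz : ∑ q ∈ Finset.piAntidiag Finset.univ k, (∑ r, ∑ j, (Am a (k + 1) N).transpose j r *
        up j (an r y) ({Fin.last N}, q)) * dmon q = 0 := by
      have h1 : ∀ r j, ∑ q ∈ Finset.piAntidiag Finset.univ k,
          up j (an r y) ({Fin.last N}, q) * dmon q = cc a (k + 1) j *
          if k = 0 then 0 else ∑ q ∈ Finset.piAntidiag Finset.univ (k - 1),
            an r y ({Fin.last N}, q) * dmon q := by
        intro r j
        rcases k with _ | k
        · rw [if_pos rfl, mul_zero]
          refine Finset.sum_eq_zero fun q hq => ?_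
          have := Finset.sum_eq_zero_iff.1 (Finset.mem_piAntidiag.1 hq).1 j (Finset.mem_univ j)
          rw [up_apply, this]; simp
        · rw [if_neg (Nat.succ_ne_zero k), Nat.add_sub_cancel]
          exact sum_mul_dmon k (fun q => an r y ({Fin.last N}, q)) j
      simp only [Finset.sum_mul]
      rw [Finset.sum_comm]
      refine Finset.sum_eq_zero fun r _ => ?_
      rw [Finset.sum_comm]
      simp only [mul_assoc, ← Finset.mul_sum, h1]
      simp only [← mul_assoc, ← Finset.sum_mul]
      rw [show ∑ j : Fin (a * (k + 1) + 1), (Am a (k + 1) N).transpose j r * cc a (k + 1) j = 0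
        from Am_mul_cc a (k + 1) N r, zero_mul]
    rw [hz]
    exact zero_mem _

end Powers

section Interpolation

/-- The coefficient of order `l` of the Taylor expansion at `y`. -/
noncomputable def tl {S : Type*} [CommRing S] (y : S) (l : ℕ) : Polynomial S →ₗ[S] S :=
  Polynomial.lcoeff S l ∘ₗ Polynomial.taylor y

theorem tl_apply {S : Type*} [CommRing S] (y : S) (l : ℕ) (F : Polynomial S) :
    tl y l F = (Polynomial.taylor y F).coeff l := rfl

theorem tl_map {S T : Type*} [CommRing S] [CommRing T] (f : S →+* T) (y : S) (l : ℕ)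
    (F : Polynomial S) : tl (f y) l (F.map f) = f (tl y l F) := by
  rw [tl_apply, tl_apply, ← Polynomial.map_taylor, Polynomial.coeff_map]

theorem X_sub_C_pow_dvd_of_tl {K : Type*} [CommRing K] {y : K} {n : ℕ} {F : Polynomial K}
    (h : ∀ l < n, tl y l F = 0) : (Polynomial.X - Polynomial.C y) ^ n ∣ F := by
  rw [Polynomial.X_sub_C_pow_dvd_iff, Polynomial.X_pow_dvd_iff]
  exact h

theorem tl_eq_zero_of_dvd {K : Type*} [CommRing K] {y : K} {n : ℕ} {F : Polynomial K}
    (h : (Polynomial.X - Polynomial.C y) ^ n ∣ F) {l : ℕ} (hl : l < n) : tl y l F = 0 := by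
  rw [Polynomial.X_sub_C_pow_dvd_iff, Polynomial.X_pow_dvd_iff] at h
  exact h l hl

theorem eq_zero_of_tl {K : Type*} [Field K] {b : ℕ} {y : Fin b → K} (hy : Function.Injective y)
    {n : ℕ} {F : Polynomial K} (hF : F.degree < (n * b : ℕ))
    (h : ∀ s, ∀ l < n, tl (y s) l F = 0) : F = 0 := by
  have h1 : ∏ s, (Polynomial.X - Polynomial.C (y s)) ^ n ∣ F := by
    refine Finset.prod_dvd_of_coprime (fun s _ s' _ hs => ?_) fun s _ => X_sub_C_pow_dvd_of_tl (h s)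
    exact (Polynomial.isCoprime_X_sub_C_of_isUnit_sub
      (sub_ne_zero.2 (hy.ne hs)).isUnit).pow
  refine Polynomial.eq_zero_of_dvd_of_degree_lt h1 ?_
  rw [Polynomial.degree_prod]
  simp only [Polynomial.degree_pow, Polynomial.degree_X_sub_C, Finset.sum_const, Finset.card_univ,
    Fintype.card_fin]
  convert hF using 1
  simp [mul_comm]

theorem sum_mul_coeff {S κ : Type*} [CommRing S] [Fintype κ] {ex : κ → ℕ}
    (hex : Function.Injective ex) {F : Polynomial S}
    (hF : ∀ i, F.coeff i ≠ 0 → i ∈ Set.range ex) (L : Polynomial S →ₗ[S] S) :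
    ∑ k, L (Polynomial.X ^ ex k) * F.coeff (ex k) = L F := by
  conv_rhs => rw [Polynomial.as_sum_support_C_mul_X_pow F]
  rw [map_sum, ← Finset.sum_image (f := fun i => L (Polynomial.X ^ i) * F.coeff i)
    hex.injOn]
  symm
  refine Finset.sum_subset_zero_on_sdiff (fun i hi => ?_) (fun i hi => ?_) fun i hi => ?_
  · obtain ⟨k, rfl⟩ := hF i (Polynomial.mem_support_iff.1 hi)
    exact Finset.mem_image_of_mem _ (Finset.mem_univ _)
  · rw [Finset.mem_sdiff, Polynomial.notMem_support_iff] at hi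
    rw [hi.2, mul_zero]
  · rw [← Polynomial.smul_eq_C_mul, map_smul, smul_eq_mul, mul_comm]

theorem det_functional_ne_zero {K κ : Type*} [Field K] [Fintype κ] [DecidableEq κ] {ex : κ → ℕ}
    (hex : Function.Injective ex) (L : κ → Polynomial K →ₗ[K] K)
    (h : ∀ F : Polynomial K, (∀ i, F.coeff i ≠ 0 → i ∈ Set.range ex) → (∀ k, L k F = 0) → F = 0) :
    (Matrix.of fun k k' => L k (Polynomial.X ^ ex k')).det ≠ 0 := by
  intro h0
  obtain ⟨v, hv, hv0⟩ := Matrix.exists_mulVec_eq_zero_iff.2 h0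
  have hc : ∀ i, (∑ k, Polynomial.C (v k) * Polynomial.X ^ ex k).coeff i =
      ∑ k, if i = ex k then v k else 0 := by
    intro i
    simp [Polynomial.finsetSum_coeff, Polynomial.coeff_X_pow]
  have h1 := h (∑ k, Polynomial.C (v k) * Polynomial.X ^ ex k) (fun i hi => by
    rw [hc] at hi
    obtain ⟨k, -, hk⟩ := Finset.exists_ne_zero_of_sum_ne_zero hi
    by_contra hn
    exact hk (if_neg fun h => hn ⟨k, h.symm⟩)) (fun k => by
    have := congrFun hv0 k
    simp only [Matrix.mulVec, dotProduct, Matrix.of_apply, Pi.zero_apply] at this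
    rw [map_sum, ← this]
    refine Finset.sum_congr rfl fun k' _ => ?_
    rw [← Polynomial.smul_eq_C_mul, map_smul, smul_eq_mul, mul_comm])
  refine hv (funext fun k => ?_)
  have h2 := hc (ex k)
  rw [h1, Finset.sum_eq_single k (fun k' _ hk => if_neg fun h => hk (hex h.symm))
    (fun hk => absurd (Finset.mem_univ _) hk)] at h2
  simpa using h2.symm

end Interpolation

section Twist
variable {S : Type*} [CommRing S]

/-- The operator `F ↦ a G' F - G F'`. -/
noncomputable def twist (a : ℕ) (G F : Polynomial S) : Polynomial S :=
  a * Polynomial.derivative G * F - G * Polynomial.derivative F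

theorem twist_pow (a : ℕ) (G : Polynomial S) : twist a G (G ^ a) = 0 := by
  rw [twist, Polynomial.derivative_pow]
  rcases a with _ | a
  · simp
  · simp only [Nat.add_sub_cancel, map_natCast, pow_succ]; ring

theorem taylor_twist (a : ℕ) (G F : Polynomial S) (y : S) : Polynomial.taylor y (twist a G F) =
    twist a (Polynomial.taylor y G) (Polynomial.taylor y F) := by
  have h : ∀ p : Polynomial S, Polynomial.taylor y (Polynomial.derivative p) =
      Polynomial.derivative (Polynomial.taylor y p) := fun p => by
    simp [Polynomial.taylor_apply, Polynomial.derivative_comp]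
  rw [twist, twist, map_sub, Polynomial.taylor_mul, Polynomial.taylor_mul, Polynomial.taylor_mul,
    h, h]
  congr 3
  rw [← map_natCast (Polynomial.C (R := S)), Polynomial.taylor_C]

/-- The coefficient of the `m`-th Taylor coefficient of `F` in the `l`-th one of `twist a G F`. -/
noncomputable def twc (a : ℕ) (G : Polynomial S) (y : S) (l m : ℕ) : S :=
  if m < l + 2 then ((a : S) * (l + 1 - m : ℕ) - m) * tl y (l + 1 - m) G else 0

theorem tl_twist (a : ℕ) (G F : Polynomial S) (y : S) {l n : ℕ} (h : l + 1 ≤ n) :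
    tl y l (twist a G F) = twc a G y l 0 * tl y 0 F +
      ∑ m : Fin n, twc a G y l (m + 1) * tl y (m + 1) F := by
  rw [tl_apply, taylor_twist, twist, coeff_mul_derivative_sub]
  have h1 := Fin.sum_univ_succ (fun m : Fin (n + 1) => twc a G y l m * tl y m F)
  simp only [Fin.val_zero, Fin.val_succ] at h1
  rw [← h1, Fin.sum_univ_eq_sum_range (fun m => twc a G y l m * tl y m F),
    ← Finset.sum_subset (Finset.range_mono (by omega : l + 2 ≤ n + 1)) (fun m _ hm => ?_)]
  · refine Finset.sum_congr rfl fun m hm => ?_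
    rw [twc, if_pos (Finset.mem_range.1 hm)]; rfl
  · rw [twc, if_neg (by simpa using hm), zero_mul]

end Twist

section Exponents
variable (a c : ℕ)

/-- The exponents of the monomials, the product indices first. -/
def exL : (Fin a × Fin (c + 1)) ⊕ Fin (c + 1) → ℕ :=
  Sum.elim (fun t => finProdFinEquiv t + 1) fun l => if l = 0 then 0 else a * (c + 1) + l

/-- The exponents of the monomials of smaller degree. -/
def exS : (Fin a × Fin (c + 1)) ⊕ Fin c → ℕ :=
  Sum.elim (fun t => finProdFinEquiv t) fun l => a * (c + 1) + l

theorem exL_injective : Function.Injective (exL a c) := by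
  rintro (t | l) (t' | l') h
  · simp only [exL, Sum.elim_inl, add_left_inj, Fin.val_inj, EmbeddingLike.apply_eq_iff_eq] at h
    rw [h]
  · exfalso
    have := (finProdFinEquiv t).2
    simp only [exL, Sum.elim_inl, Sum.elim_inr] at h
    split_ifs at h with h1
    have : (l' : ℕ) ≠ 0 := fun h => h1 (Fin.ext h)
    omega
  · exfalso
    have := (finProdFinEquiv t').2
    simp only [exL, Sum.elim_inl, Sum.elim_inr] at h
    split_ifs at h with h1
    have : (l : ℕ) ≠ 0 := fun h => h1 (Fin.ext h)
    omega
  · simp only [exL, Sum.elim_inr] at h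
    rw [Sum.inr.injEq, Fin.ext_iff]
    simp only [Fin.ext_iff, Fin.val_zero] at h
    split_ifs at h <;> omega

theorem mem_range_exL {i : ℕ} (h : i < a * (c + 1) + (c + 1)) : i ∈ Set.range (exL a c) := by
  rcases Nat.eq_zero_or_pos i with rfl | hi
  · exact ⟨Sum.inr 0, rfl⟩
  by_cases h1 : i ≤ a * (c + 1)
  · refine ⟨Sum.inl (finProdFinEquiv.symm ⟨i - 1, by omega⟩), ?_⟩
    rw [exL, Sum.elim_inl, Equiv.apply_symm_apply]
    exact Nat.sub_add_cancel hi
  · refine ⟨Sum.inr ⟨i - a * (c + 1), by omega⟩, ?_⟩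
    simp only [exL, Sum.elim_inr]
    rw [if_neg (by rw [Fin.ext_iff]; simp only [Fin.val_zero]; omega)]
    omega

theorem exL_lt (k) : exL a c k < a * (c + 1) + (c + 1) := by
  rcases k with t | l
  · have := (finProdFinEquiv t).2
    simp only [exL, Sum.elim_inl]; omega
  · simp only [exL, Sum.elim_inr]
    split_ifs <;> omega

theorem exS_injective : Function.Injective (exS a c) := by
  rintro (t | l) (t' | l') h
  · simp only [exS, Sum.elim_inl, Fin.val_inj, EmbeddingLike.apply_eq_iff_eq] at h
    rw [h]
  · have := (finProdFinEquiv t).2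
    simp only [exS, Sum.elim_inl, Sum.elim_inr] at h
    omega
  · have := (finProdFinEquiv t').2
    simp only [exS, Sum.elim_inl, Sum.elim_inr] at h
    omega
  · simp only [exS, Sum.elim_inr] at h
    rw [Sum.inr.injEq, Fin.ext_iff]; omega

theorem mem_range_exS {i : ℕ} (h : i < a * (c + 1) + c) : i ∈ Set.range (exS a c) := by
  by_cases h1 : i < a * (c + 1)
  · exact ⟨Sum.inl (finProdFinEquiv.symm ⟨i, h1⟩), by
      rw [exS, Sum.elim_inl, Equiv.apply_symm_apply]⟩
  · exact ⟨Sum.inr ⟨i - a * (c + 1), by omega⟩, by simp only [exS, Sum.elim_inr]; omega⟩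

end Exponents

section Minor
variable {S : Type*} [CommRing S] {a c : ℕ}

/-- The Taylor functionals, those of positive order first. -/
noncomputable def fL (a : ℕ) (y : Fin (c + 1) → S) :
    (Fin a × Fin (c + 1)) ⊕ Fin (c + 1) → Polynomial S →ₗ[S] S :=
  Sum.elim (fun p => tl (y p.2) (p.1 + 1)) fun s => tl (y s) 0

/-- The number of the point at which a Taylor functional is taken. -/
def site (a c : ℕ) : (Fin a × Fin (c + 1)) ⊕ Fin (c + 1) → Fin (c + 1) :=
  Sum.elim Prod.snd id

/-- The matrix expressing the Taylor coefficients of `twist a G F` by those of `F`. -/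
noncomputable def Th (a : ℕ) (G : Polynomial S) (y : Fin (c + 1) → S) :
    Matrix ((Fin a × Fin (c + 1)) ⊕ Fin (c + 1)) ((Fin a × Fin (c + 1)) ⊕ Fin (c + 1)) S :=
  Matrix.fromBlocks
    (Matrix.blockDiagonal fun s => Matrix.of fun l l' : Fin a => twc a G (y s) l (l' + 1))
    (Matrix.of fun p s => if p.2 = s then twc a G (y s) p.1 0 else 0) 0 1

theorem Th_mulVec (G : Polynomial S) (y : Fin (c + 1) → S) (F : Fin (c + 1) → Polynomial S) :
    (Th a G y).mulVec (fun k => fL a y k (F (site a c k))) =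
      Sum.elim (fun p => tl (y p.2) p.1 (twist a G (F p.2))) fun s => tl (y s) 0 (F s) := by
  funext k
  rcases k with ⟨l, s⟩ | s
  · rw [Matrix.mulVec, dotProduct, Fintype.sum_sum_type, Fintype.sum_prod_type]
    simp only [Th, Matrix.fromBlocks_apply₁₁, Matrix.fromBlocks_apply₁₂, Matrix.blockDiagonal_apply,
      Matrix.of_apply, ite_mul, zero_mul, Finset.sum_ite_eq, Finset.mem_univ, if_true, fL, site,
      Sum.elim_inl, Sum.elim_inr, id]
    rw [tl_twist a G (F s) (y s) (n := a) (by omega), add_comm]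
  · rw [Matrix.mulVec, dotProduct, Fintype.sum_sum_type]
    simp [Th, Matrix.one_apply, fL, site]

theorem det_Th (G : Polynomial S) (y : Fin (c + 1) → S) : (Th a G y).det =
    (∏ _s : Fin (c + 1), ∏ l : Fin a, (-((l : S) + 1))) * ∏ s, G.eval (y s) ^ a := by
  rw [Th, Matrix.det_fromBlocks_zero₂₁, Matrix.det_one, mul_one, Matrix.det_blockDiagonal,
    ← Finset.prod_mul_distrib]
  refine Finset.prod_congr rfl fun s _ => ?_
  rw [Matrix.det_of_isLowerTriangular]
  · have : ∀ l : Fin a, twc a G (y s) l (l + 1) = (-((l : S) + 1)) * G.eval (y s) := by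
      intro l
      rw [twc, if_pos (by omega), Nat.sub_self, tl_apply, Polynomial.taylor_coeff_zero]
      push_cast; ring
    simp only [Matrix.of_apply, this, Finset.prod_mul_distrib, Finset.prod_const, Finset.card_univ,
      Fintype.card_fin]
  · intro l l' h
    have h' : (l : ℕ) < l' := h
    rw [Matrix.of_apply, twc, if_neg (by omega)]

theorem prod_mem_pow_of_mem {A : Type*} [CommRing A] [Algebra ℂ A] {M : Submodule ℂ A} {ι : Type*}
    (s : Finset ι) {f : ι → A} (h : ∀ i ∈ s, f i ∈ M) : ∏ i ∈ s, f i ∈ M ^ s.card := by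
  classical
  induction s using Finset.induction with
  | empty => simpa using Submodule.one_le.1 (le_refl (1 : Submodule ℂ A))
  | insert i s hi ih =>
    rw [Finset.prod_insert hi, Finset.card_insert_of_notMem hi, pow_succ']
    exact Submodule.mul_mem_mul (h i (Finset.mem_insert_self _ _))
      (ih fun j hj => h j (Finset.mem_insert_of_mem hj))

theorem det_mem_pow {A ι : Type*} [CommRing A] [Algebra ℂ A] [Fintype ι] [DecidableEq ι]
    {M : Submodule ℂ A} {B : Matrix ι ι A} (h : ∀ i j, B i j ∈ M) :
    B.det ∈ M ^ Fintype.card ι := by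
  rw [Matrix.det_apply]
  refine Submodule.sum_mem _ fun σ _ => ?_
  have := prod_mem_pow_of_mem (M := M) Finset.univ (f := fun i => B (σ i) i) fun i _ => h _ _
  rw [Finset.card_univ] at this
  rcases Int.units_eq_one_or σ.sign with h | h
  · rwa [h, one_smul]
  · rw [h, Units.neg_smul, one_smul]; exact Submodule.neg_mem _ this

end Minor

section Minor
variable {S : Type*} [CommRing S] [Algebra ℂ S] {a c : ℕ}

theorem fL_map {K T : Type*} [CommRing K] [CommRing T] (f : K →+* T) (y : Fin (c + 1) → K) (k)
    (F : Polynomial K) : fL a (fun s => f (y s)) k (F.map f) = f (fL a y k F) := by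
  rcases k with p | s
  · exact tl_map f _ _ _
  · exact tl_map f _ _ _

theorem fL_X_pow (y : Fin (c + 1) → ℂ) (k) (i : ℕ) :
    fL a (fun s => algebraMap ℂ S (y s)) k (Polynomial.X ^ i) =
      algebraMap ℂ S (fL a y k (Polynomial.X ^ i)) := by
  rw [← fL_map, Polynomial.map_pow, Polynomial.map_X]

theorem eq_zero_of_fL {y : Fin (c + 1) → ℂ} (hy : Function.Injective y) {F : Polynomial ℂ}
    (hF : ∀ i, F.coeff i ≠ 0 → i ∈ Set.range (exL a c)) (h : ∀ k, fL a y k F = 0) : F = 0 := by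
  refine eq_zero_of_tl hy (n := a + 1) ?_ fun s l hl => ?_
  · rw [Polynomial.degree_lt_iff_coeff_zero]
    intro m hm
    by_contra hne
    obtain ⟨k, rfl⟩ := hF m hne
    have := exL_lt a c k
    rw [add_mul, one_mul] at hm
    omega
  · rcases l with _ | l
    · exact h (Sum.inr s)
    · exact h (Sum.inl (⟨l, by omega⟩, s))

/-- The matrix of the Taylor functionals on monomials. -/
noncomputable def vand (a : ℕ) (y : Fin (c + 1) → ℂ) :
    Matrix ((Fin a × Fin (c + 1)) ⊕ Fin (c + 1)) ((Fin a × Fin (c + 1)) ⊕ Fin (c + 1)) ℂ :=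
  Matrix.of fun k k' => fL a y k (Polynomial.X ^ exL a c k')

theorem det_vand_ne_zero {y : Fin (c + 1) → ℂ} (hy : Function.Injective y) :
    (vand a y).det ≠ 0 :=
  det_functional_ne_zero (exL_injective a c) _ fun _ hF h => eq_zero_of_fL hy hF h

theorem vand_map_mulVec (y : Fin (c + 1) → ℂ) {F : Polynomial S}
    (hF : F.natDegree < a * (c + 1) + (c + 1)) :
    ((vand a y).map (algebraMap ℂ S)).mulVec (fun k => F.coeff (exL a c k)) =
      fun k => fL a (fun s => algebraMap ℂ S (y s)) k F := by
  funext k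
  rw [← sum_mul_coeff (exL_injective a c) (fun i hi => mem_range_exL a c
    ((Polynomial.le_natDegree_of_ne_zero hi).trans_lt hF))]
  refine Finset.sum_congr rfl fun k' _ => ?_
  rw [fL_X_pow]; rfl

/-- The Taylor coefficients of `F`, distributed into columns according to the point. -/
noncomputable def splitTaylor (a : ℕ) (y : Fin (c + 1) → ℂ) (F : Polynomial S) :
    Matrix ((Fin a × Fin (c + 1)) ⊕ Fin (c + 1)) (Fin (c + 1)) S :=
  Matrix.of fun k s => if site a c k = s then fL a (fun s => algebraMap ℂ S (y s)) k F else 0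

/-- The coefficients of the polynomials with prescribed Taylor coefficients at one point. -/
noncomputable def parts (a : ℕ) (y : Fin (c + 1) → ℂ) (F : Polynomial S) :
    Matrix ((Fin a × Fin (c + 1)) ⊕ Fin (c + 1)) (Fin (c + 1)) S :=
  (vand a y)⁻¹.map (algebraMap ℂ S) * splitTaylor a y F

theorem vand_mul_parts {y : Fin (c + 1) → ℂ} (hy : Function.Injective y) (F : Polynomial S) :
    (vand a y).map (algebraMap ℂ S) * parts a y F = splitTaylor a y F := by
  rw [parts, ← Matrix.mul_assoc, ← Matrix.map_mul,
    Matrix.mul_nonsing_inv _ (det_vand_ne_zero hy).isUnit, Matrix.map_one _ (map_zero _) (map_one _),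
    Matrix.one_mul]

theorem sum_parts {y : Fin (c + 1) → ℂ} (hy : Function.Injective y) {F : Polynomial S}
    (hF : F.natDegree < a * (c + 1) + (c + 1)) (k) : ∑ s, parts a y F k s = F.coeff (exL a c k) := by
  have h1 : (parts a y F).mulVec 1 = fun k => F.coeff (exL a c k) := by
    have h2 : (splitTaylor a y F).mulVec 1 =
        fun k => fL a (fun s => algebraMap ℂ S (y s)) k F := by
      funext k
      simp [Matrix.mulVec, dotProduct, splitTaylor]
    rw [parts, ← Matrix.mulVec_mulVec, h2, ← vand_map_mulVec y hF, Matrix.mulVec_mulVec,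
      ← Matrix.map_mul, Matrix.nonsing_inv_mul _ (det_vand_ne_zero hy).isUnit,
      Matrix.map_one _ (map_zero _) (map_one _), Matrix.one_mulVec]
  rw [← congrFun h1 k]
  simp [Matrix.mulVec, dotProduct]

theorem fL_mem_span (y : Fin (c + 1) → ℂ) (k) (F : Polynomial S) :
    fL a (fun s => algebraMap ℂ S (y s)) k F ∈ Submodule.span ℂ (Set.range F.coeff) := by
  rw [F.as_sum_support_C_mul_X_pow, map_sum, ← F.as_sum_support_C_mul_X_pow]
  refine Submodule.sum_mem _ fun i _ => ?_
  rw [← Polynomial.smul_eq_C_mul, map_smul, fL_X_pow, smul_eq_mul, mul_comm, ← Algebra.smul_def]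
  exact Submodule.smul_mem _ _ (Submodule.subset_span ⟨i, rfl⟩)

theorem parts_mem_span (y : Fin (c + 1) → ℂ) (F : Polynomial S) (k s) :
    parts a y F k s ∈ Submodule.span ℂ (Set.range F.coeff) := by
  rw [parts, Matrix.mul_apply]
  refine Submodule.sum_mem _ fun k' _ => ?_
  rw [Matrix.map_apply, ← Algebra.smul_def]
  refine Submodule.smul_mem _ _ ?_
  rw [splitTaylor, Matrix.of_apply]
  split_ifs
  · exact fL_mem_span y k' F
  · exact zero_mem _

theorem det_parts {y : Fin (c + 1) → ℂ} (hy : Function.Injective y) {F : Polynomial S}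
    (hF : F.natDegree ≤ a * (c + 1)) : ∃ w ∈ Submodule.span ℂ (Set.range F.coeff) ^ c,
      (Matrix.of fun l s => parts a y F (Sum.inr l) s).det = F.coeff 0 * w := by
  set M := Matrix.of fun l s => parts a y F (Sum.inr l) s with hM
  have h1 : M.mulVec 1 = Pi.single 0 (F.coeff 0) := by
    funext l
    have : M.mulVec 1 l = ∑ s, parts a y F (Sum.inr l) s := by
      simp [Matrix.mulVec, dotProduct, hM]
    rw [this, sum_parts hy (by omega)]
    by_cases h : l = 0
    · subst h; simp [exL]
    · rw [Pi.single_eq_of_ne h, exL, Sum.elim_inr, if_neg h, Polynomial.coeff_eq_zero_of_natDegree_lt]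
      have : (l : ℕ) ≠ 0 := fun h' => h (Fin.ext h')
      omega
  have h2 : M.det • (1 : Fin (c + 1) → S) = M.adjugate.mulVec (Pi.single 0 (F.coeff 0)) := by
    rw [← h1, Matrix.mulVec_mulVec, Matrix.adjugate_mul, Matrix.smul_mulVec, Matrix.one_mulVec]
  have h3 := congrFun h2 0
  rw [Matrix.mulVec_single, Pi.smul_apply, Pi.one_apply, smul_eq_mul, mul_one] at h3
  refine ⟨M.adjugate 0 0, ?_, by rw [h3]; simp [mul_comm]⟩
  rw [Matrix.adjugate_fin_succ_eq_det_submatrix]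
  simp only [Fin.val_zero, add_zero, pow_zero, one_mul]
  have := det_mem_pow (M := Submodule.span ℂ (Set.range F.coeff))
    (B := M.submatrix (Fin.succAbove 0) (Fin.succAbove 0)) fun i j => parts_mem_span _ _ _ _
  rwa [Fintype.card_fin] at this

theorem det_twist [IsDomain S] {y : Fin (c + 1) → ℂ} (hy : Function.Injective y) {G : Polynomial S}
    (hG : G.natDegree ≤ c + 1) (hG0 : ∀ s, G.eval (algebraMap ℂ S (y s)) ≠ 0) :
    ∃ w ∈ Submodule.span ℂ (Set.range (G ^ a).coeff) ^ c, ∃ κ : ℂ,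
      (Matrix.of fun p t : Fin a × Fin (c + 1) => tl (algebraMap ℂ S (y p.2)) p.1
        (twist a G (Polynomial.X ^ exL a c (Sum.inl t)))).det =
        algebraMap ℂ S κ * ((G ^ a).coeff 0 * w) := by
  obtain ⟨w, hw, hdet⟩ := det_parts (a := a) hy (F := G ^ a)
    (Polynomial.natDegree_pow_le.trans (Nat.mul_le_mul_left a hG))
  set ys : Fin (c + 1) → S := fun s => algebraMap ℂ S (y s) with hys
  set E := parts a y (G ^ a)
  set T := Matrix.of fun p t : Fin a × Fin (c + 1) => tl (ys p.2) p.1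
        (twist a G (Polynomial.X ^ exL a c (Sum.inl t))) with hT
  set B : Matrix ((Fin a × Fin (c + 1)) ⊕ Fin (c + 1)) ((Fin a × Fin (c + 1)) ⊕ Fin (c + 1)) S :=
    Matrix.fromBlocks 1 (Matrix.of fun t s => E (Sum.inl t) s) 0
      (Matrix.of fun l s => E (Sum.inr l) s) with hB
  set V := (vand a y).map (algebraMap ℂ S) with hV
  have hVB : V * B = Matrix.of fun k k' => Sum.elim (fun t => V k (Sum.inl t))
      (fun s => splitTaylor a y (G ^ a) k s) k' := by
    ext k k'
    rw [Matrix.mul_apply, Fintype.sum_sum_type]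
    rcases k' with t | s
    · simp [hB, Matrix.one_apply]
    · simp only [hB, Matrix.fromBlocks_apply₁₂, Matrix.fromBlocks_apply₂₂, Matrix.of_apply,
        Sum.elim_inr]
      rw [← vand_mul_parts hy, Matrix.mul_apply, Fintype.sum_sum_type]
  have hprod : Th a G ys * (V * B) = Matrix.fromBlocks T 0
      (Matrix.of fun s t => tl (ys s) 0 (Polynomial.X ^ exL a c (Sum.inl t)))
      (Matrix.diagonal fun s => G.eval (ys s) ^ a) := by
    ext k k'
    rw [hVB]
    rcases k' with t | s'
    · have h1 := congrFun (Th_mulVec (a := a) G ys fun _ => Polynomial.X ^ exL a c (Sum.inl t)) k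
      have h2 : (Th a G ys * Matrix.of fun k k' => Sum.elim (fun t => V k (Sum.inl t))
          (fun s => splitTaylor a y (G ^ a) k s) k') k (Sum.inl t) =
          (Th a G ys).mulVec (fun k => fL a ys k (Polynomial.X ^ exL a c (Sum.inl t))) k := by
        refine Finset.sum_congr rfl fun k' _ => ?_
        exact congrArg _ (fL_X_pow y k' _).symm
      rw [h2, h1]
      rcases k with p | s <;> rfl
    · have h1 := congrFun (Th_mulVec (a := a) G ys fun s => if s = s' then G ^ a else 0) k
      have h2 : (Th a G ys * Matrix.of fun k k' => Sum.elim (fun t => V k (Sum.inl t))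
          (fun s => splitTaylor a y (G ^ a) k s) k') k (Sum.inr s') =
          (Th a G ys).mulVec (fun k => fL a ys k (if site a c k = s' then G ^ a else 0)) k := by
        refine Finset.sum_congr rfl fun k' _ => ?_
        congr 1
        simp only [Matrix.of_apply, Sum.elim_inr, splitTaylor]
        rw [apply_ite (fL a ys k'), map_zero]
      rw [h2, h1]
      rcases k with p | s
      · have h0 : twist a G 0 = 0 := by simp [twist]
        simp only [Sum.elim_inl, Matrix.fromBlocks_apply₁₂, Matrix.zero_apply]
        split_ifs
        · rw [twist_pow, map_zero]
        · rw [h0, map_zero]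
      · simp only [Sum.elim_inr, Matrix.fromBlocks_apply₂₂, Matrix.diagonal_apply]
        split_ifs
        · rw [tl_apply, Polynomial.taylor_coeff_zero, Polynomial.eval_pow]
        · rw [map_zero]
  have h1 := congrArg Matrix.det hprod
  rw [Matrix.det_mul, Matrix.det_mul, Matrix.det_fromBlocks_zero₁₂, Matrix.det_diagonal, det_Th,
    hB, Matrix.det_fromBlocks_zero₂₁, Matrix.det_one, one_mul, hdet, hV,
    ← RingHom.mapMatrix_apply, ← RingHom.map_det] at h1
  refine ⟨w, hw, (∏ _s : Fin (c + 1), ∏ l : Fin a, (-((l : ℂ) + 1))) * (vand a y).det, ?_⟩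
  have h2 : ∏ s, G.eval (ys s) ^ a ≠ 0 := Finset.prod_ne_zero_iff.2 fun s _ => pow_ne_zero _ (hG0 s)
  apply mul_right_cancel₀ h2
  rw [← h1, map_mul, map_prod]
  simp only [map_prod, map_neg, map_add, map_one, map_natCast]
  ring

end Minor

section Full
variable {S : Type*} [CommRing S] [Algebra ℂ S] {a c : ℕ}

theorem coeff_twist_X_pow {G : Polynomial S} (hG : G.natDegree ≤ c + 1) {i r : ℕ}
    (hi : i ≤ a * (c + 1)) (h : (twist a G (Polynomial.X ^ i)).coeff r ≠ 0) :
    r < a * (c + 1) + c := by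
  by_contra hr
  refine h ?_
  rw [twist, coeff_mul_derivative_sub]
  refine Finset.sum_eq_zero fun k _ => ?_
  rw [Polynomial.coeff_X_pow]
  split_ifs with hk
  swap
  · rw [mul_zero]
  subst hk
  by_cases h1 : c + 1 < r + 1 - k
  · rw [Polynomial.coeff_eq_zero_of_natDegree_lt (hG.trans_lt h1), mul_zero, zero_mul]
  · have h2 : r + 1 - k = c + 1 := by omega
    have h3 : k = a * (c + 1) := by omega
    rw [h2, h3]; push_cast; ring

/-- The monic polynomial with the given roots. -/
noncomputable def rootPoly (y : Fin (c + 1) → ℂ) : Polynomial ℂ :=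
  ∏ s, (Polynomial.X - Polynomial.C (y s))

theorem rootPoly_monic (y : Fin (c + 1) → ℂ) : (rootPoly y).Monic :=
  Polynomial.monic_prod_of_monic _ _ fun _ _ => Polynomial.monic_X_sub_C _

theorem natDegree_rootPoly (y : Fin (c + 1) → ℂ) : (rootPoly y).natDegree = c + 1 := by
  rw [rootPoly, Polynomial.natDegree_prod_of_monic _ _ fun _ _ => Polynomial.monic_X_sub_C _]
  simp

theorem natDegree_rootPoly_pow_mul (y : Fin (c + 1) → ℂ) (l : ℕ) :
    (rootPoly y ^ a * Polynomial.X ^ l).natDegree = a * (c + 1) + l := by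
  rw [Polynomial.Monic.natDegree_mul ((rootPoly_monic y).pow a) (Polynomial.monic_X_pow l),
    (rootPoly_monic y).natDegree_pow, natDegree_rootPoly, Polynomial.natDegree_X_pow]

/-- The polynomials whose coefficients form a maximal minor. -/
noncomputable def colPoly (a : ℕ) (G : Polynomial S) (y : Fin (c + 1) → ℂ) :
    (Fin a × Fin (c + 1)) ⊕ Fin c → Polynomial S :=
  Sum.elim (fun t => twist a G (Polynomial.X ^ exL a c (Sum.inl t)))
    fun l => (rootPoly y ^ a * Polynomial.X ^ (l : ℕ)).map (algebraMap ℂ S)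

theorem colPoly_coeff {G : Polynomial S} (hG : G.natDegree ≤ c + 1) (y : Fin (c + 1) → ℂ) (k)
    {r : ℕ} (h : (colPoly a G y k).coeff r ≠ 0) : r < a * (c + 1) + c := by
  rcases k with t | l
  · refine coeff_twist_X_pow hG ?_ h
    have := (finProdFinEquiv t).2
    simp only [exL, Sum.elim_inl]; omega
  · have h1 := Polynomial.le_natDegree_of_ne_zero h
    have h2 : (colPoly a G y (Sum.inr l)).natDegree ≤ _ := Polynomial.natDegree_map_le
    rw [natDegree_rootPoly_pow_mul] at h2
    omega

/-- Taylor functionals of low order and top coefficients. -/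
noncomputable def gL (a : ℕ) (y : Fin (c + 1) → S) :
    (Fin a × Fin (c + 1)) ⊕ Fin c → Polynomial S →ₗ[S] S :=
  Sum.elim (fun p => tl (y p.2) p.1) fun m => Polynomial.lcoeff S (a * (c + 1) + m)

theorem gL_X_pow (y : Fin (c + 1) → ℂ) (k) (i : ℕ) :
    gL a (fun s => algebraMap ℂ S (y s)) k (Polynomial.X ^ i) =
      algebraMap ℂ S (gL a y k (Polynomial.X ^ i)) := by
  rcases k with p | s
  · rw [gL, Sum.elim_inl, gL, Sum.elim_inl, ← tl_map, Polynomial.map_pow, Polynomial.map_X]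
  · simp only [gL, Sum.elim_inr, Polynomial.lcoeff_apply, Polynomial.coeff_X_pow]
    split_ifs <;> simp

theorem eq_zero_of_gL {y : Fin (c + 1) → ℂ} (hy : Function.Injective y) {F : Polynomial ℂ}
    (hF : ∀ i, F.coeff i ≠ 0 → i ∈ Set.range (exS a c)) (h : ∀ k, gL a y k F = 0) : F = 0 := by
  refine eq_zero_of_tl hy (n := a) ?_ fun s l hl => h (Sum.inl (⟨l, hl⟩, s))
  rw [Polynomial.degree_lt_iff_coeff_zero]
  intro m hm
  by_contra hne
  obtain ⟨k, rfl⟩ := hF m hne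
  rcases k with t | l
  · have := (finProdFinEquiv t).2
    simp only [exS, Sum.elim_inl] at hm
    omega
  · exact hne (h (Sum.inr l))

theorem det_colPoly [IsDomain S] {y : Fin (c + 1) → ℂ} (hy : Function.Injective y)
    {G : Polynomial S} (hG : G.natDegree ≤ c + 1)
    (hG0 : ∀ s, G.eval (algebraMap ℂ S (y s)) ≠ 0) :
    ∃ w ∈ Submodule.span ℂ (Set.range (G ^ a).coeff) ^ c,
      (Matrix.of fun k k' => (colPoly a G y k').coeff (exS a c k)).det = (G ^ a).coeff 0 * w := by
  obtain ⟨w, hw, κ, h⟩ := det_twist (a := a) hy hG hG0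
  set M := Matrix.of fun k k' => (colPoly a G y k').coeff (exS a c k) with hM
  set Z := Matrix.of fun k k' => gL a y k (Polynomial.X ^ exS a c k') with hZ
  have hZ0 : Z.det ≠ 0 := det_functional_ne_zero (exS_injective a c) _ fun _ hF h =>
    eq_zero_of_gL hy hF h
  have hprod : Z.map (algebraMap ℂ S) * M = Matrix.fromBlocks
      (Matrix.of fun p t : Fin a × Fin (c + 1) => tl (algebraMap ℂ S (y p.2)) p.1
        (twist a G (Polynomial.X ^ exL a c (Sum.inl t)))) 0
      (Matrix.of fun m t => gL a (fun s => algebraMap ℂ S (y s)) (Sum.inr m)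
        (colPoly a G y (Sum.inl t)))
      (Matrix.of fun m l : Fin c =>
        ((rootPoly y ^ a * Polynomial.X ^ (l : ℕ)).map (algebraMap ℂ S)).coeff
          (a * (c + 1) + m)) := by
    ext k k'
    have h1 := sum_mul_coeff (exS_injective a c) (fun i hi => mem_range_exS a c
      (colPoly_coeff hG y k' hi)) (gL a (fun s => algebraMap ℂ S (y s)) k)
    simp only [gL_X_pow] at h1
    refine Eq.trans h1 ?_
    rcases k with p | m <;> rcases k' with t | l
    · rfl
    · rw [Matrix.fromBlocks_apply₁₂, Matrix.zero_apply, gL, Sum.elim_inl, colPoly, Sum.elim_inr,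
        tl_map, tl_eq_zero_of_dvd (n := a) _ p.1.2, map_zero]
      refine Dvd.dvd.mul_right (pow_dvd_pow_of_dvd ?_ a) _
      exact Finset.dvd_prod_of_mem _ (Finset.mem_univ p.2)
    · rfl
    · rfl
  have hU : (Matrix.of fun m l : Fin c =>
      ((rootPoly y ^ a * Polynomial.X ^ (l : ℕ)).map (algebraMap ℂ S)).coeff
        (a * (c + 1) + m)).det = 1 := by
    rw [Matrix.det_of_isUpperTriangular, Finset.prod_eq_one]
    · intro l _
      rw [Matrix.of_apply, Polynomial.coeff_map, ← natDegree_rootPoly_pow_mul y,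
        Polynomial.coeff_natDegree,
        (((rootPoly_monic y).pow a).mul (Polynomial.monic_X_pow _)).leadingCoeff, map_one]
    · intro m l hml
      have h3 : (l : ℕ) < m := hml
      rw [Matrix.of_apply, Polynomial.coeff_map, Polynomial.coeff_eq_zero_of_natDegree_lt, map_zero]
      rw [natDegree_rootPoly_pow_mul]; omega
  have h1 := congrArg Matrix.det hprod
  rw [Matrix.det_mul, Matrix.det_fromBlocks_zero₁₂, h, hU, mul_one, ← RingHom.mapMatrix_apply,
    ← RingHom.map_det] at h1
  refine ⟨(Z.det⁻¹ * κ) • w, Submodule.smul_mem _ _ hw, ?_⟩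
  have h2 : algebraMap ℂ S Z.det ≠ 0 := (map_ne_zero_iff _ (algebraMap ℂ S).injective).2 hZ0
  apply mul_left_cancel₀ h2
  have h3 : algebraMap ℂ S Z.det * algebraMap ℂ S (Z.det⁻¹ * κ) = algebraMap ℂ S κ := by
    rw [← map_mul, mul_inv_cancel_left₀ hZ0]
  rw [h1, Algebra.smul_def, ← h3]
  ring

end Full

section Constants
variable {R O E : Type*} [CommRing R] [IsDomain R] [CharZero R] [LinearOrder O] [Fintype O]
  [DecidableEq E]

theorem wedge_mem_subring (K : Subring R) {d : ℕ} {n : Fin d → O → R} (hn : ∀ i r, n i r ∈ K)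
    {v : Fock R O E} {q : E → ℕ} (hv : ∀ P, v (P, q) ∈ K) (P) : wedge R O E d n v (P, q) ∈ K := by
  induction d generalizing P with
  | zero => rw [wedge_apply]; simpa using hv P
  | succ d ih =>
    rw [wedge_succ, Module.End.mul_apply, cv_apply]
    refine sum_mem fun r _ => mul_mem (hn _ _) (mul_mem ?_ (ih (fun i => hn _) _))
    rw [fsgn]
    exact pow_mem (neg_mem (one_mem _)) _

theorem vac_mem_subring (K : Subring R) (P Q : Finset O) : vac R E P (Q, 0) ∈ K := by
  rw [vac_apply]
  split_ifs
  exacts [one_mem _, zero_mem _]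

variable (R) in
/-- Extension of a vector by a zero entry. -/
noncomputable def snocZero (N : ℕ) : (Fin N → R) →ₗ[R] (Fin (N + 1) → R) :=
  LinearMap.pi fun r => Fin.lastCases 0 (fun i => LinearMap.proj i) r

theorem snocZero_last {N : ℕ} (v : Fin N → R) : snocZero R N v (Fin.last N) = 0 := by
  simp [snocZero]

theorem snocZero_castSucc {N : ℕ} (v : Fin N → R) (i) : snocZero R N v i.castSucc = v i := by
  simp [snocZero]

theorem eq_snocZero {N : ℕ} {v : Fin (N + 1) → R} (h : v (Fin.last N) = 0) :
    v = snocZero R N fun i => v i.castSucc := by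
  funext r
  refine Fin.lastCases ?_ (fun i => ?_) r
  · rw [snocZero_last, h]
  · rw [snocZero_castSucc]

theorem wedge_vac_full {N : ℕ} (K : Subring R) : ∃ κ ∈ K, ∀ n : Fin N → Fin (N + 1) → R,
    (∀ i, n i (Fin.last N) = 0) → wedge R (Fin (N + 1)) E N n (vac R E ∅) (full N, 0) =
      κ * (Matrix.of fun i j : Fin N => n i j.castSucc).det := by
  let f : (Fin N → R) [⋀^Fin N]→ₗ[R] R := ((((LinearMap.proj (full N, 0) :
    Fock R (Fin (N + 1)) E →ₗ[R] R)).comp (LinearMap.applyₗ (vac R E ∅))).compAlternatingMap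
    (wedge R (Fin (N + 1)) E N)).compLinearMap (snocZero R N)
  refine ⟨f (Pi.basisFun R (Fin N)), ?_, fun n hn => ?_⟩
  · refine wedge_mem_subring K (fun i r => ?_) (fun P => vac_mem_subring K _ _) _
    simp only [Pi.basisFun_apply]
    refine Fin.lastCases ?_ (fun i => ?_) r
    · rw [snocZero_last]; exact zero_mem _
    · rw [snocZero_castSucc, Pi.single_apply]
      split_ifs
      exacts [one_mem _, zero_mem _]
  · have h := DFunLike.congr_fun (AlternatingMap.eq_smul_basis_det (Pi.basisFun R (Fin N)) f)
      fun i j => n i j.castSucc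
    rw [AlternatingMap.smul_apply, Pi.basisFun_det_apply, smul_eq_mul] at h
    refine Eq.trans ?_ h
    have h1 : n = fun i => snocZero R N fun j => n i j.castSucc :=
      funext fun i => eq_snocZero (hn i)
    conv_lhs => rw [h1]
    rfl

end Constants

section Delta
variable {a c : ℕ}

local notation "RR" => MvPolynomial (Fin (c + 1 + 1)) ℂ

theorem Am_eq_coeff_twist (b N : ℕ) (i : Fin (a * b + 1)) (r : Fin (N + 1)) :
    Am a b N r i = (twist a (Gp b) (Polynomial.X ^ (i : ℕ))).coeff r := by
  rw [twist, ← Am_mul_vec _ _ _ _ (by rw [Polynomial.natDegree_X_pow]; omega),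
    Finset.sum_eq_single i]
  · simp
  · intro j _ hj
    rw [Polynomial.coeff_X_pow, if_neg (fun h => hj (Fin.ext h)), mul_zero]
  · simp

theorem Gp_eval_ne_zero (b : ℕ) (z : ℂ) :
    (Gp b).eval (algebraMap ℂ (MvPolynomial (Fin (b + 1)) ℂ) z) ≠ 0 := by
  intro h
  have h1 := congrArg (MvPolynomial.eval (Pi.single 0 1 : Fin (b + 1) → ℂ)) h
  rw [Gp, Polynomial.eval_finsetSum, map_sum, Finset.sum_range_succ'] at h1
  rw [Finset.sum_eq_zero, map_zero] at h1
  · have := uu_fin (0 : Fin (b + 1))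
    rw [Fin.val_zero] at this
    simp [this] at h1
  · intro i hi
    have := uu_fin (⟨i + 1, by simpa using hi⟩ : Fin (b + 1))
    simp only at this
    simp [this, Fin.ext_iff]

/-- The numbering of the columns of `colPoly`. -/
def colEquiv (a c : ℕ) : (Fin a × Fin (c + 1)) ⊕ Fin c ≃ Fin (a * (c + 1) + c) :=
  (finProdFinEquiv.sumCongr (Equiv.refl _)).trans finSumFinEquiv

theorem colEquiv_val (k) : (colEquiv a c k : ℕ) = exS a c k := by
  rcases k with t | l <;> simp [colEquiv, exS]

theorem delta_wedge_rootPoly_mem (ha : 1 ≤ a) {y : Fin (c + 1) → ℂ} (hy : Function.Injective y) :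
    delta a (c + 1) (a * (c + 1) + c) (wedge RR _ _ c
      (fun l r => C ((rootPoly y ^ a * Polynomial.X ^ (l : ℕ)).coeff r)) (vac _ _ ∅)) ∈
      Submodule.span ℂ (Set.range (Gp (c + 1) ^ a).coeff) ^ c := by
  set n : Fin c → Fin (a * (c + 1) + c + 1) → RR :=
    fun l r => C ((rootPoly y ^ a * Polynomial.X ^ (l : ℕ)).coeff r)
  set col : Fin (a * (c + 1)) → Fin (a * (c + 1) + c + 1) → RR :=
    fun i r => Am a (c + 1) (a * (c + 1) + c) r i.succ
  obtain ⟨κ, ⟨z, rfl⟩, hκ⟩ := wedge_vac_full (R := RR) (E := Fin (a * (c + 1) + 1))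
    (N := a * (c + 1) + c) (algebraMap ℂ RR).range
  obtain ⟨w, hw, hdet⟩ := det_colPoly (a := a) (S := RR) hy (Gp_natDegree_le (c + 1))
    fun s => Gp_eval_ne_zero (c + 1) _
  have hcol : ∀ k (r : Fin (a * (c + 1) + c + 1)), Fin.append col n (colEquiv a c k) r =
      (colPoly a (Gp (c + 1)) y k).coeff r := by
    rintro (t | l) r
    · simp only [colEquiv, Equiv.trans_apply, Equiv.sumCongr_apply, Sum.map_inl,
        finSumFinEquiv_apply_left, Fin.append_left, col, colPoly, Sum.elim_inl, exL]
      rw [Am_eq_coeff_twist, Fin.val_succ]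
    · simp only [colEquiv, Equiv.trans_apply, Equiv.sumCongr_apply, Sum.map_inr,
        finSumFinEquiv_apply_right, Fin.append_right, n, colPoly, Sum.elim_inr,
        Equiv.refl_apply, Polynomial.coeff_map]
      rfl
  have h := cc_mul_delta (N := a * (c + 1) + c) ha (Nat.succ_pos c)
    (wedge RR _ _ c n (vac _ _ ∅))
  rw [omega, ← Module.End.mul_apply, ← wedge_append, hκ] at h
  · rw [← Matrix.det_transpose, ← Matrix.det_submatrix_equiv_self (colEquiv a c)] at h
    have e : ((Matrix.of fun i j : Fin (a * (c + 1) + c) =>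
        Fin.append col n i j.castSucc).transpose.submatrix (colEquiv a c) (colEquiv a c)) =
        Matrix.of fun k k' => (colPoly a (Gp (c + 1)) y k').coeff (exS a c k) := by
      ext1 k k'
      rw [Matrix.submatrix_apply, Matrix.transpose_apply, Matrix.of_apply, hcol, Fin.val_castSucc,
        colEquiv_val, Matrix.of_apply]
    rw [e, hdet, mul_left_comm] at h
    rw [mul_left_cancel₀ cc_zero_ne_zero h, ← Algebra.smul_def]
    exact Submodule.smul_mem _ _ hw
  · intro i
    obtain ⟨k, rfl⟩ := (colEquiv a c).surjective i
    rw [hcol]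
    by_contra hne
    have := colPoly_coeff (Gp_natDegree_le (c + 1)) y k hne
    simp at this

end Delta

section Span

variable (a b : ℕ) in
/-- The span of the coefficients of the power of the generic form. -/
noncomputable def ccSpan : Submodule ℂ (MvPolynomial (Fin (b + 1)) ℂ) :=
  Submodule.span ℂ (Set.range (Gp b ^ a).coeff)

variable {a b : ℕ}

theorem cc_mem_ccSpan (j : ℕ) : cc a b j ∈ ccSpan a b := Submodule.subset_span ⟨j, rfl⟩

theorem ccSpan_le : ccSpan a b ≤ (ccIdeal a b).restrictScalars ℂ := by
  rw [ccSpan, Submodule.span_le]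
  rintro _ ⟨j, rfl⟩
  by_cases h : j < a * b + 1
  · exact cc_mem ⟨j, h⟩
  · have : cc a b j = 0 := cc_of_lt (by omega)
    rw [cc] at this
    rw [this]; exact zero_mem _

theorem ccSpan_pow_le (k : ℕ) {p} (h : p ∈ ccSpan a b ^ k) : p ∈ ccIdeal a b ^ k := by
  induction k generalizing p with
  | zero => simp
  | succ k ih =>
    rw [pow_succ] at h ⊢
    refine Submodule.mul_induction_on h (fun m hm n hn => ?_) fun x y hx hy => Ideal.add_mem _ hx hy
    exact Ideal.mul_mem_mul (ih hm) (ccSpan_le hn)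

theorem cmon_mem_ccSpan_pow (q : Fin (a * b + 1) → ℕ) : cmon q ∈ ccSpan a b ^ ∑ j, q j := by
  rw [cmon]
  have : ∀ s : Finset (Fin (a * b + 1)), ∏ j ∈ s, cc a b j ^ q j ∈ ccSpan a b ^ ∑ j ∈ s, q j := by
    intro s
    induction s using Finset.induction with
    | empty =>
      simpa using Submodule.one_le.1 (le_refl (1 : Submodule ℂ (MvPolynomial (Fin (b + 1)) ℂ)))
    | insert i s hi ih =>
      rw [Finset.prod_insert hi, Finset.sum_insert hi, pow_add]
      exact Submodule.mul_mem_mul (Submodule.pow_mem_pow _ (cc_mem_ccSpan _) _) ih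
  exact this _

theorem mem_ccSpan_pow {k : ℕ} {p} (hp : p ∈ ccIdeal a b ^ k) (hn : p.IsHomogeneous (a * k)) :
    p ∈ ccSpan a b ^ k := by
  obtain ⟨h, h0, rfl⟩ := exists_eq_sum_cmon_of_isHomogeneous (n := 0) hp (by rwa [zero_add])
  refine sum_mem fun q hq => ?_
  rw [totalDegree_eq_zero_iff_eq_C.1 (Nat.le_zero.1 (h0 q).totalDegree_le), ← smul_eq_C_mul]
  rw [← (Finset.mem_piAntidiag.1 hq).1]
  exact Submodule.smul_mem _ _ (cmon_mem_ccSpan_pow q)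

theorem map_eq_zero_of_mem_ccSpan_pow {k : ℕ} {M : Type*} [AddCommGroup M] [Module ℂ M]
    (l : MvPolynomial (Fin (b + 1)) ℂ →ₗ[ℂ] M) (h : ∀ j : Fin k → ℕ, l (∏ s, cc a b (j s)) = 0)
    {p} (hp : p ∈ ccSpan a b ^ k) : l p = 0 := by
  rw [ccSpan, Submodule.span_pow] at hp
  rw [← LinearMap.mem_ker]
  refine (Submodule.span_le.2 ?_) hp
  intro x hx
  obtain ⟨f, rfl⟩ := Set.mem_pow.1 hx
  choose j hj using fun i => (f i).2
  rw [List.prod_ofFn]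
  simp only [← hj]
  exact h j

end Span

section Interpolation

theorem eq_zero_of_eval_injective {n : ℕ} {p : MvPolynomial (Fin n) ℂ}
    (h : ∀ y : Fin n → ℂ, Function.Injective y → eval y p = 0) : p = 0 := by
  have hV : ∏ s ∈ (Finset.univ : Finset (Fin n)).offDiag, (X s.1 - X s.2 : MvPolynomial (Fin n) ℂ) ≠
      0 := by
    rw [Finset.prod_ne_zero_iff]
    intro s hs h0
    exact (Finset.mem_offDiag.1 hs).2.2 (X_injective (sub_eq_zero.1 h0))
  refine (mul_eq_zero.1 (?_ : _ * p = 0)).resolve_left hV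
  refine MvPolynomial.funext fun y => ?_
  rw [map_mul, map_zero]
  by_cases hy : Function.Injective y
  · rw [h y hy, mul_zero]
  · rw [Function.Injective] at hy
    push Not at hy
    obtain ⟨s, t, h1, h2⟩ := hy
    rw [map_prod, Finset.prod_eq_zero (i := (s, t)) (by simp [h2]), zero_mul]
    simp [h1]

theorem eval_C_eq_sum_cc (a b : ℕ) (z : ℂ) : ((Gp b) ^ a).eval (C z) =
    ∑ j ∈ Finset.range (a * b + 1), z ^ j • cc a b j := by
  rw [Polynomial.eval_eq_sum_range' (n := a * b + 1)]
  · refine Finset.sum_congr rfl fun j _ => ?_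
    rw [smul_eq_C_mul, C_pow, mul_comm, cc]
  · exact Nat.lt_succ_of_le (Polynomial.natDegree_pow_le.trans
      (Nat.mul_le_mul_left a (Gp_natDegree_le b)))

theorem map_prod_cc_eq_zero {a b n : ℕ} (l : MvPolynomial (Fin (b + 1)) ℂ →ₗ[ℂ] ℂ)
    (h : ∀ y : Fin n → ℂ, Function.Injective y → l (∏ s, ((Gp b) ^ a).eval (C (y s))) = 0)
    (j : Fin n → ℕ) : l (∏ s, cc a b (j s)) = 0 := by
  classical
  let T := Fintype.piFinset fun _ : Fin n => Finset.range (a * b + 1)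
  have hp : (∑ k ∈ T, monomial (Finsupp.equivFunOnFinite.symm k) (l (∏ s, cc a b (k s))) :
      MvPolynomial (Fin n) ℂ) = 0 := by
    refine eq_zero_of_eval_injective fun y hy => ?_
    rw [← h y hy]
    simp only [eval_C_eq_sum_cc]
    rw [Finset.prod_univ_sum, map_sum, map_sum]
    refine Finset.sum_congr rfl fun k _ => ?_
    rw [eval_monomial, Finset.prod_smul, map_smul, smul_eq_mul, mul_comm,
      Finsupp.prod_fintype _ _ (by simp)]
    rfl
  by_cases hj : j ∈ T
  · have := congrArg (coeff (Finsupp.equivFunOnFinite.symm j)) hp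
    rw [coeff_sum, coeff_zero, Finset.sum_eq_single j] at this
    · simpa [coeff_monomial] using this
    · intro k _ hk
      rw [coeff_monomial, if_neg (by simpa using hk)]
    · exact fun h => absurd hj h
  · simp only [T, Fintype.mem_piFinset, Finset.mem_range, not_forall] at hj
    obtain ⟨s, hs⟩ := hj
    rw [Finset.prod_eq_zero (Finset.mem_univ s) (cc_of_lt (by omega)), map_zero]

end Interpolation

section Functional
variable {N c : ℕ}

variable (N) in
/-- The first coefficients of a polynomial. -/
noncomputable def coeffVec : Polynomial ℂ →ₗ[ℂ] (Fin N → ℂ) :=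
  LinearMap.pi fun r => Polynomial.lcoeff ℂ r

variable (f : (Fin N → ℂ) [⋀^Fin c]→ₗ[ℂ] ℂ)

/-- An alternating form on vectors of coefficients, as a functional on multivariate polynomials. -/
noncomputable def formFun : MvPolynomial (Fin c) ℂ →ₗ[ℂ] ℂ :=
  (basisMonomials (Fin c) ℂ).constr ℂ fun m => f fun l => coeffVec N (Polynomial.X ^ m l)

theorem formFun_prod (p : Fin c → Polynomial ℂ) :
    formFun f (∏ l, Polynomial.aeval (X l) (p l)) = f fun l => coeffVec N (p l) := by
  have h : (formFun f).compMultilinearMap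
      ((MultilinearMap.mkPiAlgebra ℂ (Fin c) (MvPolynomial (Fin c) ℂ)).compLinearMap
        fun l => (Polynomial.aeval (X l : MvPolynomial (Fin c) ℂ)).toLinearMap) =
      f.toMultilinearMap.compLinearMap fun _ => coeffVec N := by
    refine Module.Basis.ext_multilinear (fun _ => Polynomial.basisMonomials ℂ) fun m => ?_
    simp only [LinearMap.compMultilinearMap_apply, MultilinearMap.compLinearMap_apply,
      MultilinearMap.mkPiAlgebra_apply, Polynomial.coe_basisMonomials, AlgHom.toLinearMap_apply,
      Polynomial.monomial_one_right_eq_X_pow, map_pow, Polynomial.aeval_X]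
    have : (∏ l, X l ^ m l : MvPolynomial (Fin c) ℂ) =
        basisMonomials (Fin c) ℂ (Finsupp.equivFunOnFinite.symm m) := by
      simp only [coe_basisMonomials]
      rw [monomial_eq, C_1, one_mul, Finsupp.prod_fintype _ _ (by simp)]
      rfl
    rw [this, formFun, Module.Basis.constr_basis]
    rfl
  exact DFunLike.congr_fun h p

/-- The value of the form on the shifts of a polynomial. -/
noncomputable def shiftForm (F : Polynomial ℂ) : ℂ :=
  f fun l => coeffVec N (F * Polynomial.X ^ (l : ℕ))

/-- The specialisation of the generic polynomial to a polynomial with generic roots. -/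
noncomputable def rootSpec (c : ℕ) : MvPolynomial (Fin (c + 1)) ℂ →ₐ[ℂ] MvPolynomial (Fin c) ℂ :=
  aeval fun k => (∏ l : Fin c, (Polynomial.C (X l : MvPolynomial (Fin c) ℂ) - Polynomial.X)).coeff k

theorem rootSpec_eval (z : ℂ) :
    rootSpec c ((Gp c).eval (C z)) = ∏ l : Fin c, (X l - C z) := by
  have h1 : (Gp c).map (rootSpec c : MvPolynomial (Fin (c + 1)) ℂ →+* MvPolynomial (Fin c) ℂ) =
      ∏ l : Fin c, (Polynomial.C (X l : MvPolynomial (Fin c) ℂ) - Polynomial.X) := by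
    ext1 i
    rw [Polynomial.coeff_map, Gp_coeff, uu]
    split_ifs with h
    · rw [RingHom.coe_coe, rootSpec, aeval_X]
    · rw [map_zero, Polynomial.coeff_eq_zero_of_natDegree_lt]
      refine (Polynomial.natDegree_prod_le _ _).trans_lt ?_
      refine (Finset.sum_le_card_nsmul _ _ 1 fun l _ => ?_).trans_lt (?_ : _ < i)
      · exact (Polynomial.natDegree_sub_le _ _).trans (by simp)
      · simp; omega
  have h2 := congrArg (Polynomial.eval (C z)) h1
  rw [Polynomial.eval_map, Polynomial.eval_prod] at h2
  have h3 : (C z : MvPolynomial (Fin c) ℂ) =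
      (rootSpec c : MvPolynomial (Fin (c + 1)) ℂ →+* MvPolynomial (Fin c) ℂ) (C z) := by
    rw [RingHom.coe_coe]; exact (rootSpec c).commutes z |>.symm
  rw [h3, Polynomial.eval₂_at_apply, ← h3] at h2
  simpa using h2

/-- The functional on polynomials in the coefficients of the generic polynomial. -/
noncomputable def symFun : MvPolynomial (Fin (c + 1)) ℂ →ₗ[ℂ] ℂ :=
  formFun f ∘ₗ LinearMap.mulRight ℂ (∏ l : Fin c, X l ^ (l : ℕ)) ∘ₗ (rootSpec c).toLinearMap

theorem symFun_prod_eval {ι : Type*} [Fintype ι] (t : ι → ℂ) :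
    symFun f (∏ i, (Gp c).eval (C (t i))) =
      shiftForm f (∏ i, (Polynomial.X - Polynomial.C (t i))) := by
  rw [shiftForm, ← formFun_prod, symFun]
  simp only [LinearMap.comp_apply, AlgHom.toLinearMap_apply, map_prod, rootSpec_eval,
    LinearMap.mulRight_apply, map_mul, map_pow, map_sub, Polynomial.aeval_X, Polynomial.aeval_C]
  rw [Finset.prod_comm, ← Finset.prod_mul_distrib]
  rfl

theorem shiftForm_prod_eq_zero {a : ℕ} (hstar : ∀ P : MvPolynomial (Fin (c + 1)) ℂ,
      P.IsHomogeneous (a * (c + 1)) → P ∈ ccIdeal a c ^ (c + 1))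
    (hf : ∀ y : Fin (c + 1) → ℂ, Function.Injective y → shiftForm f (rootPoly y ^ a) = 0)
    (t : Fin (a * (c + 1)) → ℂ) :
    shiftForm f (∏ i, (Polynomial.X - Polynomial.C (t i))) = 0 := by
  rw [← symFun_prod_eval]
  have hhom : (∏ i, (Gp c).eval (C (t i))).IsHomogeneous (a * (c + 1)) := by
    have := IsHomogeneous.prod Finset.univ (fun i => (Gp c).eval (C (t i))) (fun _ => 1) fun i _ => by
      rw [Gp, Polynomial.eval_finsetSum]
      refine IsHomogeneous.sum _ _ _ fun j _ => ?_
      rw [Polynomial.eval_mul, Polynomial.eval_C, Polynomial.eval_pow, Polynomial.eval_X, ← C_pow,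
        mul_comm]
      exact (uu_isHomogeneous _ _).C_mul _
    simpa using this
  refine map_eq_zero_of_mem_ccSpan_pow (symFun f) (map_prod_cc_eq_zero _ fun y hy => ?_)
    (mem_ccSpan_pow (hstar _ hhom) hhom)
  rw [← hf y hy]
  have := symFun_prod_eval f (fun p : Fin (c + 1) × Fin a => y p.1)
  rw [Fintype.prod_prod_type, Fintype.prod_prod_type] at this
  simp only [Finset.prod_const, Finset.card_univ, Fintype.card_fin] at this
  simpa only [Polynomial.eval_pow, rootPoly, Finset.prod_pow] using this

theorem shiftForm_smul (z : ℂ) (F : Polynomial ℂ) :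
    shiftForm f (Polynomial.C z * F) = z ^ c * shiftForm f F := by
  have := f.map_smul_univ (fun _ => z) fun l => coeffVec N (F * Polynomial.X ^ (l : ℕ))
  simp only [Finset.prod_const, Finset.card_univ, Fintype.card_fin, smul_eq_mul] at this
  rw [shiftForm, shiftForm, ← this]
  congr 1
  funext l
  rw [← map_smul, Polynomial.smul_eq_C_mul, mul_assoc]

theorem shiftForm_eq_zero {a : ℕ} (hstar : ∀ P : MvPolynomial (Fin (c + 1)) ℂ,
      P.IsHomogeneous (a * (c + 1)) → P ∈ ccIdeal a c ^ (c + 1))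
    (hf : ∀ y : Fin (c + 1) → ℂ, Function.Injective y → shiftForm f (rootPoly y ^ a) = 0)
    {F : Polynomial ℂ} (hF : F.natDegree = a * (c + 1)) : shiftForm f F = 0 := by
  have h := IsAlgClosed.splits F
  have h1 := h.eq_prod_roots
  have h2 : F.roots.card = a * (c + 1) := by rw [← hF]; exact h.natDegree_eq_card_roots.symm
  obtain ⟨t, ht⟩ : ∃ t : Fin (a * (c + 1)) → ℂ, F.roots = Finset.univ.val.map t := by
    have hl : F.roots.toList.length = a * (c + 1) := by rw [Multiset.length_toList, h2]
    refine ⟨fun i => F.roots.toList.get (i.cast hl.symm), ?_⟩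
    rw [Fin.univ_val_map]
    conv_lhs => rw [← Multiset.coe_toList F.roots]
    congr 1
    refine List.ext_get (by simp [hl]) fun i h1 h2 => by simp
  rw [h1, shiftForm_smul, ht, Multiset.map_map]
  have := shiftForm_prod_eq_zero f hstar hf t
  rw [Finset.prod_eq_multiset_prod] at this
  rw [Function.comp_def, this, mul_zero]

end Functional

section Rearrange

theorem add_le_of_strictMono {c : ℕ} {r : Fin c → ℕ} (hr : StrictMono r) (k : ℕ) (l : Fin c)
    (h : l + k < c) : r l + k ≤ r ⟨l + k, h⟩ := by
  induction k with
  | zero => simp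
  | succ k ih =>
    have h1 := ih (by omega)
    have h2 : r ⟨l + k, by omega⟩ < r ⟨l + (k + 1), h⟩ := hr (by simp [Fin.lt_def])
    omega

theorem exists_perm_of_sum_single_eq {α ι : Type*} [Fintype ι] {s t : ι → α}
    (h : ∑ l, Finsupp.single (s l) 1 = ∑ l, Finsupp.single (t l) (1 : ℕ)) :
    ∃ σ : Equiv.Perm ι, t ∘ σ = s := by
  classical
  have e : ∀ x, Nonempty ({l // s l = x} ≃ {l // t l = x}) := fun x => by
    refine Fintype.card_eq.1 ?_
    have h1 := DFunLike.congr_fun h x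
    simp only [Finsupp.finsetSum_apply, Finsupp.single_apply, Finset.sum_boole] at h1
    rw [Fintype.card_subtype, Fintype.card_subtype]
    exact_mod_cast h1
  exact ⟨Equiv.ofFiberEquiv fun x => (e x).some, funext fun l => Equiv.ofFiberEquiv_map _ l⟩

theorem sum_sq_lt_of_perm {c : ℕ} {s : Fin c → ℕ} (hs : Monotone s) {σ : Equiv.Perm (Fin c)}
    (h : s ∘ σ ≠ s) : ∑ l, (s (σ l) + l) ^ 2 < ∑ l, (s l + l) ^ 2 := by
  have hm : Monovary (fun l : Fin c => (l : ℕ)) s := by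
    intro i j hij
    exact (not_le.1 fun h => absurd (hs h) (not_le.2 hij)).le
  have h1 := hm.sum_mul_comp_perm_lt_sum_mul_iff (σ := σ) |>.2 fun h2 => h ?_
  · have h3 : ∑ l, s (σ l) ^ 2 = ∑ l, s l ^ 2 := Equiv.sum_comp σ fun l => s l ^ 2
    have e : ∀ t : Fin c → ℕ, ∑ l : Fin c, (t l + l) ^ 2 =
        ∑ l, t l ^ 2 + 2 * ∑ l : Fin c, (l : ℕ) * t l + ∑ l : Fin c, (l : ℕ) ^ 2 := fun t => by
      rw [Finset.mul_sum, ← Finset.sum_add_distrib, ← Finset.sum_add_distrib]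
      exact Finset.sum_congr rfl fun l _ => by ring
    rw [e fun l => s (σ l), e s, h3]
    omega
  · have h4 : Monotone (s ∘ σ) := by
      intro i j hij
      by_contra hlt
      have := h2 (not_le.1 hlt)
      have h5 : i = j := le_antisymm hij this
      rw [h5] at hlt
      exact hlt le_rfl
    exact Tuple.unique_monotone (f := s) (σ := σ) (τ := 1) h4 hs

end Rearrange

section Leading
variable {d c : ℕ} (f : (Fin (d + c) → ℂ) [⋀^Fin c]→ₗ[ℂ] ℂ)

/-- The generic value of `shiftForm`. -/
noncomputable def shiftPoly : MvPolynomial (Fin (d + 1)) ℂ :=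
  ∑ s : Fin c → Fin (d + 1), C (f fun l => coeffVec (d + c) (Polynomial.X ^ ((s l : ℕ) + l))) *
    ∏ l, X (s l)

theorem eval_shiftPoly (x : Fin (d + 1) → ℂ) :
    eval x (shiftPoly f) = shiftForm f (∑ i, Polynomial.C (x i) * Polynomial.X ^ (i : ℕ)) := by
  have e : ∀ l : Fin c, coeffVec (d + c)
      ((∑ i, Polynomial.C (x i) * Polynomial.X ^ (i : ℕ)) * Polynomial.X ^ (l : ℕ)) =
      ∑ i : Fin (d + 1), x i • coeffVec (d + c) (Polynomial.X ^ ((i : ℕ) + l)) := by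
    intro l
    rw [Finset.sum_mul, map_sum]
    refine Finset.sum_congr rfl fun i _ => ?_
    rw [← map_smul, Polynomial.smul_eq_C_mul, pow_add, mul_assoc]
  simp only [shiftForm, e]
  rw [← AlternatingMap.coe_multilinearMap, MultilinearMap.map_sum, shiftPoly, map_sum]
  refine Finset.sum_congr rfl fun s _ => ?_
  rw [MultilinearMap.map_smul_univ, map_mul, eval_C, map_prod, smul_eq_mul, mul_comm]
  simp only [eval_X, AlternatingMap.coe_multilinearMap]

theorem shiftPoly_eq_zero (h : ∀ F : Polynomial ℂ, F.natDegree = d → shiftForm f F = 0) :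
    shiftPoly f = 0 := by
  refine (mul_eq_zero.1 (?_ : X (Fin.last d) * shiftPoly f = 0)).resolve_left (X_ne_zero _)
  refine MvPolynomial.funext fun x => ?_
  rw [map_mul, map_zero, eval_X]
  by_cases hx : x (Fin.last d) = 0
  · rw [hx, zero_mul]
  rw [eval_shiftPoly, h, mul_zero]
  refine Polynomial.natDegree_eq_of_le_of_coeff_ne_zero ?_ ?_
  · refine Polynomial.natDegree_sum_le_of_forall_le _ _ fun i _ => ?_
    exact (Polynomial.natDegree_C_mul_X_pow_le _ _).trans (by omega)
  · rw [Polynomial.finsetSum_coeff, Finset.sum_eq_single (Fin.last d)]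
    · simpa using hx
    · intro i _ hi
      rw [Polynomial.coeff_C_mul_X_pow, if_neg]
      exact fun h => hi (Fin.ext h.symm)
    · simp

theorem form_X_pow_eq_zero (h : shiftPoly f = 0) (r : Fin c → ℕ) :
    f (fun l => coeffVec (d + c) (Polynomial.X ^ r l)) = 0 := by
  induction hn : ∑ l, r l ^ 2 using Nat.strong_induction_on generalizing r with
  | _ n ih =>
  subst hn
  by_cases hN : ∀ l, r l < d + c
  swap
  · push Not at hN
    obtain ⟨l, hl⟩ := hN
    refine f.map_coord_zero l ?_
    funext i
    have : ((i : ℕ)) ≠ r l := by omega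
    simp [coeffVec, Polynomial.coeff_X_pow, this]
  by_cases hinj : Function.Injective r
  swap
  · rw [Function.Injective] at hinj
    push Not at hinj
    obtain ⟨i, j, h1, h2⟩ := hinj
    exact f.map_eq_zero_of_eq _ (by rw [h1]) h2
  let σ := Tuple.sort r
  have hmono : StrictMono (r ∘ σ) :=
    (Tuple.monotone_sort r).strictMono_of_injective (hinj.comp σ.injective)
  have hperm := f.map_perm (fun l => coeffVec (d + c) (Polynomial.X ^ r l)) σ
  suffices hs : f (fun l => coeffVec (d + c) (Polynomial.X ^ (r ∘ σ) l)) = 0 by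
    have h3 : ((fun l => coeffVec (d + c) (Polynomial.X ^ r l)) ∘ σ) =
      fun l => coeffVec (d + c) (Polynomial.X ^ (r ∘ σ) l) := rfl
    rw [h3, hs] at hperm
    rcases Int.units_eq_one_or (Equiv.Perm.sign σ) with h4 | h4 <;> rw [h4] at hperm <;>
      simpa using hperm.symm
  have hQ : ∑ l, r l ^ 2 = ∑ l, (r ∘ σ) l ^ 2 := (Equiv.sum_comp σ fun l => r l ^ 2).symm
  rw [hQ] at ih
  have hN' : ∀ l, (r ∘ σ) l < d + c := fun l => hN _
  generalize r ∘ σ = t at *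
  have hlow : ∀ l : Fin c, (l : ℕ) ≤ t l := fun l => by
    have := add_le_of_strictMono hmono l ⟨0, l.pos⟩ (by simp)
    have h0 : (⟨(⟨0, l.pos⟩ : Fin c) + (l : ℕ), by simp⟩ : Fin c) = l := Fin.ext (by simp)
    rw [h0] at this
    omega
  have hup : ∀ l : Fin c, t l < l + (d + 1) := fun l => by
    have := add_le_of_strictMono hmono (c - 1 - l) l (by omega)
    have := hN' ⟨l + (c - 1 - l), by omega⟩
    omega
  let s : Fin c → Fin (d + 1) := fun l => ⟨t l - l, by have := hup l; omega⟩
  have hs : ∀ l, (s l : ℕ) + l = t l := fun l => Nat.sub_add_cancel (hlow l)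
  have hsm : Monotone fun l => (s l : ℕ) := by
    intro i j hij
    have h1 : (i : ℕ) ≤ j := hij
    have h2 := add_le_of_strictMono hmono (j - i) i (by omega)
    have h3 : (⟨i + (j - i), by omega⟩ : Fin c) = j := Fin.ext (by simp; omega)
    rw [h3] at h2
    show t i - i ≤ t j - j
    omega
  have hmon : ∀ s : Fin c → Fin (d + 1), (∏ l, X (s l) : MvPolynomial (Fin (d + 1)) ℂ) =
      monomial (∑ l, Finsupp.single (s l) 1) 1 := fun s => by
    rw [monomial_sum_one]; rfl
  have hc := congrArg (coeff (∑ l, Finsupp.single (s l) 1)) h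
  rw [shiftPoly, coeff_sum, coeff_zero, Finset.sum_eq_single s] at hc
  · rw [hmon, coeff_C_mul, coeff_monomial, if_pos rfl, mul_one] at hc
    simpa only [hs] using hc
  · intro s' _ hne
    rw [hmon, coeff_C_mul, coeff_monomial]
    split_ifs with he
    swap
    · rw [mul_zero]
    obtain ⟨τ, hτ⟩ := exists_perm_of_sum_single_eq he
    rw [mul_one]
    refine ih _ ?_ (fun l => (s' l : ℕ) + l) rfl
    have := sum_sq_lt_of_perm hsm (σ := τ) fun h5 => hne (by
      rw [← hτ]
      funext l
      exact Fin.ext (congrFun h5 l))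
    simp only [hs] at this
    refine lt_of_eq_of_lt (Finset.sum_congr rfl fun l _ => ?_) this
    rw [← hτ]; rfl
  · simp

theorem form_eq_zero (h : ∀ F : Polynomial ℂ, F.natDegree = d → shiftForm f F = 0) : f = 0 := by
  refine Module.Basis.ext_alternating (Pi.basisFun ℂ (Fin (d + c))) fun v _ => ?_
  rw [AlternatingMap.zero_apply, ← form_X_pow_eq_zero f (shiftPoly_eq_zero f h) fun l => v l]
  congr 1
  funext l i
  simp only [Pi.basisFun_apply, Pi.single_apply, coeffVec, LinearMap.pi_apply,
    Polynomial.lcoeff_apply, Polynomial.coeff_X_pow, Fin.ext_iff]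

end Leading

section Vac
variable {R O E : Type*} [CommRing R] [IsDomain R] [CharZero R] [LinearOrder O] [Fintype O]
  [DecidableEq E]

theorem wedge_single_vac {k : ℕ} {p : Fin k → O} (hp : Function.Injective p) :
    ∃ ε : R, (ε = 1 ∨ ε = -1) ∧ wedge R O E k (fun l => Pi.single (p l) 1) (vac R E ∅) =
      ε • vac R E (Finset.univ.image p) := by
  induction k with
  | zero => exact ⟨1, Or.inl rfl, by simp [wedge_apply]⟩
  | succ k ih =>
    obtain ⟨ε, hε, h⟩ := ih (p := fun l => p l.succ) (hp.comp (Fin.succ_injective _))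
    refine ⟨ε * fsgn R (p 0) (Finset.univ.image fun l : Fin k => p l.succ), ?_, ?_⟩
    · rw [fsgn]
      rcases hε with rfl | rfl <;>
        rcases neg_one_pow_eq_or R ((Finset.univ.image fun l : Fin k => p l.succ).filter (· < p 0)).card
          with h | h <;> rw [h] <;> simp
    · rw [wedge_succ, Module.End.mul_apply, h, map_smul, cv_vac, Finset.sum_eq_single (p 0),
        Pi.single_eq_same, one_smul, cr_vac, smul_smul]
      · congr 2
        rw [Fin.univ_succ, Finset.cons_eq_insert, Finset.image_insert, Finset.map_eq_image, Finset.image_image]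
        rfl
      · simp only [Finset.mem_image, Finset.mem_univ, true_and, not_exists]
        exact fun l hl => Fin.succ_ne_zero l (hp hl)
      · intro r _ hr
        rw [Pi.single_eq_of_ne hr, zero_smul]
      · simp

end Vac

section Forms
variable {R : Type*} [CommRing R] [IsDomain R] [CharZero R] [Algebra ℂ R]

variable (R) in
/-- Complex vectors, extended by zero, as vectors over an algebra. -/
noncomputable def constVec (N : ℕ) : (Fin N → ℂ) →ₗ[ℂ] (Fin (N + 1) → R) :=
  (snocZero R N).restrictScalars ℂ ∘ₗ (Algebra.linearMap ℂ R).compLeft (Fin N)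

theorem constVec_eq {N : ℕ} {v : Fin N → ℂ} {w : Fin (N + 1) → R} (h : w (Fin.last N) = 0)
    (h' : ∀ i : Fin N, w i.castSucc = algebraMap ℂ R (v i)) : constVec R N v = w := by
  rw [eq_snocZero h]
  simp only [h']
  rfl

/-- The composition of an alternating form over an algebra with a functional. -/
noncomputable def restrictForm {N c : ℕ} (w : (Fin (N + 1) → R) [⋀^Fin c]→ₗ[R] R) (l : R →ₗ[ℂ] ℂ) :
    (Fin N → ℂ) [⋀^Fin c]→ₗ[ℂ] ℂ :=
  { l.compMultilinearMap
      ((w.toMultilinearMap.restrictScalars ℂ).compLinearMap fun _ => constVec R N) with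
    map_eq_zero_of_eq' := fun v i j h hij => by
      have := w.map_eq_zero_of_eq (fun i => constVec R N (v i)) (by rw [h]) hij
      exact (congrArg l this).trans (map_zero l) }

theorem restrictForm_apply {N c : ℕ} (w : (Fin (N + 1) → R) [⋀^Fin c]→ₗ[R] R) (l : R →ₗ[ℂ] ℂ)
    (v : Fin c → Fin N → ℂ) : restrictForm w l v = l (w fun i => constVec R N (v i)) := rfl

end Forms

section Delta
variable {a c : ℕ}

local notation "RR" => MvPolynomial (Fin (c + 1 + 1)) ℂ

theorem deltaP_mem_ccSpan_pow (ha : 1 ≤ a) (hstar : ∀ P : MvPolynomial (Fin (c + 1)) ℂ,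
      P.IsHomogeneous (a * (c + 1)) → P ∈ ccIdeal a c ^ (c + 1))
    {P : Finset (Fin (a * (c + 1) + c + 1))} (hP : P.card = c)
    (hl : Fin.last (a * (c + 1) + c) ∉ P) :
    deltaP a (c + 1) (a * (c + 1) + c) P ∈ ccSpan a (c + 1) ^ c := by
  by_contra hne
  obtain ⟨l, hl1, hl2⟩ := Submodule.exists_le_ker_of_notMem hne
  let w : (Fin (a * (c + 1) + c + 1) → RR) [⋀^Fin c]→ₗ[RR] RR :=
    ((delta a (c + 1) (a * (c + 1) + c)).comp (LinearMap.applyₗ (vac _ _ ∅))).compAlternatingMap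
      (wedge RR _ _ c)
  have hw : ∀ n, w n = delta a (c + 1) (a * (c + 1) + c) (wedge RR _ _ c n (vac _ _ ∅)) :=
    fun n => rfl
  have h0 : restrictForm w l = 0 := by
    refine form_eq_zero _ fun F hF => shiftForm_eq_zero (a := a) _ hstar (fun y hy => ?_) hF
    rw [shiftForm, restrictForm_apply, hw]
    refine hl2 ?_
    have := delta_wedge_rootPoly_mem ha hy
    have hfun : ∀ i : Fin c, constVec RR _ (coeffVec _ (rootPoly y ^ a * Polynomial.X ^ (i : ℕ))) =
        fun r : Fin (a * (c + 1) + c + 1) =>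
          C ((rootPoly y ^ a * Polynomial.X ^ (i : ℕ)).coeff r) := by
      intro i
      refine constVec_eq ?_ fun j => rfl
      rw [Polynomial.coeff_eq_zero_of_natDegree_lt, C_0]
      rw [natDegree_rootPoly_pow_mul, Fin.val_last]
      omega
    simp only [hfun]
    exact this
  let p : Fin c → Fin (a * (c + 1) + c + 1) := P.orderEmbOfFin hP
  have hpl : ∀ i, p i ≠ Fin.last _ := fun i h =>
    hl (h ▸ P.orderEmbOfFin_mem hP i)
  obtain ⟨ε, hε, h⟩ := wedge_single_vac (R := RR) (E := Fin (a * (c + 1) + 1)) (p := p)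
    (P.orderEmbOfFin hP).injective
  have hpP : Finset.univ.image p = P := by
    rw [← Finset.coe_inj, Finset.coe_image, Finset.coe_univ, Set.image_univ]
    exact P.range_orderEmbOfFin hP
  have h1 := DFunLike.congr_fun h0 fun i => Pi.single ((p i).castPred (hpl i)) 1
  rw [restrictForm_apply, AlternatingMap.zero_apply] at h1
  have h2 : ∀ i, constVec RR _ (Pi.single ((p i).castPred (hpl i)) 1) = Pi.single (p i) 1 := by
    intro i
    refine constVec_eq ?_ fun j => ?_
    · rw [Pi.single_eq_of_ne (hpl i).symm]
    · rw [Pi.single_apply, Pi.single_apply]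
      have : j.castSucc = p i ↔ j = (p i).castPred (hpl i) := by
        rw [Fin.ext_iff, Fin.ext_iff]
        rfl
      simp only [this]
      split_ifs <;> simp
  simp only [h2] at h1
  rw [hw, h, hpP, map_smul, delta_vac] at h1
  refine hl1 ?_
  rcases hε with rfl | rfl
  · simpa using h1
  · simpa using h1

end Delta

section Induction
variable {a : ℕ}

theorem mem_ccIdeal_pow_of_le {c n : ℕ} (ha : 1 ≤ a)
    (hstar : ∀ P : MvPolynomial (Fin (c + 1)) ℂ,
      P.IsHomogeneous (a * (c + 1)) → P ∈ ccIdeal a c ^ (c + 1))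
    (hn : a * (c + 1) - 1 ≤ n) {P : MvPolynomial (Fin (c + 1 + 1)) ℂ} (hP : P.IsHomogeneous n) :
    P ∈ ccIdeal a (c + 1) ^ c := by
  have hN : a * (c + 1) + c + 1 = a * (c + 1) + (c + 1) := rfl
  obtain ⟨r, rfl⟩ := exists_eq_sum_deltaP ha (Nat.succ_pos c) hN hn hP
  refine Ideal.sum_mem _ fun Q _ => Ideal.mul_mem_left _ _ ?_
  by_cases h : Q.card + 1 = c + 1 ∧ Fin.last _ ∉ Q
  · exact ccSpan_pow_le c (deltaP_mem_ccSpan_pow ha hstar (Nat.succ_injective h.1) h.2)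
  · rw [deltaP_eq_zero ha (Nat.succ_pos c) hN h]
    exact zero_mem _

theorem mem_of_isHomogeneous_add {σ : Type*} {J : Ideal (MvPolynomial σ ℂ)} {n m : ℕ}
    (h : ∀ P : MvPolynomial σ ℂ, P.IsHomogeneous n → P ∈ J) {P : MvPolynomial σ ℂ}
    (hP : P.IsHomogeneous (n + m)) : P ∈ J := by
  have : P ∈ homogeneousSubmodule σ ℂ n * homogeneousSubmodule σ ℂ m := by
    rw [← homogeneousSubmodule_one_pow ℂ n, ← homogeneousSubmodule_one_pow ℂ m, ← pow_add,
      homogeneousSubmodule_one_pow]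
    exact hP
  exact Submodule.mul_induction_on this
    (fun x hx y _ => Ideal.mul_mem_right _ _ (h x hx)) fun x y hx hy => Ideal.add_mem _ hx hy

theorem mem_ccIdeal_pow_succ (ha : 1 ≤ a) (b : ℕ) : ∀ P : MvPolynomial (Fin (b + 1)) ℂ,
    P.IsHomogeneous (a * (b + 1)) → P ∈ ccIdeal a b ^ (b + 1) := by
  induction b with
  | zero =>
    intro P hP
    replace hP : P.IsHomogeneous a := by simpa using hP
    suffices h : P ∈ ccIdeal a 0 by simpa using h
    rw [P.as_sum]
    refine Ideal.sum_mem _ fun m hm => ?_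
    have hd : m 0 = a := by
      have := hP (mem_support_iff.1 hm)
      simpa [Finsupp.weight_apply, Finsupp.sum_fintype] using this
    have h0 : (X 0 : MvPolynomial (Fin (0 + 1)) ℂ) ^ a ∈ ccIdeal a 0 := by
      have := cc_mem (a := a) (b := 0) 0
      rw [cc, Fin.val_zero, Polynomial.coeff_zero_eq_eval_zero, Polynomial.eval_pow,
        ← Polynomial.coeff_zero_eq_eval_zero, Gp_coeff] at this
      rwa [← uu_fin]
    rw [monomial_eq, Finsupp.prod_fintype _ _ (by simp), Fin.prod_univ_one, hd]
    exact Ideal.mul_mem_left _ _ h0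
  | succ c ih =>
    intro P hP
    have h1 : ∀ P : MvPolynomial (Fin (c + 1 + 1)) ℂ, P.IsHomogeneous (a * (c + 1)) →
        P ∈ ccIdeal a (c + 1) ^ (c + 1) := fun P hP =>
      mem_ccIdeal_pow_of_pred ha (Nat.succ_pos c) hP
        (mem_ccIdeal_pow_of_le ha ih (Nat.sub_le _ _) hP)
    have h2 : P ∈ ccIdeal a (c + 1) :=
      mem_of_isHomogeneous_add (n := a * (c + 1)) (m := a)
        (fun P hP => Ideal.pow_le_self (Nat.succ_ne_zero c) (h1 P hP)) hP
    obtain ⟨h, hh, rfl⟩ := exists_eq_sum_cmon_of_isHomogeneous (k := 1) (n := a * (c + 1))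
      (by rwa [pow_one]) (by convert hP using 1; ring)
    refine Ideal.sum_mem _ fun q hq => ?_
    rw [pow_succ]
    refine Ideal.mul_mem_mul (h1 _ (hh q)) ?_
    have := cmon_mem (q := q)
    rwa [(Finset.mem_piAntidiag.1 hq).1, pow_one] at this

theorem card_piAntidiag_univ (n k : ℕ) :
    (Finset.piAntidiag (Finset.univ : Finset (Fin (n + 1))) k).card = (n + k).choose k := by
  rw [← Fintype.card_coe, Fintype.card_congr ((Equiv.subtypeEquivRight (by simp)).trans
    (Sym.equivNatSumOfFintype (Fin (n + 1)) k).symm), Sym.card_sym_eq_choose, Fintype.card_fin]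
  congr 1
  omega

theorem mem_span_deltaP {c : ℕ} (ha : 1 ≤ a) {p : MvPolynomial (Fin (c + 1 + 1)) ℂ}
    (hp : p ∈ ccIdeal a (c + 1) ^ c) : ∃ r : Finset (Fin (a * (c + 1) + c + 1)) → _,
      p = ∑ P, r P * deltaP a (c + 1) (a * (c + 1) + c) P := by
  classical
  have hN : a * (c + 1) + c + 1 = a * (c + 1) + (c + 1) := rfl
  set S : Finset (Finset (Fin (a * (c + 1) + c + 1))) :=
    Finset.powersetCard c (Finset.univ.erase (Fin.last _)) with hS
  have hSm : ∀ P ∈ S, P.card + 1 = c + 1 ∧ Fin.last _ ∉ P := by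
    intro P hP
    rw [hS, Finset.mem_powersetCard] at hP
    exact ⟨by rw [hP.2], fun h => Finset.notMem_erase _ _ (hP.1 h)⟩
  let D : S → MvPolynomial (Fin (c + 1 + 1)) ℂ := fun P => deltaP a (c + 1) (a * (c + 1) + c) P
  have hD : LinearIndependent ℂ D := by
    rw [Fintype.linearIndependent_iff]
    intro g hg P
    have := eq_zero_of_sum_deltaP_eq_zero ha (Nat.succ_pos c) hN
      (κ := fun P => if h : P ∈ S then g ⟨P, h⟩ else 0) ?_ (hSm _ P.2)
    · simpa using this
    · rw [← hg, ← Finset.sum_subset (Finset.subset_univ S), ← Finset.sum_coe_sort]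
      · refine Finset.sum_congr rfl fun P _ => ?_
        rw [dif_pos P.2, smul_eq_C_mul]
      · intro P _ hP
        rw [dif_neg hP, C_0, zero_mul]
  set W : Submodule ℂ (MvPolynomial (Fin (c + 1 + 1)) ℂ) := Submodule.span ℂ
    ((Finset.piAntidiag Finset.univ c).image (cmon (a := a) (b := c + 1))) with hW
  have hle : Submodule.span ℂ (Set.range D) ≤ W := by
    rw [Submodule.span_le]
    rintro _ ⟨P, rfl⟩
    have h1 := hSm _ P.2
    obtain ⟨h, h0, hsum⟩ := exists_eq_sum_cmon_of_isHomogeneous (n := 0)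
      (ccSpan_pow_le c (deltaP_mem_ccSpan_pow ha (mem_ccIdeal_pow_succ ha c)
        (Nat.succ_injective h1.1) h1.2))
      (by rw [zero_add]; exact deltaP_isHomogeneous ha (Nat.succ_pos c) hN _)
    change deltaP _ _ _ _ ∈ W
    rw [hsum]
    refine sum_mem fun q hq => ?_
    rw [totalDegree_eq_zero_iff_eq_C.1 (Nat.le_zero.1 (h0 q).totalDegree_le), ← smul_eq_C_mul]
    exact Submodule.smul_mem _ _ (Submodule.subset_span (Finset.mem_image_of_mem _ hq))
  have heq : Submodule.span ℂ (Set.range D) = W := by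
    refine Submodule.eq_of_le_of_finrank_le hle ?_
    rw [finrank_span_eq_card hD, Fintype.card_coe, hS, Finset.card_powersetCard,
      Finset.card_erase_of_mem (Finset.mem_univ _), Finset.card_univ, Fintype.card_fin,
      Nat.add_sub_cancel, ← card_piAntidiag_univ]
    exact (finrank_span_finset_le_card _).trans Finset.card_image_le
  have hmem : ∀ q ∈ Finset.piAntidiag Finset.univ c, cmon (a := a) (b := c + 1) q ∈
      Ideal.span (Set.range (deltaP a (c + 1) (a * (c + 1) + c))) := by
    intro q hq
    have : cmon q ∈ W := Submodule.subset_span (Finset.mem_image_of_mem _ hq)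
    rw [← heq] at this
    refine Submodule.span_le_restrictScalars ℂ _ _ (Submodule.span_mono ?_ this)
    rintro _ ⟨P, rfl⟩
    exact ⟨_, rfl⟩
  obtain ⟨h, rfl⟩ := exists_eq_sum_cmon hp
  have hsp := Ideal.sum_mem _ fun q hq => Ideal.mul_mem_left _ (h q) (hmem q hq)
  obtain ⟨r, hr⟩ := (Ideal.mem_span_range_iff_exists_fun).1 hsp
  exact ⟨r, hr.symm⟩

end Induction

section Forms

theorem coeff_aeval_of_isHomogeneous {S : Type*} [CommRing S] {F : MvPolynomial (Fin 2) S}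
    {d j : ℕ} (hF : F.IsHomogeneous d) (hj : j ≤ d) :
    (aeval ![(Polynomial.X : Polynomial S), 1] F).coeff j =
      F.coeff (Finsupp.single 0 j + Finsupp.single 1 (d - j)) := by
  rw [aeval_def, eval₂_eq', Polynomial.finsetSum_coeff]
  simp only [Fin.prod_univ_two, Matrix.cons_val_zero, Matrix.cons_val_one, one_pow, mul_one,
    Polynomial.algebraMap_eq, Polynomial.coeff_C_mul_X_pow]
  rw [Finset.sum_eq_single (Finsupp.single 0 j + Finsupp.single 1 (d - j))]
  · simp
  · intro m hm hne
    refine if_neg fun h => hne ?_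
    have := hF (mem_support_iff.1 hm)
    simp only [Finsupp.weight_apply, Finsupp.sum_fintype, Fin.sum_univ_two, Pi.one_apply,
      smul_eq_mul, mul_one, implies_true] at this
    ext i
    fin_cases i
    · simp [h]
    · simp; omega
  · intro h
    rw [notMem_support_iff.1 h, ite_self]

theorem genForm_isHomogeneous (b : ℕ) : (genForm b).IsHomogeneous b := by
  refine IsHomogeneous.sum _ _ _ fun i _ => ?_
  have := (((isHomogeneous_X (MvPolynomial (Fin (b + 1)) ℂ) (0 : Fin 2)).pow (i : ℕ)).C_mul
    (X i)).mul ((isHomogeneous_X _ (1 : Fin 2)).pow (b - i))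
  convert this using 1
  omega

theorem aeval_genForm (b : ℕ) :
    aeval ![(Polynomial.X : Polynomial (MvPolynomial (Fin (b + 1)) ℂ)), 1] (genForm b) = Gp b := by
  rw [Gp, Finset.sum_range, genForm, map_sum]
  refine Finset.sum_congr rfl fun i _ => ?_
  simp [uu_fin, algHom_C]

theorem Iab_eq_ccIdeal (a b : ℕ) : Iab a b = ccIdeal a b := by
  have : ∀ j : Fin (a * b + 1), coeffC a b j = cc a b j := by
    intro j
    rw [coeffC, cc, ← aeval_genForm, ← map_pow, coeff_aeval_of_isHomogeneous (d := a * b) _ (by omega)]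
    rw [mul_comm]
    exact (genForm_isHomogeneous b).pow a
  simp only [Iab, ccIdeal, this]

end Forms

end PowCoeff

/-- For `a, b ≥ 2` and `d = ab`: every homogeneous polynomial of degree `≥ d−1`
lies in `I_{a,b}^{b−1}`, and some homogeneous polynomial of degree `d−2` does not.
Hence `reg(I_{a,b}^{b−1}) = d−1`. -/
theorem top_degree_of_Iab_pow_b_sub_one (a b : ℕ) (ha : 2 ≤ a) (hb : 2 ≤ b) :
    (∀ (n : ℕ) (P : MvPolynomial (Fin (b + 1)) ℂ), P.IsHomogeneous n →
      a * b - 1 ≤ n → P ∈ Iab a b ^ (b - 1)) ∧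
    (∃ P : MvPolynomial (Fin (b + 1)) ℂ,
      P.IsHomogeneous (a * b - 2) ∧ P ∉ Iab a b ^ (b - 1)) := by
  rw [PowCoeff.Iab_eq_ccIdeal]
  obtain ⟨c, rfl⟩ : ∃ c, b = c + 1 := Nat.exists_eq_add_of_le' (by omega)
  have ha' : 1 ≤ a := by omega
  refine ⟨fun n P hP hn => PowCoeff.mem_ccIdeal_pow_of_le ha'
    (PowCoeff.mem_ccIdeal_pow_succ ha' c) hn hP, ?_⟩
  obtain ⟨p, hp, hne⟩ := PowCoeff.exists_notMem_span_deltaP (N := a * (c + 1) + c) ha hb rfl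
  refine ⟨p, hp, fun h => ?_⟩
  obtain ⟨r, hr⟩ := PowCoeff.mem_span_deltaP ha' h
  exact hne r hr
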